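/- arXiv:1506.06369 — 2 statements merged into one kernel-verified Lean document; each statement's English description precedes it below -/
import Mathlib

section
/- Every simple connected bridgeless cubic graph on n ≥ 8 vertices has a closed spanning walk (travelling salesman tour) of length at most 1.3·n − 2. -/
open SimpleGraph

variable {V : Type*}

noncomputable def deg (F : SimpleGraph V) (v : V) : ℕ := Nat.card (F.neighborSet v)

def IsCubic (G : SimpleGraph V) : Prop := ∀ v, deg G v = 3

def Bridgeless (G : SimpleGraph V) : Prop := ∀ e : Sym2 V, ¬ G.IsBridge e

def IsEvenFactor (G F : SimpleGraph V) : Prop := F ≤ G ∧ ∀ v, deg F v = 0 ∨ deg F v = 2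

def Is2Factor (G F : SimpleGraph V) : Prop := F ≤ G ∧ ∀ v, deg F v = 2

noncomputable def numIso (F : SimpleGraph V) : ℕ := Nat.card {v : V // deg F v = 0}

def IsCircuitOf (F : SimpleGraph V) (C : Set V) : Prop :=
  ∃ v, deg F v ≠ 0 ∧ C = {u | F.Reachable v u}

noncomputable def numCirc (F : SimpleGraph V) : ℕ := Nat.card {C : Set V // IsCircuitOf F C}

noncomputable def cost [Fintype V] (F : SimpleGraph V) : ℝ :=
  (Fintype.card V : ℝ) + 2 * (numCirc F : ℝ) + (numIso F : ℝ)


namespace CubicTour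

open Finset
open scoped Classical

variable {G : SimpleGraph V}

/-- `PathOn G Z x y`: the vertex set `Z` is spanned by a path of `G` from `x` to `y`. -/
inductive PathOn (G : SimpleGraph V) : Finset V → V → V → Prop
  | single (x : V) : PathOn G {x} x x
  | cons {Z : Finset V} {x z y : V} (hadj : G.Adj x z) (hx : x ∉ Z) (h : PathOn G Z z y) :
      PathOn G (insert x Z) x y

/-- `Cover G S k`: the vertex set `S` is partitioned into cycles of cost `2` and isolated
vertices of cost `1`, with total cost `k`. -/
inductive Cover (G : SimpleGraph V) : Finset V → ℕ → Prop
  | empty : Cover G ∅ 0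
  | vertex {S : Finset V} {k : ℕ} {v : V} (hv : v ∉ S) (h : Cover G S k) :
      Cover G (insert v S) (k + 1)
  | cycle {S Z : Finset V} {k : ℕ} {x y : V} (hp : PathOn G Z x y) (hxy : G.Adj y x)
      (hd : Disjoint Z S) (h : Cover G S k) : Cover G (Z ∪ S) (k + 2)

/-- `PathCover G S x y k`: the vertex set `S` is partitioned into a path from `x` to `y` and
a cover of cost `k`. -/
def PathCover (G : SimpleGraph V) (S : Finset V) (x y : V) (k : ℕ) : Prop :=
  ∃ Z R, PathOn G Z x y ∧ Cover G R k ∧ Disjoint Z R ∧ Z ∪ R = S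

/-- `Link G A u v k`: the vertices `u` and `v` are joined through `A`, either by an edge when
`A` is empty, or by a path cover of `A` of cost `k`. -/
def Link (G : SimpleGraph V) (A : Finset V) (u v : V) (k : ℕ) : Prop :=
  (A = ∅ ∧ G.Adj u v) ∨ ∃ a b, G.Adj u a ∧ G.Adj b v ∧ PathCover G A a b k

lemma PathOn.append {Z W : Finset V} {x a b y : V} (h : PathOn G Z x a) (hab : G.Adj a b)
    (h' : PathOn G W b y) (hd : Disjoint Z W) : PathOn G (Z ∪ W) x y := by
  induction h with
  | single x =>
    rw [singleton_union]
    exact .cons hab (by simpa using hd) h'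
  | cons hadj hx _ ih =>
    rw [disjoint_insert_left] at hd
    rw [insert_union]
    exact .cons hadj (by simp [hx, hd.1]) (ih hab hd.2)

lemma PathOn.symm {Z : Finset V} {x y : V} (h : PathOn G Z x y) : PathOn G Z y x := by
  induction h with
  | single x => exact .single x
  | @cons Z x z y hadj hx _ ih =>
    rw [insert_eq, union_comm]
    exact ih.append hadj.symm (.single x) (by simpa using hx)

lemma Cover.union {S T : Finset V} {k l : ℕ} (h : Cover G S k) (h' : Cover G T l)
    (hd : Disjoint S T) : Cover G (S ∪ T) (k + l) := by
  induction h with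
  | empty => simpa using h'
  | @vertex S k v hv _ ih =>
    rw [disjoint_insert_left] at hd
    rw [insert_union, add_right_comm]
    exact .vertex (by simp [hv, hd.1]) (ih hd.2)
  | @cycle S Z k x y hp hxy hd' _ ih =>
    rw [disjoint_union_left] at hd
    rw [union_assoc, add_right_comm]
    exact .cycle hp hxy (by simp [hd', hd.1]) (ih hd.2)

lemma PathCover.single (x : V) : PathCover G {x} x x 0 :=
  ⟨{x}, ∅, .single x, .empty, by simp, by simp⟩

lemma PathCover.symm {S : Finset V} {x y : V} {k : ℕ} (h : PathCover G S x y k) :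
    PathCover G S y x k := by
  obtain ⟨Z, R, hp, hc, hd, hu⟩ := h
  exact ⟨Z, R, hp.symm, hc, hd, hu⟩

lemma PathCover.union_cover {S T : Finset V} {x y : V} {k l : ℕ} (h : PathCover G S x y k)
    (h' : Cover G T l) (hd : Disjoint S T) : PathCover G (S ∪ T) x y (k + l) := by
  obtain ⟨Z, R, hp, hc, hd', rfl⟩ := h
  rw [disjoint_union_left] at hd
  exact ⟨Z, R ∪ T, hp, hc.union h' hd.2, by simp [hd', hd.1], by rw [union_assoc]⟩

lemma PathCover.append {S T : Finset V} {x a b y : V} {k l : ℕ} (h : PathCover G S x a k)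
    (hab : G.Adj a b) (h' : PathCover G T b y l) (hd : Disjoint S T) :
    PathCover G (S ∪ T) x y (k + l) := by
  obtain ⟨Z, R, hp, hc, hd₁, rfl⟩ := h
  obtain ⟨W, Q, hp', hc', hd₂, rfl⟩ := h'
  simp only [disjoint_union_left, disjoint_union_right] at hd
  refine ⟨Z ∪ W, R ∪ Q, hp.append hab hp' hd.1.1, hc.union hc' hd.2.2, ?_, ?_⟩
  · simp only [disjoint_union_left, disjoint_union_right]
    exact ⟨⟨hd₁, hd.1.2.symm⟩, hd.2.1, hd₂⟩
  · exact union_union_union_comm _ _ _ _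

lemma PathCover.close {S : Finset V} {x y : V} {k : ℕ} (h : PathCover G S x y k)
    (hxy : G.Adj y x) : Cover G S (k + 2) := by
  obtain ⟨Z, R, hp, hc, hd, rfl⟩ := h
  exact .cycle hp hxy hd hc

lemma Link.symm {A : Finset V} {u v : V} {k : ℕ} (h : Link G A u v k) : Link G A v u k := by
  obtain ⟨h, h'⟩ | ⟨a, b, ha, hb, h⟩ := h
  · exact .inl ⟨h, h'.symm⟩
  · exact .inr ⟨b, a, hb.symm, ha.symm, h.symm⟩

lemma Link.extend {S A T : Finset V} {x u v y : V} {j k i : ℕ} (h : PathCover G S x u j)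
    (hA : Link G A u v k) (h' : PathCover G T v y i) (hSA : Disjoint S A) (hST : Disjoint S T)
    (hAT : Disjoint A T) : ∃ l ≤ j + k + i, PathCover G (S ∪ A ∪ T) x y l := by
  obtain ⟨rfl, hadj⟩ | ⟨a, b, ha, hb, hA⟩ := hA
  · exact ⟨j + i, by omega, by simpa using h.append hadj h' hST⟩
  · exact ⟨_, le_rfl, (h.append ha hA hSA).append hb h' (by simp [hST, hAT])⟩

lemma Link.close {S A : Finset V} {x y : V} {j k : ℕ} (h : PathCover G S x y j)
    (hA : Link G A y x k) (hSA : Disjoint S A) : ∃ l ≤ j + k + 2, Cover G (S ∪ A) l := by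
  obtain ⟨rfl, hadj⟩ | ⟨a, b, ha, hb, hA⟩ := hA
  · exact ⟨j + 2, by omega, by simpa using h.close hadj⟩
  · exact ⟨_, le_rfl, (h.append ha hA hSA).close hb⟩

lemma Link.append_pathCover {A K : Finset V} {u l r : V} {i k : ℕ} (hA : Link G A u l i)
    (hK : PathCover G K l r k) (hAK : Disjoint A K) :
    ∃ a, G.Adj u a ∧ ∃ m ≤ i + k, PathCover G (A ∪ K) a r m := by
  obtain ⟨rfl, hadj⟩ | ⟨a, b, ha, hb, hA⟩ := hA
  · exact ⟨l, hadj, k, by omega, by simpa using hK⟩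
  · exact ⟨a, ha, _, le_rfl, hA.append hb hK hAK⟩

lemma Link.concat {A K C : Finset V} {u l r v : V} {i k j : ℕ} (hA : Link G A u l i)
    (hK : PathCover G K l r k) (hC : Link G C r v j) (hAK : Disjoint A K) (hAC : Disjoint A C)
    (hKC : Disjoint K C) : ∃ m ≤ i + k + j, Link G (A ∪ K ∪ C) u v m := by
  obtain ⟨a, ha, m, hm, h⟩ := hA.append_pathCover hK hAK
  obtain ⟨b, hb, n, hn, h'⟩ :=
    hC.symm.append_pathCover h.symm (by simp [hAC.symm, hKC.symm])
  exact ⟨n, by omega, .inr ⟨a, b, ha, hb.symm, by rw [union_comm]; exact h'.symm⟩⟩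


/-- The number of pairs in `X × Y` that are adjacent in `G`. -/
noncomputable def edgeCount (G : SimpleGraph V) (X Y : Finset V) : ℕ :=
  ∑ u ∈ X, ∑ v ∈ Y, if G.Adj u v then 1 else 0

lemma edgeCount_comm (X Y : Finset V) : edgeCount G X Y = edgeCount G Y X := by
  unfold edgeCount
  rw [sum_comm]
  simp only [G.adj_comm]

lemma edgeCount_eq_sum (X Y : Finset V) :
    edgeCount G X Y = ∑ u ∈ X, edgeCount G {u} Y := by
  simp [edgeCount]

lemma edgeCount_add_sdiff_left {X S : Finset V} (h : X ⊆ S) (Z : Finset V) :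
    edgeCount G X Z + edgeCount G (S \ X) Z = edgeCount G S Z := by
  unfold edgeCount
  rw [add_comm, sum_sdiff h]

lemma edgeCount_add_sdiff_right {X S : Finset V} (h : X ⊆ S) (Z : Finset V) :
    edgeCount G Z X + edgeCount G Z (S \ X) = edgeCount G Z S := by
  simp only [edgeCount_comm Z]
  exact edgeCount_add_sdiff_left h Z

lemma edgeCount_singleton_self (x : V) : edgeCount G {x} {x} = 0 := by
  simp [edgeCount]

lemma edgeCount_erase {S : Finset V} {x : V} (h : x ∈ S) (Z : Finset V) :
    edgeCount G Z (S.erase x) + edgeCount G Z {x} = edgeCount G Z S := by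
  rw [erase_eq, add_comm]
  exact edgeCount_add_sdiff_right (by simpa using h) Z

lemma edgeCount_singleton_singleton (u v : V) :
    edgeCount G {u} {v} = if G.Adj u v then 1 else 0 := by
  rw [edgeCount, sum_singleton, sum_singleton]

lemma edgeCount_mono_left {X Y : Finset V} (h : X ⊆ Y) (Z : Finset V) :
    edgeCount G X Z ≤ edgeCount G Y Z := by
  rw [← edgeCount_add_sdiff_left h]
  omega

lemma edgeCount_mono_right {X Y : Finset V} (h : X ⊆ Y) (Z : Finset V) :
    edgeCount G Z X ≤ edgeCount G Z Y := by
  rw [← edgeCount_add_sdiff_right h]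
  omega

lemma exists_of_sum_eq_one {X : Finset V} {f : V → ℕ} (h : ∑ u ∈ X, f u = 1) :
    ∃ a ∈ X, ∀ v ∈ X, f v = if v = a then 1 else 0 := by
  obtain ⟨a, ha, hfa⟩ : ∃ a ∈ X, f a ≠ 0 := by
    by_contra! hc
    simp [sum_eq_zero hc] at h
  have hsum := add_sum_erase X f ha
  refine ⟨a, ha, fun v hv => ?_⟩
  split_ifs with hva
  · subst hva
    omega
  · have := single_le_sum (f := f) (fun _ _ => Nat.zero_le _) (mem_erase.2 ⟨hva, hv⟩)
    omega

lemma exists_adj_of_edgeCount_eq_one {X Y : Finset V} (h : edgeCount G X Y = 1) :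
    ∃ a ∈ X, ∃ b ∈ Y, G.Adj a b ∧ (∀ v ∈ X, edgeCount G {v} Y = if v = a then 1 else 0) ∧
      ∀ v ∈ Y, edgeCount G {v} X = if v = b then 1 else 0 := by
  have h' := h
  rw [edgeCount_eq_sum] at h
  rw [edgeCount_comm, edgeCount_eq_sum] at h'
  obtain ⟨a, ha, hX⟩ := exists_of_sum_eq_one h
  obtain ⟨b, hb, hY⟩ := exists_of_sum_eq_one h'
  refine ⟨a, ha, b, hb, ?_, hX, hY⟩
  have hsum := hX a ha
  rw [edgeCount_comm, edgeCount_eq_sum, if_pos rfl] at hsum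
  obtain ⟨c, hc, hcY⟩ := exists_of_sum_eq_one hsum
  have hca : edgeCount G {c} {a} = 1 := by rw [hcY c hc, if_pos rfl]
  have hcb : c = b := by
    by_contra hne
    have := hY c hc
    rw [if_neg hne] at this
    have := edgeCount_mono_right (G := G) (singleton_subset_iff.2 ha) {c}
    omega
  subst hcb
  rw [edgeCount_singleton_singleton] at hca
  exact (by simpa using hca : G.Adj c a).symm

lemma exists_neighbors_of_edgeCount_eq_two {x : V} {S : Finset V}
    (h : edgeCount G {x} S = 2) :
    ∃ a ∈ S, ∃ b ∈ S, a ≠ b ∧ G.Adj x a ∧ G.Adj x b ∧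
      ∀ v ∈ S, edgeCount G {v} {x} = (if v = a then 1 else 0) + if v = b then 1 else 0 := by
  rw [edgeCount_comm, edgeCount_eq_sum] at h
  simp only [edgeCount_singleton_singleton] at h ⊢
  rw [← card_filter, card_eq_two] at h
  obtain ⟨a, b, hab, h⟩ := h
  have ha : a ∈ ({a, b} : Finset V) := by simp
  have hb : b ∈ ({a, b} : Finset V) := by simp
  rw [← h, mem_filter] at ha hb
  refine ⟨a, ha.1, b, hb.1, hab, ha.2.symm, hb.2.symm, fun v hv => ?_⟩
  have hiff : G.Adj v x ↔ v = a ∨ v = b := by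
    have := congrArg (v ∈ ·) h
    simpa [hv] using this
  by_cases hva : v = a
  · subst hva
    simp [hiff, hab]
  · simp [hiff, hva]

/-- `S` induces a subgraph without bridges and with at most one component. -/
def Block (G : SimpleGraph V) (S : Finset V) : Prop :=
  ∀ X ⊆ S, X.Nonempty → (S \ X).Nonempty → 2 ≤ edgeCount G X (S \ X)

/-- `T` induces a connected subgraph all of whose bridges separate `a` from `b`, and adding one
to the degrees of `a` and of `b` gives the degree function `g`, which is at most three. -/
structure Chain (G : SimpleGraph V) (g : V → ℕ) (T : Finset V) (a b : V) : Prop where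
  left_mem : a ∈ T
  right_mem : b ∈ T
  connected : ∀ X ⊆ T, X.Nonempty → (T \ X).Nonempty → 1 ≤ edgeCount G X (T \ X)
  two_le : ∀ X ⊆ T, X.Nonempty → a ∉ X → b ∉ X → 2 ≤ edgeCount G X (T \ X)
  degree : ∀ v ∈ T,
    edgeCount G {v} T + (if v = a then 1 else 0) + (if v = b then 1 else 0) = g v
  le_three : ∀ v ∈ T, g v ≤ 3

variable {g : V → ℕ}

lemma Chain.symm {T : Finset V} {a b : V} (h : Chain G g T a b) : Chain G g T b a where
  left_mem := h.right_mem
  right_mem := h.left_mem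
  connected := h.connected
  two_le X hX hne ha hb := h.two_le X hX hne hb ha
  degree v hv := by rw [add_right_comm]; exact h.degree v hv
  le_three := h.le_three

/-- The part of a chain before a bridge is a chain. -/
lemma Chain.prefix {T X : Finset V} {a b c : V} (h : Chain G g T a b) (hX : X ⊆ T)
    (ha : a ∈ X) (hb : b ∉ X) (hc : c ∈ X)
    (hcut : ∀ v ∈ X, edgeCount G {v} (T \ X) = if v = c then 1 else 0) :
    Chain G g X a c := by
  have key : ∀ Z ⊆ X, c ∉ Z → edgeCount G Z (X \ Z) = edgeCount G Z (T \ Z) := by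
    intro Z hZ hcZ
    have h0 : edgeCount G Z (T \ X) = 0 := by
      rw [edgeCount_eq_sum]
      refine sum_eq_zero fun v hv => ?_
      rw [hcut v (hZ hv), if_neg (by rintro rfl; exact hcZ hv)]
    have h1 := edgeCount_add_sdiff_right (G := G) (sdiff_subset_sdiff hX (Subset.refl Z)) Z
    rw [show (T \ Z) \ (X \ Z) = T \ X from ?_] at h1
    · omega
    · ext v
      have := @hZ v
      simp only [mem_sdiff]
      tauto
  have conn : ∀ Z ⊆ X, Z.Nonempty → c ∉ Z → 1 ≤ edgeCount G Z (X \ Z) := by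
    intro Z hZ hne hcZ
    rw [key Z hZ hcZ]
    exact h.connected Z (hZ.trans hX) hne ⟨c, by simp [hX hc, hcZ]⟩
  refine ⟨ha, hc, fun Z hZ hne hne' => ?_, fun Z hZ hne haZ hcZ => ?_, fun v hv => ?_,
    fun v hv => h.le_three v (hX hv)⟩
  · by_cases hcZ : c ∈ Z
    · have := conn (X \ Z) sdiff_subset hne' (by simp [hcZ])
      rwa [Finset.sdiff_sdiff_eq_self hZ, edgeCount_comm] at this
    · exact conn Z hZ hne hcZ
  · rw [key Z hZ hcZ]
    exact h.two_le Z (hZ.trans hX) hne haZ fun hbZ => hb (hZ hbZ)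
  · have h1 := edgeCount_add_sdiff_right (G := G) hX {v}
    have h2 := h.degree v (hX hv)
    rw [hcut v hv] at h1
    rw [if_neg (by rintro rfl; exact hb hv : v ≠ b)] at h2
    omega

/-- A chain that is not a block splits at a bridge. -/
lemma Chain.exists_split {T : Finset V} {a b : V} (h : Chain G g T a b) (hT : ¬ Block G T) :
    ∃ X Y c d, Disjoint X Y ∧ X ∪ Y = T ∧ G.Adj c d ∧ Chain G g X a c ∧ Chain G g Y d b := by
  obtain ⟨X, hX, haX, hbX, hcut⟩ :
      ∃ X ⊆ T, a ∈ X ∧ b ∉ X ∧ edgeCount G X (T \ X) = 1 := by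
    unfold Block at hT
    push Not at hT
    obtain ⟨X, hX, hne, hne', hlt⟩ := hT
    have hge := h.connected X hX hne hne'
    have hcomm : edgeCount G (T \ X) (T \ (T \ X)) = edgeCount G X (T \ X) := by
      rw [Finset.sdiff_sdiff_eq_self hX, edgeCount_comm]
    have ha := h.left_mem
    have hb := h.right_mem
    by_cases haX : a ∈ X <;> by_cases hbX : b ∈ X
    · have := h.two_le (T \ X) sdiff_subset hne' (by simp [haX]) (by simp [hbX])
      omega
    · exact ⟨X, hX, haX, hbX, by omega⟩
    · exact ⟨T \ X, sdiff_subset, by simp [ha, haX], by simp [hbX], by omega⟩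
    · have := h.two_le X hX hne haX hbX
      omega
  obtain ⟨c, hc, d, hd, hadj, hcX, hdY⟩ := exists_adj_of_edgeCount_eq_one hcut
  refine ⟨X, T \ X, c, d, disjoint_sdiff, union_sdiff_of_subset hX, hadj,
    h.prefix hX haX hbX hc hcX, ?_⟩
  refine (h.symm.prefix sdiff_subset (by simp [h.right_mem, hbX]) (by simp [haX]) hd ?_).symm
  rwa [Finset.sdiff_sdiff_eq_self hX]

/-- A subset of a block joined to the rest by two edges induces a chain. -/
lemma Block.chain_of_subset {S T : Finset V} {a b : V} (h : Block G S) (hT : T ⊆ S)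
    (hne : (S \ T).Nonempty) (hle : ∀ v ∈ S, edgeCount G {v} S ≤ 3) (ha : a ∈ T) (hb : b ∈ T)
    (hN : ∀ v ∈ T, edgeCount G {v} (S \ T) = (if v = a then 1 else 0) + if v = b then 1 else 0) :
    Chain G (fun v => edgeCount G {v} S) T a b := by
  have hcount : ∀ X ⊆ T, edgeCount G X (T \ X) + edgeCount G X (S \ T) =
      edgeCount G X (S \ X) := by
    intro X hX
    have heq : (S \ X) \ (T \ X) = S \ T := by
      ext v
      have := @hX v
      simp only [mem_sdiff]
      tauto
    rw [← edgeCount_add_sdiff_right (sdiff_subset_sdiff hT (Subset.refl X)), heq]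
  have hsum : ∀ X ⊆ T, edgeCount G X (S \ T) =
      (if a ∈ X then 1 else 0) + if b ∈ X then 1 else 0 := by
    intro X hX
    rw [edgeCount_eq_sum, sum_congr rfl fun v hv => hN v (hX hv), sum_add_distrib,
      sum_ite_eq', sum_ite_eq']
  have hcut : ∀ X ⊆ T, X.Nonempty → 2 ≤ edgeCount G X (S \ X) := fun X hX hXne =>
    h X (hX.trans hT) hXne (hne.mono (sdiff_subset_sdiff (Subset.refl S) hX))
  have conn : ∀ X ⊆ T, X.Nonempty → a ∉ X → 1 ≤ edgeCount G X (T \ X) := by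
    intro X hX hXne haX
    have h₁ := hcount X hX
    have h₂ := hsum X hX
    have h₃ := hcut X hX hXne
    rw [if_neg haX] at h₂
    split_ifs at h₂ <;> omega
  refine ⟨ha, hb, fun X hX hXne hXne' => ?_, fun X hX hXne haX hbX => ?_, fun v hv => ?_,
    fun v hv => hle v (hT hv)⟩
  · by_cases haX : a ∈ X
    · have := conn _ sdiff_subset hXne' (by simp [haX])
      rwa [Finset.sdiff_sdiff_eq_self hX, edgeCount_comm] at this
    · exact conn X hX hXne haX
  · have h₁ := hcount X hX
    have h₂ := hsum X hX
    have h₃ := hcut X hX hXne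
    rw [if_neg haX, if_neg hbX] at h₂
    omega
  · have := hN v hv
    have := edgeCount_add_sdiff_right (G := G) hT {v}
    omega

/-- Deleting a vertex of degree two from a block leaves a chain. -/
lemma Block.exists_chain_erase {S : Finset V} {x : V} (h : Block G S) (hx : x ∈ S)
    (hdeg : edgeCount G {x} S = 2) (hle : ∀ v ∈ S, edgeCount G {v} S ≤ 3) :
    ∃ a b, G.Adj x a ∧ G.Adj x b ∧
      Chain G (fun v => edgeCount G {v} S) (S.erase x) a b := by
  obtain ⟨a, ha, b, hb, -, hxa, hxb, hN⟩ := exists_neighbors_of_edgeCount_eq_two hdeg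
  have hx' : S \ S.erase x = {x} := by
    rw [erase_eq, Finset.sdiff_sdiff_eq_self (by simpa using hx)]
  refine ⟨a, b, hxa, hxb, h.chain_of_subset (erase_subset _ _) (by simp [hx']) hle
    (mem_erase.2 ⟨hxa.ne', ha⟩) (mem_erase.2 ⟨hxb.ne', hb⟩) fun v hv => ?_⟩
  rw [hx', hN v (mem_of_mem_erase hv)]

/-- A sequence of blocks joined by bridges, leading from `a` to `b`. -/
inductive Necklace (G : SimpleGraph V) (g : V → ℕ) : Finset V → V → V → Prop
  | block {K : Finset V} {a b : V} (hK : Block G K) (h : Chain G g K a b) : Necklace G g K a b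
  | append {X Y : Finset V} {a c d b : V} (hX : Necklace G g X a c) (hcd : G.Adj c d)
      (hY : Necklace G g Y d b) (hd : Disjoint X Y) : Necklace G g (X ∪ Y) a b

lemma Chain.necklace {T : Finset V} {a b : V} (h : Chain G g T a b) : Necklace G g T a b := by
  induction T using Finset.strongInduction generalizing a b with
  | H T ih =>
    by_cases hT : Block G T
    · exact .block hT h
    · obtain ⟨X, Y, c, d, hd, rfl, hcd, hX, hY⟩ := h.exists_split hT
      refine .append (ih X ?_ hX) hcd (ih Y ?_ hY) hd
      · exact Finset.ssubset_iff_subset_ne.2 ⟨subset_union_left, fun he =>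
          disjoint_left.1 hd (he ▸ mem_union_right _ hY.left_mem) hY.left_mem⟩
      · exact Finset.ssubset_iff_subset_ne.2 ⟨subset_union_right, fun he =>
          disjoint_left.1 hd hX.left_mem (he ▸ mem_union_left _ hX.left_mem)⟩

lemma Necklace.symm {T : Finset V} {a b : V} (h : Necklace G g T a b) : Necklace G g T b a := by
  induction h with
  | block hK h => exact .block hK h.symm
  | append _ hcd _ hd ihX ihY =>
    rw [union_comm]
    exact .append ihY hcd.symm ihX hd.symm

/-- The vertices `u` and `v` are joined by an edge when `A` is empty, or by a necklace on `A`. -/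
def NecklaceLink (G : SimpleGraph V) (g : V → ℕ) (A : Finset V) (u v : V) : Prop :=
  (A = ∅ ∧ G.Adj u v) ∨ ∃ a b, G.Adj u a ∧ G.Adj b v ∧ Necklace G g A a b

lemma NecklaceLink.symm {A : Finset V} {u v : V} (h : NecklaceLink G g A u v) :
    NecklaceLink G g A v u := by
  obtain ⟨h, h'⟩ | ⟨a, b, ha, hb, h⟩ := h
  · exact .inl ⟨h, h'.symm⟩
  · exact .inr ⟨b, a, hb.symm, ha.symm, h.symm⟩

lemma NecklaceLink.snoc {A T : Finset V} {u d b v : V} (h : NecklaceLink G g A u d)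
    (hT : Necklace G g T d b) (hbv : G.Adj b v) (hd : Disjoint A T) :
    NecklaceLink G g (A ∪ T) u v := by
  obtain ⟨rfl, hadj⟩ | ⟨a, c, ha, hc, h⟩ := h
  · exact .inr ⟨d, b, hadj, hbv, by simpa using hT⟩
  · exact .inr ⟨a, b, ha, hbv, .append h hc hT hd⟩

/-- The set `T` splits into the disjoint parts `A`, `B`, `C`. -/
structure Splits (T A B C : Finset V) : Prop where
  left_mid : Disjoint A B
  left_right : Disjoint A C
  mid_right : Disjoint B C
  union_eq : A ∪ B ∪ C = T

lemma Splits.symm {T A B C : Finset V} (h : Splits T A B C) : Splits T C B A :=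
  ⟨h.mid_right.symm, h.left_right.symm, h.left_mid.symm, by
    rw [← h.union_eq, union_comm C, union_comm, union_assoc]⟩

/-- The block of a necklace containing a given vertex. -/
lemma Necklace.exists_block {T : Finset V} {a b u v y : V} (h : Necklace G g T a b)
    (hu : G.Adj u a) (hv : G.Adj b v) (hy : y ∈ T) :
    ∃ A B C l r, Splits T A B C ∧ y ∈ B ∧ Block G B ∧ Chain G g B l r ∧
      NecklaceLink G g A u l ∧ NecklaceLink G g C r v := by
  induction h generalizing u v with
  | @block K a b hK h =>
    exact ⟨∅, K, ∅, a, b, ⟨by simp, by simp, by simp, by simp⟩, hy, hK, h, .inl ⟨rfl, hu⟩,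
      .inl ⟨rfl, hv⟩⟩
  | @append X Y a c d b hX hcd hY hd ihX ihY =>
    obtain hy | hy := mem_union.1 hy
    · obtain ⟨A, B, C, l, r, ⟨hAB, hAC, hBC, rfl⟩, hyB, hB, hch, hA, hC⟩ := ihX hu hcd hy
      simp only [disjoint_union_left] at hd
      refine ⟨A, B, C ∪ Y, l, r, ⟨hAB, ?_, ?_, ?_⟩, hyB, hB, hch, hA, hC.snoc hY hv hd.2⟩
      · simp [hAC, hd.1.1]
      · simp [hBC, hd.1.2]
      · simp [union_assoc]
    · obtain ⟨A, B, C, l, r, ⟨hAB, hAC, hBC, rfl⟩, hyB, hB, hch, hA, hC⟩ := ihY hcd hv hy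
      simp only [disjoint_union_right] at hd
      refine ⟨A ∪ X, B, C, l, r, ⟨?_, ?_, hBC, ?_⟩, hyB, hB, hch,
        (hA.symm.snoc hX.symm hu.symm hd.1.1.symm).symm, hC⟩
      · simp [hAB, hd.1.2]
      · simp [hAC, hd.2]
      · rw [union_comm A X, union_assoc, union_assoc, union_assoc]

lemma NecklaceLink.exists_block {T : Finset V} {u v y : V} (h : NecklaceLink G g T u v)
    (hy : y ∈ T) :
    ∃ A B C l r, Splits T A B C ∧ y ∈ B ∧ Block G B ∧ Chain G g B l r ∧
      NecklaceLink G g A u l ∧ NecklaceLink G g C r v := by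
  obtain ⟨rfl, -⟩ | ⟨a, b, ha, hb, h⟩ := h
  · simp at hy
  · exact h.exists_block ha hb hy

/-- The sum over `A` of the deficiencies `4 - g v`. -/
noncomputable def weight (g : V → ℕ) (A : Finset V) : ℤ := ∑ v ∈ A, (4 - (g v : ℤ))

lemma weight_union {A B : Finset V} (h : Disjoint A B) :
    weight g (A ∪ B) = weight g A + weight g B :=
  sum_union h

/-- The weight of `S` for its induced degrees, minus two. -/
noncomputable def surplus (G : SimpleGraph V) (S : Finset V) : ℤ :=
  weight (fun v => edgeCount G {v} S) S - 2

lemma Chain.surplus_eq {T : Finset V} {a b : V} (h : Chain G g T a b) :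
    surplus G T = weight g T := by
  have hsum : weight (fun v => edgeCount G {v} T) T =
      ∑ v ∈ T, ((4 - (g v : ℤ)) + ((if v = a then 1 else 0) + if v = b then 1 else 0)) := by
    refine sum_congr rfl fun v hv => ?_
    rw [← h.degree v hv]
    push_cast
    ring
  rw [surplus, hsum, sum_add_distrib, sum_add_distrib, sum_ite_eq' T a, sum_ite_eq' T b,
    if_pos h.left_mem, if_pos h.right_mem, weight]
  ring

/-- The least cost of a path cover of `S` from `x` to `y`. -/
noncomputable def minCost (G : SimpleGraph V) (S : Finset V) (x y : V) : ℕ :=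
  sInf {k | PathCover G S x y k}

lemma PathCover.minCost_le {S : Finset V} {x y : V} {k : ℕ} (h : PathCover G S x y k) :
    minCost G S x y ≤ k :=
  Nat.sInf_le h

lemma PathCover.pathCover_minCost {S : Finset V} {x y : V} {k : ℕ} (h : PathCover G S x y k) :
    PathCover G S x y (minCost G S x y) :=
  Nat.sInf_mem (s := {k | PathCover G S x y k}) ⟨k, h⟩

lemma minCost_comm (S : Finset V) (x y : V) : minCost G S x y = minCost G S y x :=
  congrArg sInf (Set.ext fun _ => ⟨PathCover.symm, PathCover.symm⟩)

lemma minCost_singleton (x : V) : minCost G {x} x x = 0 :=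
  Nat.le_zero.1 (PathCover.single x).minCost_le

/-- A block of maximum degree three with two vertices of degree at most two, or a single
vertex. -/
structure Terminal (G : SimpleGraph V) (S : Finset V) (x y : V) : Prop where
  block : Block G S
  left_mem : x ∈ S
  right_mem : y ∈ S
  le_three : ∀ v ∈ S, edgeCount G {v} S ≤ 3
  left_le : x ≠ y → edgeCount G {x} S ≤ 2
  right_le : x ≠ y → edgeCount G {y} S ≤ 2
  eq_singleton : x = y → S = {x}

/-- The bounds on covers and path covers of a block proved by induction. -/
structure Good (G : SimpleGraph V) (S : Finset V) (x y : V) : Prop where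
  pathCover : PathCover G S x y (minCost G S x y)
  four_mul_le : 4 * (minCost G S x y : ℤ) + 2 ≤ surplus G S
  exists_cover : ∃ q : ℕ, Cover G S q ∧ 2 * (minCost G S x y : ℤ) + 2 * q ≤ surplus G S

lemma Block.two_le_degree {S : Finset V} {x : V} (h : Block G S) (hx : x ∈ S) (hne : S ≠ {x}) :
    2 ≤ edgeCount G {x} S := by
  have hsub : ({x} : Finset V) ⊆ S := by simpa using hx
  refine (h {x} hsub (by simp) ?_).trans (edgeCount_mono_right sdiff_subset _)
  rw [sdiff_nonempty]
  exact fun hle => hne (hle.antisymm hsub)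

lemma Chain.le_three_induced {T : Finset V} {a b v : V} (h : Chain G g T a b) (hv : v ∈ T) :
    edgeCount G {v} T ≤ 3 := by
  have := h.degree v hv
  have := h.le_three v hv
  omega

lemma Chain.left_le_two {T : Finset V} {a b : V} (h : Chain G g T a b) :
    edgeCount G {a} T ≤ 2 := by
  have := h.degree a h.left_mem
  have := h.le_three a h.left_mem
  simp only [if_true] at *
  omega

lemma Chain.eq_singleton {T : Finset V} {a : V} (h : Chain G g T a a) (hT : Block G T) :
    T = {a} := by
  by_contra hne
  have := hT.two_le_degree h.left_mem hne
  have := h.degree a h.left_mem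
  have := h.le_three a h.left_mem
  simp only [if_true] at *
  omega

lemma Chain.terminal {T : Finset V} {a b : V} (h : Chain G g T a b) (hT : Block G T) :
    Terminal G T a b :=
  ⟨hT, h.left_mem, h.right_mem, fun _ hv => h.le_three_induced hv, fun _ => h.left_le_two,
    fun _ => h.symm.left_le_two, fun he => by subst he; exact h.eq_singleton hT⟩

/-- Bounds for path covers and covers of `K`, with discrepancy `t`. -/
def PathBalance (G : SimpleGraph V) (g : V → ℕ) (K : Finset V) (l r : V) (t : ℤ) : Prop :=
  ∃ p q : ℕ, PathCover G K l r p ∧ Cover G K q ∧ 4 * (p : ℤ) + t ≤ weight g K ∧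
    4 * (q : ℤ) ≤ weight g K + t ∧ 2 ≤ t

/-- Bounds for links and covers of `A`, with discrepancy `t`. -/
def LinkBalance (G : SimpleGraph V) (g : V → ℕ) (A : Finset V) (u v : V) (t : ℤ) : Prop :=
  ∃ p q : ℕ, Link G A u v p ∧ Cover G A q ∧ 4 * (p : ℤ) + t ≤ weight g A ∧
    4 * (q : ℤ) ≤ weight g A + t ∧ (A = ∅ ∧ t = 0 ∨ 2 ≤ t)

lemma LinkBalance.symm {A : Finset V} {u v : V} {t : ℤ} (h : LinkBalance G g A u v t) :
    LinkBalance G g A v u t := by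
  obtain ⟨p, q, hp, hq, h⟩ := h
  exact ⟨p, q, hp.symm, hq, h⟩

lemma LinkBalance.nonneg {A : Finset V} {u v : V} {t : ℤ} (h : LinkBalance G g A u v t) :
    0 ≤ t := by
  obtain ⟨p, q, -, -, -, -, h | h⟩ := h <;> omega

lemma LinkBalance.concat {A K C : Finset V} {u l r v : V} {s t t' : ℤ}
    (hA : LinkBalance G g A u l s) (hK : PathBalance G g K l r t)
    (hC : LinkBalance G g C r v t') (hAK : Disjoint A K) (hAC : Disjoint A C)
    (hKC : Disjoint K C) : LinkBalance G g (A ∪ K ∪ C) u v (s + t + t') := by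
  have hs := hA.nonneg
  have ht' := hC.nonneg
  obtain ⟨p₁, q₁, hp₁, hq₁, hA⟩ := hA
  obtain ⟨p₂, q₂, hp₂, hq₂, hK⟩ := hK
  obtain ⟨p₃, q₃, hp₃, hq₃, hC⟩ := hC
  obtain ⟨m, hm, hl⟩ := hp₁.concat hp₂ hp₃ hAK hAC hKC
  have hd : Disjoint (A ∪ K) C := by simp [hAC, hKC]
  refine ⟨m, q₁ + q₂ + q₃, hl, (hq₁.union hq₂ hAK).union hq₃ hd, ?_, ?_, .inr ?_⟩
  · rw [weight_union hd, weight_union hAK]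
    omega
  · rw [weight_union hd, weight_union hAK]
    omega
  · omega

lemma Good.pathBalance {K : Finset V} {l r : V} (hK : Good G K l r) (h : Chain G g K l r) :
    PathBalance G g K l r (surplus G K - 4 * minCost G K l r) := by
  obtain ⟨q, hq, hle⟩ := hK.exists_cover
  have := hK.four_mul_le
  have := h.surplus_eq
  exact ⟨_, q, hK.pathCover, hq, by omega, by omega, by omega⟩

lemma Necklace.exists_pathBalance {n : ℕ}
    (hgood : ∀ S x y, #S < n → Terminal G S x y → Good G S x y) {T : Finset V} {a b : V}
    (h : Necklace G g T a b) (hT : #T < n) : ∃ t, PathBalance G g T a b t := by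
  induction h with
  | block hK h => exact ⟨_, (hgood _ _ _ hT (h.terminal hK)).pathBalance h⟩
  | @append X Y a c d b _ hcd _ hd ihX ihY =>
    obtain ⟨s, p₁, q₁, hp₁, hq₁, h₁⟩ := ihX ((card_le_card subset_union_left).trans_lt hT)
    obtain ⟨t, p₂, q₂, hp₂, hq₂, h₂⟩ := ihY ((card_le_card subset_union_right).trans_lt hT)
    refine ⟨s + t, p₁ + p₂, q₁ + q₂, hp₁.append hcd hp₂ hd, hq₁.union hq₂ hd, ?_⟩
    rw [weight_union hd]
    omega

lemma NecklaceLink.exists_linkBalance {n : ℕ}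
    (hgood : ∀ S x y, #S < n → Terminal G S x y → Good G S x y) {A : Finset V} {u v : V}
    (h : NecklaceLink G g A u v) (hA : #A < n) : ∃ t, LinkBalance G g A u v t := by
  obtain ⟨rfl, hadj⟩ | ⟨a, b, ha, hb, h⟩ := h
  · exact ⟨0, 0, 0, .inl ⟨rfl, hadj⟩, .empty, by simp [weight]⟩
  · obtain ⟨t, p, q, hp, hq, h₁, h₂, h₃⟩ := h.exists_pathBalance hgood hA
    exact ⟨t, p, q, .inr ⟨a, b, ha, hb, hp⟩, hq, h₁, h₂, .inr h₃⟩

/-- A block of maximum degree three with three distinct vertices of degree at most two. -/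
structure Tri (G : SimpleGraph V) (S : Finset V) (x y z : V) : Prop where
  block : Block G S
  le_three : ∀ v ∈ S, edgeCount G {v} S ≤ 3
  mem₁ : x ∈ S
  mem₂ : y ∈ S
  mem₃ : z ∈ S
  le₁ : edgeCount G {x} S ≤ 2
  le₂ : edgeCount G {y} S ≤ 2
  le₃ : edgeCount G {z} S ≤ 2
  ne₁₂ : x ≠ y
  ne₁₃ : x ≠ z
  ne₂₃ : y ≠ z

lemma Tri.swap {S : Finset V} {x y z : V} (h : Tri G S x y z) : Tri G S x z y :=
  ⟨h.block, h.le_three, h.mem₁, h.mem₃, h.mem₂, h.le₁, h.le₃, h.le₂, h.ne₁₃, h.ne₁₂, h.ne₂₃.symm⟩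

/-- The bounds on path covers from `x` to `y` and from `x` to `z` proved by induction. -/
structure TriBound (G : SimpleGraph V) (S : Finset V) (x y z : V) : Prop where
  sum_le : 4 * (minCost G S x y : ℤ) + 4 * minCost G S x z + 8 ≤ 2 * surplus G S
  of_not_adj : ¬ G.Adj y z → 4 * (minCost G S x y : ℤ) + 5 ≤ surplus G S ∨
    4 * (minCost G S x z : ℤ) + 5 ≤ surplus G S

lemma surplus_singleton (x : V) : surplus G {x} = 2 := by
  simp [surplus, weight, edgeCount_singleton_self]

lemma surplus_eq_weight_erase {S : Finset V} {x : V} (hx : x ∈ S)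
    (hdeg : edgeCount G {x} S = 2) :
    surplus G S = weight (fun v => edgeCount G {v} S) (S.erase x) := by
  rw [surplus, weight, weight, ← add_sum_erase S _ hx, hdeg]
  push_cast
  ring

lemma Splits.weight_eq {T A B C : Finset V} (h : Splits T A B C) :
    weight g T = weight g A + weight g B + weight g C := by
  rw [← h.union_eq, weight_union (by simp [h.left_right, h.mid_right]), weight_union h.left_mid]

lemma Splits.left_subset {T A B C : Finset V} (h : Splits T A B C) : A ⊆ T := by
  rw [← h.union_eq, union_assoc]
  exact subset_union_left

lemma Splits.mid_subset {T A B C : Finset V} (h : Splits T A B C) : B ⊆ T := by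
  rw [← h.union_eq]
  exact subset_union_right.trans subset_union_left

lemma Splits.right_subset {T A B C : Finset V} (h : Splits T A B C) : C ⊆ T :=
  h.symm.left_subset

lemma Splits.exists_pathCover {S A B C : Finset V} {x l y : V} {p k q : ℕ} (hx : x ∈ S)
    (h : Splits (S.erase x) A B C) (hA : Link G A x l p) (hB : PathCover G B l y k)
    (hC : Cover G C q) : ∃ m ≤ p + k + q, PathCover G S x y m := by
  have hxA : Disjoint {x} A := by simpa using fun h' => (mem_erase.1 (h.left_subset h')).1 rfl
  have hxB : Disjoint {x} B := by simpa using fun h' => (mem_erase.1 (h.mid_subset h')).1 rfl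
  have hxC : Disjoint {x} C := by simpa using fun h' => (mem_erase.1 (h.right_subset h')).1 rfl
  obtain ⟨m, hm, hp⟩ := Link.extend (.single x) hA hB hxA hxB h.left_mid
  refine ⟨m + q, by omega, ?_⟩
  have := hp.union_cover hC (by simpa [h.left_right, h.mid_right] using hxC)
  rwa [union_assoc, union_assoc, ← union_assoc A, h.union_eq, ← insert_eq,
    insert_erase hx] at this

lemma Splits.exists_cover {S A B C : Finset V} {x l r : V} {p k q : ℕ} (hx : x ∈ S)
    (h : Splits (S.erase x) A B C) (hA : Link G A x l p) (hB : PathCover G B l r k)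
    (hC : Link G C r x q) : ∃ m ≤ p + k + q + 2, Cover G S m := by
  have hxA : Disjoint {x} A := by simpa using fun h' => (mem_erase.1 (h.left_subset h')).1 rfl
  have hxB : Disjoint {x} B := by simpa using fun h' => (mem_erase.1 (h.mid_subset h')).1 rfl
  have hxC : Disjoint {x} C := by simpa using fun h' => (mem_erase.1 (h.right_subset h')).1 rfl
  obtain ⟨m, hm, hp⟩ := Link.extend (.single x) hA hB hxA hxB h.left_mid
  obtain ⟨n, hn, hc⟩ := Link.close hp hC (by simpa [h.left_right, h.mid_right] using hxC)
  refine ⟨n, by omega, ?_⟩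
  rwa [union_assoc, union_assoc, ← union_assoc A, h.union_eq, ← insert_eq,
    insert_erase hx] at hc

lemma Splits.four_mul_minCost_le {S A B C : Finset V} {x l y r : V} {s t : ℤ} (hx : x ∈ S)
    (h : Splits (S.erase x) A B C) (hA : LinkBalance G g A x l s)
    (hB : PathCover G B l y (minCost G B l y)) (hC : LinkBalance G g C r x t) :
    4 * (minCost G S x y : ℤ) + s + weight g B ≤
      weight g (S.erase x) + 4 * minCost G B l y + t := by
  obtain ⟨p, -, hp, -, hA, -, -⟩ := hA
  obtain ⟨-, q, -, hq, -, hC, -⟩ := hC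
  obtain ⟨m, hm, hpath⟩ := h.exists_pathCover hx hp hB hq
  have := hpath.minCost_le
  have := h.weight_eq (g := g)
  omega

/-- In a block of a necklace, a vertex of degree at most two is either the whole block, or
distinct from the two end vertices of the block. -/
lemma Chain.eq_singleton_or_tri {B : Finset V} {l r y : V} (h : Chain G g B l r)
    (hB : Block G B) (hy : y ∈ B) (hle : g y ≤ 2) :
    (B = {y} ∧ l = y ∧ r = y) ∨ (Tri G B l y r ∧ Tri G B r y l) := by
  by_cases hs : B = {y}
  · refine .inl ⟨hs, ?_, ?_⟩
    · simpa [hs] using h.left_mem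
    · simpa [hs] using h.right_mem
  · have h2 := hB.two_le_degree hy hs
    have hdeg := h.degree y hy
    have hl : l ≠ y := by
      rintro rfl
      rw [if_pos rfl] at hdeg
      omega
    have hr : r ≠ y := by
      rintro rfl
      rw [if_pos (rfl : r = r)] at hdeg
      omega
    have hlr : l ≠ r := by
      rintro rfl
      rw [h.eq_singleton hB, mem_singleton] at hy
      exact hl hy.symm
    have hy2 : edgeCount G {y} B ≤ 2 := by omega
    exact .inr ⟨⟨hB, fun v hv => h.le_three_induced hv, h.left_mem, hy, h.right_mem,
      h.left_le_two, hy2, h.symm.left_le_two, hl, hlr, hr.symm⟩,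
      ⟨hB, fun v hv => h.le_three_induced hv, h.right_mem, hy, h.left_mem,
      h.symm.left_le_two, hy2, h.left_le_two, hr, hlr.symm, hl.symm⟩⟩

lemma Tri.terminal {S : Finset V} {x y z : V} (h : Tri G S x y z) : Terminal G S x y :=
  ⟨h.block, h.mem₁, h.mem₂, h.le_three, fun _ => h.le₁, fun _ => h.le₂,
    fun he => absurd he h.ne₁₂⟩

lemma Chain.terminal_of_le {B : Finset V} {l r y : V} (h : Chain G g B l r)
    (hB : Block G B) (hy : y ∈ B) (hle : g y ≤ 2) : Terminal G B l y := by
  obtain ⟨rfl, rfl, rfl⟩ | ⟨ht, -⟩ := h.eq_singleton_or_tri hB hy hle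
  · exact h.terminal hB
  · exact ht.terminal

/-- Around a vertex of degree two of a block there is a closed necklace. -/
lemma Block.exists_splits {S : Finset V} {x y : V} (h : Block G S) (hx : x ∈ S)
    (hdeg : edgeCount G {x} S = 2) (hle : ∀ v ∈ S, edgeCount G {v} S ≤ 3)
    (hy : y ∈ S) (hxy : x ≠ y) :
    ∃ A B C l r, Splits (S.erase x) A B C ∧ y ∈ B ∧ Block G B ∧
      Chain G (fun v => edgeCount G {v} S) B l r ∧
      NecklaceLink G (fun v => edgeCount G {v} S) A x l ∧
      NecklaceLink G (fun v => edgeCount G {v} S) C r x := by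
  obtain ⟨a, b, ha, hb, hch⟩ := h.exists_chain_erase hx hdeg hle
  exact hch.necklace.exists_block ha hb.symm (mem_erase.2 ⟨hxy.symm, hy⟩)

lemma Splits.good {S A B C : Finset V} {x y l r : V} {s t : ℤ}
    (hgood : ∀ S' x y, #S' < #S → Terminal G S' x y → Good G S' x y)
    (htri : ∀ S' x y z, #S' < #S → Tri G S' x y z → TriBound G S' x y z)
    (hx : x ∈ S) (hdeg : edgeCount G {x} S = 2) (hy : edgeCount G {y} S ≤ 2)
    (h : Splits (S.erase x) A B C) (hyB : y ∈ B) (hB : Block G B)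
    (hch : Chain G (fun v => edgeCount G {v} S) B l r)
    (hA : LinkBalance G (fun v => edgeCount G {v} S) A x l s)
    (hC : LinkBalance G (fun v => edgeCount G {v} S) C r x t) (hst : t ≤ s) (hs : B = {y} → 2 ≤ s) :
    Good G S x y := by
  have hBS : #B < #S := (card_le_card h.mid_subset).trans_lt (card_erase_lt_of_mem hx)
  have hly := hgood B l y hBS (hch.terminal_of_le hB hyB hy)
  have hlr := hgood B l r hBS (hch.terminal hB)
  have hkey := h.four_mul_minCost_le hx hA hly.pathCover hC
  have hw := surplus_eq_weight_erase hx hdeg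
  have hwB := hch.surplus_eq
  have hsplit := h.weight_eq (g := fun v => edgeCount G {v} S)
  have h4 := hly.four_mul_le
  have hs0 := hA.nonneg
  obtain ⟨p, -, hp, -, hpA, -, -⟩ := hA
  obtain ⟨p', q', hp', hq', hpC, hqC, -⟩ := hC
  obtain ⟨m, -, hpath⟩ := h.exists_pathCover hx hp hly.pathCover hq'
  obtain ⟨k, hk, hcover⟩ := h.exists_cover hx hp hlr.pathCover hp'
  refine ⟨hpath.pathCover_minCost, by omega, k, hcover, ?_⟩
  obtain ⟨rfl, rfl, rfl⟩ | ⟨ht, -⟩ := hch.eq_singleton_or_tri hB hyB hy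
  · rw [minCost_singleton] at *
    rw [surplus_singleton] at *
    have := hs rfl
    omega
  · have := (htri B l y r hBS ht).sum_le
    omega

lemma Terminal.good {S : Finset V} {x y : V} (h : Terminal G S x y)
    (hgood : ∀ S' x y, #S' < #S → Terminal G S' x y → Good G S' x y)
    (htri : ∀ S' x y z, #S' < #S → Tri G S' x y z → TriBound G S' x y z) :
    Good G S x y := by
  by_cases hxy : x = y
  · have hS := h.eq_singleton hxy
    subst hxy hS
    refine ⟨(PathCover.single x).pathCover_minCost, ?_, 1, by simpa using Cover.empty.vertex, ?_⟩ <;>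
    · rw [minCost_singleton, surplus_singleton]
      norm_num
  · have hx := h.left_mem
    have hy := h.right_mem
    have hdeg : edgeCount G {x} S = 2 := (h.left_le hxy).antisymm
      (h.block.two_le_degree hx (by rintro rfl; simp at hy; exact hxy hy.symm))
    obtain ⟨A, B, C, l, r, hs, hyB, hB, hch, hA, hC⟩ :=
      h.block.exists_splits hx hdeg h.le_three hy hxy
    have hlt := card_erase_lt_of_mem hx
    obtain ⟨s, hbA⟩ := hA.exists_linkBalance hgood ((card_le_card hs.left_subset).trans_lt hlt)
    obtain ⟨t, hbC⟩ := hC.exists_linkBalance hgood ((card_le_card hs.right_subset).trans_lt hlt)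
    have hlarge : B = {y} → 2 ≤ s ∨ 2 ≤ t := by
      intro hBy
      by_contra! hc
      obtain ⟨hs2, ht2⟩ := hc
      have hA0 : A = ∅ := by
        obtain ⟨-, -, -, -, -, -, h0 | h2⟩ := hbA
        · exact h0.1
        · omega
      have hC0 : C = ∅ := by
        obtain ⟨-, -, -, -, -, -, h0 | h2⟩ := hbC
        · exact h0.1
        · omega
      have hSy : S.erase x = {y} := by simp [← hs.union_eq, hA0, hC0, hBy]
      have := edgeCount_erase (G := G) hx {x}
      rw [hSy, edgeCount_singleton_self, edgeCount_singleton_singleton] at this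
      split_ifs at this <;> omega
    rcases le_total t s with hts | hst
    · exact hs.good hgood htri hx hdeg (h.right_le hxy) hyB hB hch hbA hbC hts
        fun hBy => by have := hlarge hBy; omega
    · exact hs.symm.good hgood htri hx hdeg (h.right_le hxy) hyB hB hch.symm hbC.symm hbA.symm hst
        fun hBy => by have := hlarge hBy; omega

lemma Necklace.left_mem {T : Finset V} {a b : V} (h : Necklace G g T a b) : a ∈ T := by
  induction h with
  | block _ h => exact h.left_mem
  | append _ _ _ _ ih _ => exact mem_union_left _ ih

lemma NecklaceLink.adj_of_eq_empty {A : Finset V} {u v : V} (h : NecklaceLink G g A u v)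
    (hA : A = ∅) : G.Adj u v := by
  obtain ⟨-, h⟩ | ⟨a, b, -, -, h⟩ := h
  · exact h
  · simpa [hA] using h.left_mem

lemma LinkBalance.eq_empty {A : Finset V} {u v : V} (h : LinkBalance G g A u v 0) : A = ∅ := by
  obtain ⟨-, -, -, -, -, -, h | h⟩ := h
  · exact h.1
  · omega

/-- The case of two vertices in the same block of the necklace around `x`. -/
lemma Splits.triBound_of_mem {S A B C : Finset V} {x y z l r : V} {s t : ℤ}
    (hgood : ∀ S' x y, #S' < #S → Terminal G S' x y → Good G S' x y)
    (htri : ∀ S' x y z, #S' < #S → Tri G S' x y z → TriBound G S' x y z)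
    (hx : x ∈ S) (hdeg : edgeCount G {x} S = 2) (hy : edgeCount G {y} S ≤ 2)
    (hz : edgeCount G {z} S ≤ 2) (hyz : y ≠ z)
    (h : Splits (S.erase x) A B C) (hyB : y ∈ B) (hzB : z ∈ B) (hB : Block G B)
    (hch : Chain G (fun v => edgeCount G {v} S) B l r)
    (hA : LinkBalance G (fun v => edgeCount G {v} S) A x l s)
    (hC : LinkBalance G (fun v => edgeCount G {v} S) C r x t) (hst : t ≤ s) :
    TriBound G S x y z := by
  have hBS : #B < #S := (card_le_card h.mid_subset).trans_lt (card_erase_lt_of_mem hx)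
  have hly := hgood B l y hBS (hch.terminal_of_le hB hyB hy)
  have hlz := hgood B l z hBS (hch.terminal_of_le hB hzB hz)
  have hkeyy := h.four_mul_minCost_le hx hA hly.pathCover hC
  have hkeyz := h.four_mul_minCost_le hx hA hlz.pathCover hC
  have hw := surplus_eq_weight_erase hx hdeg
  have hwB := hch.surplus_eq
  obtain ⟨rfl, -, -⟩ | ⟨hty, -⟩ := hch.eq_singleton_or_tri hB hyB hy
  · exact absurd (mem_singleton.1 hzB).symm hyz
  obtain ⟨rfl, -, -⟩ | ⟨htz, -⟩ := hch.eq_singleton_or_tri hB hzB hz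
  · exact absurd (mem_singleton.1 hyB) hyz
  have hbound := htri B l y z hBS ⟨hB, hty.le_three, hty.mem₁, hyB, hzB, hty.le₁, hty.le₂,
    htz.le₂, hty.ne₁₂, htz.ne₁₂, hyz⟩
  have hsum := hbound.sum_le
  refine ⟨by omega, fun hadj => (hbound.of_not_adj hadj).imp (fun _ => ?_) fun _ => ?_⟩ <;> omega

/-- The case of two vertices in different blocks of the necklace around `x`. -/
lemma Splits.triBound_of_mem_right {S A B C M K R : Finset V} {x y z l r l' r' : V}
    (hgood : ∀ S' x y, #S' < #S → Terminal G S' x y → Good G S' x y)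
    (htri : ∀ S' x y z, #S' < #S → Tri G S' x y z → TriBound G S' x y z)
    (hx : x ∈ S) (hdeg : edgeCount G {x} S = 2) (hy : edgeCount G {y} S ≤ 2)
    (hz : edgeCount G {z} S ≤ 2)
    (h : Splits (S.erase x) A B C) (hyB : y ∈ B) (hB : Block G B)
    (hchB : Chain G (fun v => edgeCount G {v} S) B l r)
    (h' : Splits C M K R) (hzK : z ∈ K) (hK : Block G K)
    (hchK : Chain G (fun v => edgeCount G {v} S) K l' r')
    (hA : NecklaceLink G (fun v => edgeCount G {v} S) A x l)
    (hM : NecklaceLink G (fun v => edgeCount G {v} S) M r l')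
    (hR : NecklaceLink G (fun v => edgeCount G {v} S) R r' x) :
    TriBound G S x y z := by
  have hlt : ∀ Z ⊆ S.erase x, #Z < #S := fun Z hZ =>
    (card_le_card hZ).trans_lt (card_erase_lt_of_mem hx)
  have hCS := h.right_subset
  have hBS := hlt B h.mid_subset
  have hKS := hlt K (h'.mid_subset.trans hCS)
  obtain ⟨a, hbA⟩ := hA.exists_linkBalance hgood (hlt A h.left_subset)
  obtain ⟨m, hbM⟩ := hM.exists_linkBalance hgood (hlt M (h'.left_subset.trans hCS))
  obtain ⟨c, hbR⟩ := hR.exists_linkBalance hgood (hlt R (h'.right_subset.trans hCS))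
  have hgB := hgood B l r hBS (hchB.terminal hB)
  have hgK := hgood K l' r' hKS (hchK.terminal hK)
  obtain ⟨hAM, hAK, hAR⟩ : Disjoint A M ∧ Disjoint A K ∧ Disjoint A R :=
    ⟨h.left_right.mono_right h'.left_subset, h.left_right.mono_right h'.mid_subset,
      h.left_right.mono_right h'.right_subset⟩
  obtain ⟨hBM, hBK, hBR⟩ : Disjoint B M ∧ Disjoint B K ∧ Disjoint B R :=
    ⟨h.mid_right.mono_right h'.left_subset, h.mid_right.mono_right h'.mid_subset,
      h.mid_right.mono_right h'.right_subset⟩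
  have hsplit : Splits (S.erase x) (A ∪ B ∪ M) K R :=
    ⟨by simp [hAK, hBK, h'.left_mid], by simp [hAR, hBR, h'.left_right], h'.mid_right, by
      rw [← h.union_eq, ← h'.union_eq]; simp only [union_assoc]⟩
  have hbleft := hbA.concat (hgB.pathBalance hchB) hbM h.left_mid hAM hBM
  have hbright := hbM.concat (hgK.pathBalance hchK) hbR h'.left_mid h'.left_right h'.mid_right
  rw [h'.union_eq] at hbright
  have hry := hgood B r y hBS (hchB.symm.terminal_of_le hB hyB hy)
  have hlz := hgood K l' z hKS (hchK.terminal_of_le hK hzK hz)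
  have hkey₁ := h.symm.four_mul_minCost_le hx hbright.symm hry.pathCover hbA.symm
  have hkey₂ := hsplit.four_mul_minCost_le hx hbleft hlz.pathCover hbR
  have hw := surplus_eq_weight_erase hx hdeg
  have hwB := hchB.surplus_eq
  have hwK := hchK.surplus_eq
  have h₁ := hry.four_mul_le
  have h₂ := hlz.four_mul_le
  have hkB := hgB.four_mul_le
  have hkK := hgK.four_mul_le
  have hm := hbM.nonneg
  refine ⟨by omega, fun hadj => ?_⟩
  by_contra! hcon
  obtain ⟨hcy, hcz⟩ := hcon
  have hm0 : m = 0 := by omega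
  subst hm0
  have hrl := hM.adj_of_eq_empty hbM.eq_empty
  obtain ⟨-, -, rfl⟩ | ⟨-, ht⟩ := hchB.eq_singleton_or_tri hB hyB hy
  · obtain ⟨-, rfl, -⟩ | ⟨ht, -⟩ := hchK.eq_singleton_or_tri hK hzK hz
    · exact hadj hrl
    · have := (htri K l' z r' hKS ht).sum_le
      omega
  · have := (htri B r y l hBS ht).sum_le
    rw [minCost_comm B r l] at this
    omega

lemma Tri.triBound {S : Finset V} {x y z : V} (h : Tri G S x y z)
    (hgood : ∀ S' x y, #S' < #S → Terminal G S' x y → Good G S' x y)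
    (htri : ∀ S' x y z, #S' < #S → Tri G S' x y z → TriBound G S' x y z) :
    TriBound G S x y z := by
  have hx := h.mem₁
  have hdeg : edgeCount G {x} S = 2 := h.le₁.antisymm
    (h.block.two_le_degree hx (by rintro rfl; exact h.ne₁₂ (mem_singleton.1 h.mem₂).symm))
  obtain ⟨A, B, C, l, r, hs, hyB, hB, hch, hA, hC⟩ :=
    h.block.exists_splits hx hdeg h.le_three h.mem₂ h.ne₁₂
  have hz : z ∈ S.erase x := mem_erase.2 ⟨h.ne₁₃.symm, h.mem₃⟩
  rw [← hs.union_eq, mem_union, mem_union] at hz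
  obtain (hzA | hzB) | hzC := hz
  · obtain ⟨M, K, R, l', r', hs', hzK, hK, hchK, hM, hR⟩ := hA.symm.exists_block hzA
    exact hs.symm.triBound_of_mem_right hgood htri hx hdeg h.le₂ h.le₃ hyB hB hch.symm hs' hzK
      hK hchK hC.symm hM hR
  · have hlt := card_erase_lt_of_mem hx
    obtain ⟨s, hbA⟩ := hA.exists_linkBalance hgood ((card_le_card hs.left_subset).trans_lt hlt)
    obtain ⟨t, hbC⟩ := hC.exists_linkBalance hgood ((card_le_card hs.right_subset).trans_lt hlt)
    rcases le_total t s with hts | hst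
    · exact hs.triBound_of_mem hgood htri hx hdeg h.le₂ h.le₃ h.ne₂₃ hyB hzB hB hch hbA hbC hts
    · exact hs.symm.triBound_of_mem hgood htri hx hdeg h.le₂ h.le₃ h.ne₂₃ hyB hzB hB hch.symm
        hbC.symm hbA.symm hst
  · obtain ⟨M, K, R, l', r', hs', hzK, hK, hchK, hM, hR⟩ := hC.exists_block hzC
    exact hs.triBound_of_mem_right hgood htri hx hdeg h.le₂ h.le₃ hyB hB hch hs' hzK hK hchK hA
      hM hR

theorem good_and_triBound (S : Finset V) :
    (∀ x y, Terminal G S x y → Good G S x y) ∧ ∀ x y z, Tri G S x y z → TriBound G S x y z := by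
  induction hn : #S using Nat.strong_induction_on generalizing S with
  | _ n ih =>
    subst hn
    have hgood : ∀ S' x y, #S' < #S → Terminal G S' x y → Good G S' x y :=
      fun S' x y hlt => (ih _ hlt S' rfl).1 x y
    have htri : ∀ S' x y z, #S' < #S → Tri G S' x y z → TriBound G S' x y z :=
      fun S' x y z hlt => (ih _ hlt S' rfl).2 x y z
    exact ⟨fun x y h => h.good hgood htri, fun x y z h => h.triBound hgood htri⟩

lemma Chain.exists_pathCover {T : Finset V} {a b : V} (h : Chain G g T a b) :
    ∃ p : ℕ, PathCover G T a b p ∧ 4 * (p : ℤ) + 2 ≤ weight g T := by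
  obtain ⟨t, p, -, hp, -, hle, -, ht⟩ := h.necklace.exists_pathBalance (n := #T + 1)
    (fun S x y _ hS => (good_and_triBound S).1 x y hS) (Nat.lt_succ_self _)
  exact ⟨p, hp, by omega⟩

lemma Tri.pathCover {S : Finset V} {x y z : V} (h : Tri G S x y z) :
    PathCover G S x y (minCost G S x y) :=
  ((good_and_triBound S).1 x y h.terminal).pathCover

lemma PathOn.exists_walk {Z : Finset V} {x y : V} (h : PathOn G Z x y) :
    ∃ w : G.Walk x y, (∀ v ∈ Z, v ∈ w.support) ∧ w.length + 1 = #Z := by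
  induction h with
  | single x => exact ⟨.nil, by simp, by simp⟩
  | cons hadj hx _ ih =>
    obtain ⟨w, hw, hlen⟩ := ih
    refine ⟨.cons hadj w, fun v hv => ?_, ?_⟩
    · rw [mem_insert] at hv
      rw [Walk.support_cons, List.mem_cons]
      exact hv.imp id (hw v)
    · rw [Walk.length_cons, card_insert_of_notMem hx, hlen]

lemma Cover.exists_closedWalks {S : Finset V} {k : ℕ} (h : Cover G S k) :
    ∃ L : List (Σ a, G.Walk a a), (∀ v ∈ S, ∃ w ∈ L, v ∈ w.2.support) ∧
      (L.map fun w => w.2.length + 2).sum = #S + k := by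
  induction h with
  | empty => exact ⟨[], by simp, by simp⟩
  | @vertex S k v hv _ ih =>
    obtain ⟨L, hL, hsum⟩ := ih
    refine ⟨⟨v, .nil⟩ :: L, fun u hu => ?_, ?_⟩
    · obtain rfl | hu := mem_insert.1 hu
      · exact ⟨_, List.mem_cons_self, by simp⟩
      · obtain ⟨w, hw, h⟩ := hL u hu
        exact ⟨w, List.mem_cons_of_mem _ hw, h⟩
    · simp [hsum, card_insert_of_notMem hv]
      omega
  | @cycle S Z k x y hp hxy hd _ ih =>
    obtain ⟨L, hL, hsum⟩ := ih
    obtain ⟨w, hw, hlen⟩ := hp.exists_walk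
    refine ⟨⟨y, .cons hxy w⟩ :: L, fun u hu => ?_, ?_⟩
    · obtain hu | hu := mem_union.1 hu
      · exact ⟨_, List.mem_cons_self, by simp [hw u hu]⟩
      · obtain ⟨w', hw', h⟩ := hL u hu
        exact ⟨w', List.mem_cons_of_mem _ hw', h⟩
    · simp [hsum, card_union_of_disjoint hd, ← hlen]
      omega

/-- Closed walks covering a connected graph can be merged into one, at a cost of two for each
merger. -/
lemma exists_spanning_closedWalk (hconn : G.Connected) (w : Σ a, G.Walk a a)
    (L : List (Σ a, G.Walk a a)) (hL : ∀ v, ∃ w' ∈ w :: L, v ∈ w'.2.support) :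
    ∃ (a : V) (w' : G.Walk a a), (∀ v, v ∈ w'.support) ∧
      w'.length + 2 ≤ ((w :: L).map fun w => w.2.length + 2).sum := by
  induction hn : L.length generalizing w L with
  | zero =>
    rw [List.length_eq_zero_iff] at hn
    subst hn
    exact ⟨w.1, w.2, by simpa using hL, by simp⟩
  | succ n ih =>
    by_cases hall : ∀ v, v ∈ w.2.support
    · exact ⟨w.1, w.2, hall, by simp⟩
    push Not at hall
    obtain ⟨z, hz⟩ := hall
    obtain ⟨p⟩ := hconn.preconnected w.1 z
    obtain ⟨d, -, hd₁, hd₂⟩ := p.exists_boundary_dart {v | v ∈ w.2.support} (by simp) hz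
    rw [Set.mem_ofPred_eq] at hd₁ hd₂
    obtain ⟨w', hw', hdw'⟩ := hL d.snd
    have hmem : w' ∈ L := by
      obtain rfl | h := List.mem_cons.1 hw'
      · exact absurd hdw' hd₂
      · exact h
    obtain ⟨L₁, L₂, rfl⟩ := List.append_of_mem hmem
    let c : G.Walk d.fst d.fst :=
      (w.2.rotate d.fst hd₁).append (.cons d.adj ((w'.2.rotate d.snd hdw').append (.cons d.adj.symm .nil)))
    have hlen : c.length = w.2.length + w'.2.length + 2 := by
      simp [c]
      omega
    have hsupp : ∀ v, v ∈ w.2.support ∨ v ∈ w'.2.support → v ∈ c.support := by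
      rintro v (hv | hv)
      · have := (w.2.mem_support_rotate_iff d.fst hd₁).2 hv
        simp [c, Walk.mem_support_append_iff, this]
      · have := (w'.2.mem_support_rotate_iff d.snd hdw').2 hv
        simp [c, Walk.mem_support_append_iff, this]
    have hcover : ∀ v, ∃ w'' ∈ (⟨d.fst, c⟩ : Σ a, G.Walk a a) :: (L₁ ++ L₂),
        v ∈ w''.2.support := by
      intro v
      obtain ⟨w'', hw'', hv⟩ := hL v
      simp only [List.mem_cons, List.mem_append] at hw''
      obtain rfl | h | rfl | h := hw''
      · exact ⟨_, List.mem_cons_self, hsupp v (.inl hv)⟩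
      · exact ⟨w'', by simp [h], hv⟩
      · exact ⟨_, List.mem_cons_self, hsupp v (.inr hv)⟩
      · exact ⟨w'', by simp [h], hv⟩
    obtain ⟨a, t, ht, hle⟩ := ih ⟨d.fst, c⟩ (L₁ ++ L₂) hcover (by simp at hn ⊢; omega)
    refine ⟨a, t, ht, hle.trans ?_⟩
    simp [hlen]
    omega

lemma Cover.exists_spanning_closedWalk [Fintype V] (hconn : G.Connected) {k : ℕ}
    (h : Cover G univ k) :
    ∃ (a : V) (w : G.Walk a a), (∀ v, v ∈ w.support) ∧ w.length + 2 ≤ Fintype.card V + k := by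
  obtain ⟨L, hL, hsum⟩ := h.exists_closedWalks
  rw [card_univ] at hsum
  rw [← hsum]
  obtain ⟨v⟩ := hconn.nonempty
  cases L with
  | nil => simpa using hL v (mem_univ v)
  | cons w L => exact CubicTour.exists_spanning_closedWalk hconn w L fun v => hL v (mem_univ v)

lemma edgeCount_pos_of_adj {X Y : Finset V} {a b : V} (ha : a ∈ X) (hb : b ∈ Y)
    (h : G.Adj a b) : 1 ≤ edgeCount G X Y := by
  have h₁ := edgeCount_mono_left (G := G) (singleton_subset_iff.2 ha) Y
  have h₂ := edgeCount_mono_right (G := G) (singleton_subset_iff.2 hb) {a}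
  rw [edgeCount_singleton_singleton, if_pos h] at h₂
  omega

lemma eq_ite_add_ite_of_sum_eq_two {X : Finset V} {f : V → ℕ} {a b : V} (ha : a ∈ X)
    (hb : b ∈ X) (hab : a ≠ b) (hfa : 1 ≤ f a) (hfb : 1 ≤ f b) (h : ∑ v ∈ X, f v = 2) :
    ∀ v ∈ X, f v = (if v = a then 1 else 0) + if v = b then 1 else 0 := by
  intro v hv
  have h₁ := add_sum_erase X f ha
  have hb' := mem_erase.2 ⟨hab.symm, hb⟩
  have h₂ := add_sum_erase (X.erase a) f hb'
  by_cases hva : v = a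
  · subst hva
    rw [if_pos rfl, if_neg hab]
    omega
  by_cases hvb : v = b
  · subst hvb
    rw [if_pos rfl, if_neg hva]
    omega
  have h₃ := single_le_sum (f := f) (fun _ _ => Nat.zero_le _)
    (mem_erase.2 ⟨hvb, mem_erase.2 ⟨hva, hv⟩⟩)
  rw [if_neg hva, if_neg hvb]
  omega

section Fintype

variable [Fintype V]

lemma edgeCount_univ_of_isCubic (h : IsCubic G) (v : V) : edgeCount G {v} univ = 3 := by
  rw [← h v, deg, edgeCount, sum_singleton, ← card_filter, Nat.card_eq_fintype_card,
    Fintype.card_subtype]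
  rfl

lemma even_card_of_isCubic (h : IsCubic G) : Even (Fintype.card V) := by
  have hsum := G.sum_degrees_eq_twice_card_edges
  have hdeg : ∀ v, G.degree v = 3 := fun v => by
    rw [← h v, deg, Nat.card_eq_fintype_card, card_neighborSet_eq_degree]
  rw [sum_congr rfl fun v _ => hdeg v, sum_const, card_univ, smul_eq_mul] at hsum
  rw [Nat.even_iff]
  omega

lemma block_univ (hconn : G.Connected) (hb : Bridgeless G) : Block G univ := by
  intro X _ hX hX'
  obtain ⟨u, hu⟩ := hX
  obtain ⟨v, hv⟩ := hX'
  have hvX : v ∉ X := (mem_sdiff.1 hv).2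
  have hpos : 1 ≤ edgeCount G X (univ \ X) := by
    obtain ⟨p⟩ := hconn.preconnected u v
    obtain ⟨d, -, hd₁, hd₂⟩ := p.exists_boundary_dart X hu hvX
    exact edgeCount_pos_of_adj (by simpa using hd₁) (by simpa using hd₂) d.adj
  by_contra hlt
  obtain ⟨a, ha, b, hb', hab, hXa, hXb⟩ :=
    exists_adj_of_edgeCount_eq_one (by omega : edgeCount G X (univ \ X) = 1)
  refine hb s(a, b) (isBridge_iff.2 fun ⟨p⟩ => ?_)
  obtain ⟨d, -, hd₁, hd₂⟩ := p.exists_boundary_dart X ha (by simpa using hb')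
  have hadj := d.adj
  rw [deleteEdges_adj] at hadj
  have hd₂' : d.snd ∈ univ \ X := by simpa using hd₂
  have h₁ := edgeCount_pos_of_adj (mem_singleton_self d.fst) hd₂' hadj.1
  have h₂ := edgeCount_pos_of_adj (mem_singleton_self d.snd) hd₁ hadj.1.symm
  rw [hXa d.fst hd₁] at h₁
  rw [hXb d.snd hd₂'] at h₂
  split_ifs at h₁ h₂ with e₁ e₂
  · exact hadj.2 (by rw [e₁, e₂]; rfl)
  all_goals omega

lemma surplus_eq_of_cubic (h : ∀ v, edgeCount G {v} univ = 3) (T : Finset V) :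
    surplus G T = #T + edgeCount G T (univ \ T) - 2 := by
  have hv : ∀ v ∈ T, (4 - (edgeCount G {v} T : ℤ)) = 1 + (edgeCount G {v} (univ \ T) : ℕ) := by
    intro v _
    have := edgeCount_add_sdiff_right (G := G) (subset_univ T) {v}
    rw [h v] at this
    omega
  rw [surplus, weight, sum_congr rfl hv, sum_add_distrib, sum_const, edgeCount_eq_sum T]
  simp

/-- A set with at most three leaving edges is a block if its proper subsets have at least three
leaving edges. -/
lemma block_of_three_le {T : Finset V} (hT : edgeCount G T (univ \ T) ≤ 3)
    (h : ∀ Z ⊂ T, Z.Nonempty → 3 ≤ edgeCount G Z (univ \ Z)) : Block G T := by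
  have hcount : ∀ Z ⊆ T, edgeCount G Z (T \ Z) + edgeCount G Z (univ \ T) =
      edgeCount G Z (univ \ Z) := by
    intro Z hZ
    have heq : (univ \ Z) \ (T \ Z) = univ \ T := by
      ext v
      have := @hZ v
      simp only [mem_sdiff, mem_univ, true_and]
      tauto
    rw [← edgeCount_add_sdiff_right (sdiff_subset_sdiff (subset_univ T) (Subset.refl Z)), heq]
  intro Z hZ hne hne'
  have h₁ := h Z (hZ.ssubset_of_ne fun he => by simp [he] at hne') hne
  have h₂ := h (T \ Z) (sdiff_ssubset hZ hne) hne'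
  have h₃ := hcount Z hZ
  have h₄ := hcount (T \ Z) sdiff_subset
  have h₅ := edgeCount_add_sdiff_left (G := G) hZ (univ \ T)
  rw [Finset.sdiff_sdiff_eq_self hZ, edgeCount_comm] at h₄
  omega

/-- A cubic graph without small cuts. -/
lemma exists_cover_of_three_le (hcubic : ∀ v, edgeCount G {v} univ = 3)
    (hn : 8 ≤ Fintype.card V)
    (hcut : ∀ X : Finset V, X.Nonempty → (univ \ X).Nonempty → 3 ≤ edgeCount G X (univ \ X)) :
    ∃ k, Cover G univ k ∧ 4 * k ≤ Fintype.card V + 3 := by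
  obtain ⟨x⟩ : Nonempty V := Fintype.card_pos_iff.1 (by omega)
  obtain ⟨y, b₁, b₂, hy, hb₁, hb₂, h₁, h₂, h₃, hadj⟩ : ∃ y b₁ b₂, G.Adj x y ∧ G.Adj x b₁ ∧
      G.Adj x b₂ ∧ y ≠ b₁ ∧ y ≠ b₂ ∧ b₁ ≠ b₂ ∧ ¬ G.Adj b₁ b₂ := by
    have hx := hcubic x
    rw [edgeCount, sum_singleton, ← card_filter, card_eq_three] at hx
    obtain ⟨a, b, c, hab, hac, hbc, hN⟩ := hx
    have hmem : ∀ v, G.Adj x v ↔ v = a ∨ v = b ∨ v = c := fun v => by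
      have := congrArg (v ∈ ·) hN
      simpa using this
    by_contra! hcon
    have ha := (hmem a).2 (by simp)
    have hb := (hmem b).2 (by simp)
    have hc := (hmem c).2 (by simp)
    have hbc' := hcon a b c ha hb hc hab hac hbc
    have hac' := hcon b a c hb ha hc hab.symm hbc hac
    have hab' := hcon c a b hc ha hb hac.symm hbc.symm hab
    have hsum := hcut {x, a, b, c} (by simp) (by
      rw [sdiff_nonempty]
      intro hsub
      have h₁ := card_le_card hsub
      have h₂ := card_le_four (a := x) (b := a) (c := b) (d := c)
      rw [card_univ] at h₁
      omega)
    rw [edgeCount_eq_sum, sum_eq_zero] at hsum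
    · omega
    intro v hv
    have h₁ := edgeCount_add_sdiff_right (G := G) (subset_univ {x, a, b, c}) {v}
    have h₂ : edgeCount G {v} {x, a, b, c} = 3 := by
      have hx1 := ha.ne
      have hx2 := hb.ne
      have hx3 := hc.ne
      rw [edgeCount, sum_singleton, sum_insert (by simp [hx1, hx2, hx3]),
        sum_insert (by simp [hab, hac]), sum_insert (by simp [hbc]), sum_singleton]
      simp only [mem_insert, mem_singleton] at hv
      obtain rfl | rfl | rfl | rfl := hv <;>
      simp [ha, hb, hc, hab', hac', hbc', ha.symm, hb.symm, hc.symm, hab'.symm, hac'.symm,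
        hbc'.symm]
    rw [h₂, hcubic v] at h₁
    omega
  have hx' : univ \ univ.erase x = {x} := by
    rw [erase_eq, Finset.sdiff_sdiff_eq_self (subset_univ _)]
  have hout : edgeCount G (univ.erase x) {x} = 3 := by
    have := edgeCount_erase (G := G) (mem_univ x) {x}
    rw [edgeCount_singleton_self, hcubic x] at this
    rw [edgeCount_comm]
    exact this
  have hblock : Block G (univ.erase x) := block_of_three_le (by rw [hx', hout])
    fun Z hZ hne => hcut Z hne ⟨x, by simpa using fun hxZ => (mem_erase.1 (hZ.1 hxZ)).1 rfl⟩
  have hdeg : ∀ v, G.Adj x v → edgeCount G {v} (univ.erase x) ≤ 2 := by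
    intro v hv
    have := edgeCount_erase (G := G) (mem_univ x) {v}
    rw [edgeCount_singleton_singleton, if_pos hv.symm, hcubic v] at this
    omega
  have hmem : ∀ v, G.Adj x v → v ∈ univ.erase x := fun v hv => by simpa using hv.ne'
  have htri : Tri G (univ.erase x) y b₁ b₂ :=
    ⟨hblock, fun v _ => (edgeCount_mono_right (subset_univ _) _).trans (hcubic v).le, hmem y hy,
      hmem b₁ hb₁, hmem b₂ hb₂, hdeg y hy, hdeg b₁ hb₁, hdeg b₂ hb₂, h₁, h₂, h₃⟩
  have hsurplus := surplus_eq_of_cubic hcubic (univ.erase x)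
  rw [hx', hout, card_erase_of_mem (mem_univ x), card_univ] at hsurplus
  have hclose : ∀ b p, G.Adj x b → PathCover G (univ.erase x) y b p → Cover G univ (p + 2) := by
    intro b p hb hp
    have := (hp.append hb.symm (.single x) (by simp)).close hy
    rwa [union_comm, ← insert_eq, insert_erase (mem_univ x)] at this
  obtain h | h := ((good_and_triBound _).2 _ _ _ htri).of_not_adj hadj
  · exact ⟨_, hclose b₁ _ hb₁ htri.pathCover, by omega⟩
  · exact ⟨_, hclose b₂ _ hb₂ htri.swap.pathCover, by omega⟩

/-- The edges of a two-edge cut in a bridgeless cubic graph are disjoint. -/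
lemma edgeCount_le_one_of_cut (hcubic : ∀ v, edgeCount G {v} univ = 3) (hblock : Block G univ)
    {X : Finset V} (hX : edgeCount G X (univ \ X) = 2) {v : V} (hv : v ∈ X) :
    edgeCount G {v} (univ \ X) ≤ 1 := by
  by_contra! hlt
  have hvX := edgeCount_add_sdiff_right (G := G) (subset_univ X) {v}
  rw [hcubic v] at hvX
  have hsplit := edgeCount_add_sdiff_left (G := G) (singleton_subset_iff.2 hv) (univ \ X)
  have hne : X ≠ {v} := by
    rintro rfl
    rw [edgeCount_singleton_self] at hvX
    omega
  have hvv := edgeCount_erase (G := G) hv {v}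
  rw [edgeCount_singleton_self] at hvv
  have hcut := hblock (X.erase v) (subset_univ _) (by
    rw [nonempty_iff_ne_empty, Ne, erase_eq_empty_iff]
    rintro (rfl | h)
    · simp at hv
    · exact hne h) ⟨v, by simp⟩
  have heq : (univ \ X.erase v) \ (univ \ X) = {v} := by
    ext u
    simp only [mem_sdiff, mem_univ, true_and, mem_erase, mem_singleton]
    by_cases hu : u = v
    · simp [hu, hv]
    · simp [hu]
  rw [← edgeCount_add_sdiff_right (sdiff_subset_sdiff (Subset.refl univ) (erase_subset v X)),
    heq, edgeCount_comm _ {v}, erase_eq] at hcut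
  rw [erase_eq] at hvv
  omega

/-- The two edges of a two-edge cut. -/
lemma exists_matching_of_cut (hcubic : ∀ v, edgeCount G {v} univ = 3) (hblock : Block G univ)
    {X : Finset V} (hX : edgeCount G X (univ \ X) = 2) :
    ∃ x₁ ∈ X, ∃ x₂ ∈ X, ∃ z₁ ∈ univ \ X, ∃ z₂ ∈ univ \ X, x₁ ≠ x₂ ∧ z₁ ≠ z₂ ∧ G.Adj x₁ z₁ ∧
      G.Adj x₂ z₂ := by
  have hexists : ∀ v, edgeCount G {v} (univ \ X) ≠ 0 → ∃ z ∈ univ \ X, G.Adj v z := by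
    intro v hv
    by_contra! hcon
    rw [edgeCount, sum_singleton] at hv
    exact hv (sum_eq_zero fun z hz => if_neg (hcon z hz))
  have hsum := hX
  rw [edgeCount_eq_sum] at hsum
  obtain ⟨x₁, hx₁, hne₁⟩ := exists_ne_zero_of_sum_ne_zero (by omega :
    ∑ u ∈ X, edgeCount G {u} (univ \ X) ≠ 0)
  have hle := edgeCount_le_one_of_cut hcubic hblock hX hx₁
  rw [← add_sum_erase X _ hx₁] at hsum
  obtain ⟨x₂, hx₂, hne₂⟩ := exists_ne_zero_of_sum_ne_zero (by omega :
    ∑ u ∈ X.erase x₁, edgeCount G {u} (univ \ X) ≠ 0)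
  obtain ⟨hx₂₁, hx₂⟩ := mem_erase.1 hx₂
  obtain ⟨z₁, hz₁, h₁⟩ := hexists x₁ hne₁
  obtain ⟨z₂, hz₂, h₂⟩ := hexists x₂ hne₂
  refine ⟨x₁, hx₁, x₂, hx₂, z₁, hz₁, z₂, hz₂, hx₂₁.symm, ?_, h₁, h₂⟩
  rintro rfl
  have hX' : edgeCount G (univ \ X) (univ \ (univ \ X)) = 2 := by
    rw [Finset.sdiff_sdiff_eq_self (subset_univ X), edgeCount_comm, hX]
  have hle' := edgeCount_le_one_of_cut hcubic hblock hX' hz₁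
  rw [Finset.sdiff_sdiff_eq_self (subset_univ X), ← edgeCount_erase hx₁] at hle'
  have h₃ := edgeCount_pos_of_adj (mem_singleton_self z₁) (mem_singleton_self x₁) h₁.symm
  have h₄ := edgeCount_pos_of_adj (mem_singleton_self z₁) (mem_erase.2 ⟨hx₂₁, hx₂⟩) h₂.symm
  omega

/-- A set that is minimal among those bounded by a two-edge cut has a path cover of small cost
between the ends of the cut. -/
lemma exists_pathCover_of_minimal_cut (hcubic : ∀ v, edgeCount G {v} univ = 3)
    {X : Finset V} {x₁ x₂ : V} (hx₁ : x₁ ∈ X) (hx₂ : x₂ ∈ X) (hne : x₁ ≠ x₂)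
    (hends : ∀ v ∈ X, edgeCount G {v} (univ \ X) =
      (if v = x₁ then 1 else 0) + if v = x₂ then 1 else 0)
    (hmin : ∀ Z ⊂ X, Z.Nonempty → 3 ≤ edgeCount G Z (univ \ Z)) :
    ∃ p, PathCover G X x₁ x₂ p ∧ 4 * p + 4 ≤ #X := by
  have hin : ∀ v, edgeCount G {v} X + edgeCount G {v} (univ \ X) = 3 := fun v => by
    rw [edgeCount_add_sdiff_right (subset_univ X), hcubic]
  have hends₁ : edgeCount G {x₁} (univ \ X) = 1 := by simp [hends x₁ hx₁, hne]
  have hends₂ : edgeCount G {x₂} (univ \ X) = 1 := by simp [hends x₂ hx₂, hne.symm]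
  have hin₁ := hin x₁
  have hin₂ := hin x₂
  obtain ⟨c₁, hc₁, c₂, hc₂, hc, hadj₁, hadj₂, -⟩ :=
    exists_neighbors_of_edgeCount_eq_two (by omega : edgeCount G {x₁} X = 2)
  set T := X.erase x₁ with hT
  have herase : ∀ v, edgeCount G {v} T + edgeCount G {v} {x₁} = edgeCount G {v} X :=
    fun v => edgeCount_erase hx₁ {v}
  have hout : edgeCount G T (univ \ T) = 3 := by
    have heq : (univ \ T) \ (univ \ X) = {x₁} := by
      ext u
      simp only [hT, mem_sdiff, mem_univ, true_and, mem_erase, mem_singleton]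
      by_cases hu : u = x₁
      · simp [hu, hx₁]
      · simp [hu]
    have h₁ := edgeCount_add_sdiff_left (G := G) (singleton_subset_iff.2 hx₁) (univ \ X)
    have h₂ := herase x₁
    have h₃ : edgeCount G X (univ \ X) = 2 := by
      rw [edgeCount_eq_sum, sum_congr rfl hends, sum_add_distrib, sum_ite_eq', sum_ite_eq',
        if_pos hx₁, if_pos hx₂]
    rw [← erase_eq, ← hT] at h₁
    rw [edgeCount_singleton_self] at h₂
    rw [← edgeCount_add_sdiff_right (sdiff_subset_sdiff (Subset.refl univ) (erase_subset x₁ X)),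
      heq, edgeCount_comm _ {x₁}]
    omega
  have hTX : T ⊂ X := erase_ssubset hx₁
  have hblock : Block G T := block_of_three_le hout.le fun Z hZ => hmin Z (hZ.trans hTX)
  have hx₂T : x₂ ∈ T := mem_erase.2 ⟨hne.symm, hx₂⟩
  have hdeg : ∀ c ∈ X, G.Adj x₁ c → c ∈ T ∧ edgeCount G {c} T ≤ 2 := by
    intro c hc hadj
    have h₁ := herase c
    have h₂ := hin c
    rw [edgeCount_singleton_singleton, if_pos hadj.symm] at h₁
    exact ⟨mem_erase.2 ⟨hadj.ne', hc⟩, by omega⟩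
  obtain ⟨hc₁T, hd₁⟩ := hdeg c₁ hc₁ hadj₁
  obtain ⟨hc₂T, hd₂⟩ := hdeg c₂ hc₂ hadj₂
  have hx₂d := herase x₂
  have hTne : T ≠ {x₂} := by
    intro h
    rw [h, mem_singleton] at hc₁T hc₂T
    exact hc (hc₁T.trans hc₂T.symm)
  have htwo := hblock.two_le_degree hx₂T hTne
  have hnadj : ¬ G.Adj x₁ x₂ := by
    intro h
    rw [edgeCount_singleton_singleton, if_pos h.symm] at hx₂d
    omega
  have htri : Tri G T x₂ c₁ c₂ :=
    ⟨hblock, fun v _ => (edgeCount_mono_right (subset_univ _) _).trans (hcubic v).le, hx₂T, hc₁T,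
      hc₂T, by omega, hd₁, hd₂, by rintro rfl; exact hnadj hadj₁,
      by rintro rfl; exact hnadj hadj₂, hc⟩
  have hsurplus := surplus_eq_of_cubic hcubic T
  have hcard : #T + 1 = #X := card_erase_add_one hx₁
  rw [hout] at hsurplus
  have hsum := ((good_and_triBound _).2 _ _ _ htri).sum_le
  have hfinish : ∀ c p, G.Adj x₁ c → PathCover G T x₂ c p → PathCover G X x₁ x₂ p := by
    intro c p hadj hp
    have := hp.append hadj.symm (.single x₁) (by simp [hT])
    rw [union_comm, ← insert_eq, hT, insert_erase hx₁] at this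
    exact this.symm
  by_cases hle : 4 * minCost G T x₂ c₁ + 4 ≤ #X
  · exact ⟨_, hfinish c₁ _ hadj₁ htri.pathCover, hle⟩
  · exact ⟨_, hfinish c₂ _ hadj₂ htri.swap.pathCover, by omega⟩

/-- A cubic graph with a two-edge cut. -/
lemma exists_cover_of_cut (hcubic : ∀ v, edgeCount G {v} univ = 3) (hblock : Block G univ)
    {X : Finset V} (hX : X.Nonempty) (hX' : (univ \ X).Nonempty)
    (hcut : edgeCount G X (univ \ X) ≤ 2)
    (hmin : ∀ Z ⊂ X, Z.Nonempty → 3 ≤ edgeCount G Z (univ \ Z)) :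
    ∃ k, Cover G univ k ∧ 4 * k ≤ Fintype.card V + 3 := by
  have hcut : edgeCount G X (univ \ X) = 2 := hcut.antisymm (hblock X (subset_univ X) hX hX')
  obtain ⟨x₁, hx₁, x₂, hx₂, z₁, hz₁, z₂, hz₂, hx, hz, h₁, h₂⟩ :=
    exists_matching_of_cut hcubic hblock hcut
  have hendsX := eq_ite_add_ite_of_sum_eq_two (f := fun v => edgeCount G {v} (univ \ X)) hx₁ hx₂ hx
    (edgeCount_pos_of_adj (mem_singleton_self _) hz₁ h₁)
    (edgeCount_pos_of_adj (mem_singleton_self _) hz₂ h₂) (by rw [← edgeCount_eq_sum, hcut])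
  have hendsY := eq_ite_add_ite_of_sum_eq_two (f := fun v => edgeCount G {v} X) hz₁ hz₂ hz
    (edgeCount_pos_of_adj (mem_singleton_self _) hx₁ h₁.symm)
    (edgeCount_pos_of_adj (mem_singleton_self _) hx₂ h₂.symm)
    (by rw [← edgeCount_eq_sum, edgeCount_comm, hcut])
  have hXX : univ \ (univ \ X) = X := Finset.sdiff_sdiff_eq_self (subset_univ X)
  have hchain := hblock.chain_of_subset (sdiff_subset (s := univ) (t := X)) (by rwa [hXX])
    (fun v _ => (hcubic v).le) hz₁ hz₂ (by rwa [hXX])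
  obtain ⟨p, hp, hple⟩ := exists_pathCover_of_minimal_cut hcubic hx₁ hx₂ hx hendsX hmin
  obtain ⟨q, hq, hqle⟩ := hchain.exists_pathCover
  have hcover := (hp.symm.append h₁ hq disjoint_sdiff).close h₂.symm
  rw [union_sdiff_of_subset (subset_univ X)] at hcover
  refine ⟨_, hcover, ?_⟩
  have hcard := card_sdiff_add_card_eq_card (subset_univ X)
  rw [card_univ] at hcard
  simp only [weight, hcubic] at hqle
  norm_num at hqle
  omega

lemma exists_cover_of_isCubic (hconn : G.Connected) (hcubic : IsCubic G) (hb : Bridgeless G)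
    (hn : 8 ≤ Fintype.card V) : ∃ k, Cover G univ k ∧ 4 * k ≤ Fintype.card V + 3 := by
  have hdeg := edgeCount_univ_of_isCubic hcubic
  by_cases h : ∃ X : Finset V, X.Nonempty ∧ (univ \ X).Nonempty ∧ edgeCount G X (univ \ X) ≤ 2
  · obtain ⟨X, ⟨hX, hX', hcut⟩, hmin⟩ := WellFounded.has_min (wellFounded_lt (α := Finset V))
      {X | X.Nonempty ∧ (univ \ X).Nonempty ∧ edgeCount G X (univ \ X) ≤ 2} h
    refine exists_cover_of_cut hdeg (block_univ hconn hb) hX hX' hcut fun Z hZ hne => ?_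
    by_contra! hlt
    exact hmin Z ⟨hne, hX'.mono (sdiff_subset_sdiff (Subset.refl _) hZ.1), by omega⟩ hZ
  · push Not at h
    exact exists_cover_of_three_le hdeg hn h

end Fintype

end CubicTour

/-- Every simple connected bridgeless cubic graph on `n ≥ 8` vertices has a closed
spanning walk (travelling salesman tour) of length at most `1.3 * n - 2`. -/
theorem cubic_graph_tsp_tour {V : Type*} [Fintype V] (G : SimpleGraph V)
    (hconn : G.Connected) (hcubic : IsCubic G) (hbridgeless : Bridgeless G)
    (hn : 8 ≤ Fintype.card V) :
    ∃ (a : V) (w : G.Walk a a), (∀ v : V, v ∈ w.support) ∧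
      (w.length : ℝ) ≤ 1.3 * (Fintype.card V : ℝ) - 2 := by
  obtain ⟨k, hk, hle⟩ := CubicTour.exists_cover_of_isCubic hconn hcubic hbridgeless hn
  obtain ⟨a, w, hw, hlen⟩ := hk.exists_spanning_closedWalk hconn
  refine ⟨a, w, hw, ?_⟩
  obtain ⟨m, hm⟩ := CubicTour.even_card_of_isCubic hcubic
  have h : 10 * w.length + 20 ≤ 13 * Fintype.card V := by omega
  have h' : 10 * (w.length : ℝ) + 20 ≤ 13 * Fintype.card V := by exact_mod_cast h
  linarith
end

section
/- A simple connected bridgeless cubic graph on n ≥ 8 vertices has an even factor F with cost c(F) = n + 2·|C_F| + |V_F| at most 1.3·n. -/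
open SimpleGraph

variable {V : Type*}

section EvenCovers

/-- `PathOn H S x y`: the vertices listed in `S` form a walk of `H` from `x` to `y`, which is a
path when `S` has no repeated element. -/
inductive PathOn (H : SimpleGraph V) : Multiset V → V → V → Prop
  | single (x : V) : PathOn H {x} x x
  | snoc {S : Multiset V} {x y z : V} : PathOn H S x y → H.Adj y z → PathOn H (S + {z}) x z

/-- `Cover H S k`: the vertices listed in `S` are split into circuits of `H`, counted with cost `2`,
and isolated vertices, counted with cost `1`, of total cost `k`. -/
inductive Cover (H : SimpleGraph V) : Multiset V → ℕ → Prop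
  | zero : Cover H 0 0
  | isolated (v : V) : Cover H {v} 1
  | circuit {S : Multiset V} {x y : V} :
      PathOn H S x y → H.Adj y x → 3 ≤ S.card → Cover H S 2
  | add {S T : Multiset V} {k j : ℕ} : Cover H S k → Cover H T j → Cover H (S + T) (k + j)

/-- `Route H S x y k`: the vertices listed in `S` are split into a path from `x` to `y` and a cover
of cost `k`. -/
def Route (H : SimpleGraph V) (S : Multiset V) (x y : V) (k : ℕ) : Prop :=
  ∃ P R, PathOn H P x y ∧ Cover H R k ∧ S = P + R

/-- `Link H D s t k`: a path from `s` to `t` with all interior vertices in `D`, together with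
a cover of cost `k` of the remaining vertices of `D`. -/
def Link (H : SimpleGraph V) (D : Multiset V) (s t : V) (k : ℕ) : Prop :=
  (D = 0 ∧ k = 0 ∧ H.Adj s t) ∨ ∃ c d, Route H D c d k ∧ H.Adj s c ∧ H.Adj d t

variable {H : SimpleGraph V}

theorem PathOn.append {S T : Multiset V} {x y z w : V} (hS : PathOn H S x y) (hyz : H.Adj y z)
    (hT : PathOn H T z w) : PathOn H (S + T) x w := by
  induction hT with
  | single z => exact hS.snoc hyz
  | snoc _ h ih => rw [← add_assoc]; exact (ih hyz).snoc h

theorem PathOn.symm {S : Multiset V} {x y : V} (hS : PathOn H S x y) : PathOn H S y x := by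
  induction hS with
  | single x => exact .single x
  | snoc _ h ih => rw [add_comm]; exact (PathOn.single _).append h.symm ih

theorem PathOn.mono {H' : SimpleGraph V} (hH : H ≤ H') {S : Multiset V} {x y : V}
    (hS : PathOn H S x y) : PathOn H' S x y := by
  induction hS with
  | single x => exact .single x
  | snoc _ h ih => exact ih.snoc (hH h)

theorem PathOn.card_cases {S : Multiset V} {x y : V} (hS : PathOn H S x y) :
    (x = y ∧ S.card = 1) ∨ (H.Adj x y ∧ S.card = 2) ∨ 3 ≤ S.card := by
  induction hS with
  | single x => simp
  | snoc _ h ih =>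
    rcases ih with ⟨rfl, h1⟩ | ⟨_, h1⟩ | h1 <;> simp [h1, h]
    omega

theorem Cover.mono {H' : SimpleGraph V} (hH : H ≤ H') {S : Multiset V} {k : ℕ}
    (hS : Cover H S k) : Cover H' S k := by
  induction hS with
  | zero => exact .zero
  | isolated v => exact .isolated v
  | circuit h h' h3 => exact .circuit (h.mono hH) (hH h') h3
  | add _ _ ih ih' => exact ih.add ih'

theorem Route.single (x : V) : Route H {x} x x 0 := ⟨{x}, 0, .single x, .zero, by simp⟩

theorem Route.symm {S : Multiset V} {x y : V} {k : ℕ} (h : Route H S x y k) : Route H S y x k := by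
  obtain ⟨P, R, hP, hR, rfl⟩ := h
  exact ⟨P, R, hP.symm, hR, rfl⟩

theorem Route.append {S T : Multiset V} {x y z w : V} {k j : ℕ} (hS : Route H S x y k)
    (hyz : H.Adj y z) (hT : Route H T z w j) : Route H (S + T) x w (k + j) := by
  obtain ⟨P, R, hP, hR, rfl⟩ := hS
  obtain ⟨P', R', hP', hR', rfl⟩ := hT
  exact ⟨P + P', R + R', hP.append hyz hP', hR.add hR', by abel⟩

theorem Route.add_cover {S T : Multiset V} {x y : V} {k j : ℕ} (hS : Route H S x y k)
    (hT : Cover H T j) : Route H (S + T) x y (k + j) := by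
  obtain ⟨P, R, hP, hR, rfl⟩ := hS
  exact ⟨P, R + T, hP, hR.add hT, by abel⟩

theorem Route.close {S : Multiset V} {x y z : V} {k : ℕ} (hS : Route H S x y k) (hxy : x ≠ y)
    (hyz : H.Adj y z) (hzx : H.Adj z x) : Cover H (S + {z}) (k + 2) := by
  obtain ⟨P, R, hP, hR, rfl⟩ := hS
  have h3 : 3 ≤ (P + {z}).card := by
    rcases hP.card_cases with ⟨h, _⟩ | ⟨_, h⟩ | h
    · exact absurd h hxy
    · simp [h]
    · simp; omega
  have := hR.add (Cover.circuit (hP.snoc hyz) hzx h3)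
  rwa [show P + R + {z} = R + (P + {z}) by abel]

theorem Link.symm {D : Multiset V} {s t : V} {k : ℕ} (h : Link H D s t k) : Link H D t s k := by
  rcases h with ⟨hD, hk, h⟩ | ⟨c, d, h, hc, hd⟩
  · exact .inl ⟨hD, hk, h.symm⟩
  · exact .inr ⟨d, c, h.symm, hd.symm, hc.symm⟩

theorem Route.link {S D T : Multiset V} {x y z w : V} {k j i : ℕ} (hS : Route H S x y k)
    (hD : Link H D y z j) (hT : Route H T z w i) : Route H (S + D + T) x w (k + j + i) := by
  rcases hD with ⟨rfl, rfl, h⟩ | ⟨c, d, h, hc, hd⟩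
  · simpa using hS.append h hT
  · exact (hS.append hc h).append hd hT

end EvenCovers

section Realization

/-- Adding one edge to a graph. -/
theorem exists_add_edge (F : SimpleGraph V) {y z : V} (hyz : y ≠ z) :
    ∃ F', F ≤ F' ∧ ∀ u v, F'.Adj u v ↔ F.Adj u v ∨ (u = y ∧ v = z) ∨ (u = z ∧ v = y) := by
  refine ⟨F ⊔ SimpleGraph.edge y z, le_sup_left, fun u v => ?_⟩
  rw [SimpleGraph.sup_adj, SimpleGraph.edge_adj]
  constructor
  · rintro (h | ⟨h, -⟩)
    · exact .inl h
    · exact .inr h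
  · rintro (h | ⟨rfl, rfl⟩ | ⟨rfl, rfl⟩)
    · exact .inl h
    · exact .inr ⟨.inl ⟨rfl, rfl⟩, hyz⟩
    · exact .inr ⟨.inr ⟨rfl, rfl⟩, hyz.symm⟩

/-- A path without repeated vertices, as a subgraph. -/
theorem PathOn.exists_subgraph {G : SimpleGraph V} {S : Multiset V} {x y : V}
    (hS : PathOn G S x y) (hnd : S.Nodup) :
    ∃ F ≤ G, (∀ u v, F.Adj u v → u ∈ S) ∧ x ∈ S ∧ y ∈ S ∧ (∀ v ∈ S, F.Reachable x v) ∧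
      (3 ≤ S.card → ¬ F.Adj x y) ∧
      ((x = y ∧ S = {x} ∧ F = ⊥) ∨ (x ≠ y ∧ (∃ p, F.neighborSet x = {p}) ∧
        (∃ q, F.neighborSet y = {q}) ∧
        ∀ v ∈ S, v ≠ x → v ≠ y → ∃ p q, p ≠ q ∧ F.neighborSet v = {p, q})) := by
  induction hS with
  | single x => exact ⟨⊥, bot_le, by simp, by simp, by simp, by simp, by simp, .inl ⟨rfl, rfl, rfl⟩⟩
  | @snoc S x y z hP hyz ih =>
    rw [Multiset.nodup_add] at hnd
    obtain ⟨hnd, -, hdisj⟩ := hnd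
    have hz : z ∉ S := by simpa using hdisj
    obtain ⟨F, hF, hsupp, hx, hy, hreach, -, hcase⟩ := ih hnd
    have hsupp' : ∀ u v, F.Adj u v → v ∈ S := fun u v h => hsupp v u h.symm
    have hyz' : y ≠ z := hyz.ne
    have hxz : x ≠ z := fun h => hz (h ▸ hx)
    obtain ⟨F', hFF', hadj⟩ := exists_add_edge F hyz'
    refine ⟨F', ?_, ?_, ?_, ?_, ?_, ?_, .inr ⟨hxz, ?_, ?_, ?_⟩⟩
    · intro u v h
      rcases (hadj u v).1 h with h | ⟨rfl, rfl⟩ | ⟨rfl, rfl⟩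
      exacts [hF h, hyz, hyz.symm]
    · intro u v h
      rcases (hadj u v).1 h with h | ⟨rfl, rfl⟩ | ⟨rfl, rfl⟩ <;> simp [*]
      exact .inl (hsupp _ _ h)
    · simp [hx]
    · simp
    · have hy' := (hreach y hy).mono hFF'
      intro v hv
      rcases Multiset.mem_add.1 hv with hv | hv
      · exact (hreach v hv).mono hFF'
      · rw [Multiset.mem_singleton.1 hv]
        exact hy'.trans (SimpleGraph.Adj.reachable ((hadj y z).2 (.inr (.inl ⟨rfl, rfl⟩))))
    · intro h3 h
      rcases (hadj x z).1 h with h | ⟨rfl, -⟩ | ⟨h, -⟩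
      · exact hz (hsupp' _ _ h)
      · rcases hcase with ⟨-, rfl, -⟩ | ⟨h, -⟩
        · simp at h3
        · exact h rfl
      · exact hxz h
    · rcases hcase with ⟨rfl, rfl, rfl⟩ | ⟨hxy, ⟨p, hp⟩, -⟩
      · refine ⟨z, ?_⟩
        ext v
        simp [hadj, hxz]
      · refine ⟨p, ?_⟩
        rw [← hp]
        ext v
        simp [hadj, hxz, hxy]
    · refine ⟨y, ?_⟩
      ext v
      simp only [SimpleGraph.mem_neighborSet, hadj, Set.mem_singleton_iff]
      constructor
      · rintro (h | ⟨h, -⟩ | ⟨-, h⟩)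
        · exact absurd (hsupp _ _ h) hz
        · exact absurd h.symm hyz'
        · exact h
      · rintro rfl
        simp
    · intro v hv hvx hvz
      have hvS : v ∈ S := by simpa [hvz] using hv
      rcases hcase with ⟨rfl, rfl, rfl⟩ | ⟨hxy, -, ⟨q, hq⟩, hrest⟩
      · exact absurd (by simpa using hvS) hvx
      · by_cases hvy : v = y
        · subst hvy
          refine ⟨q, z, ?_, ?_⟩
          · rintro rfl
            have : F.Adj v q := by
              rw [← SimpleGraph.mem_neighborSet, hq]; rfl
            exact hz (hsupp' _ _ this)
          · ext u
            have := Set.ext_iff.1 hq u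
            simp only [SimpleGraph.mem_neighborSet, Set.mem_singleton_iff] at this
            simp [hadj, this, hvz]
        · obtain ⟨p, q, hpq, hp⟩ := hrest v hvS hvx hvy
          refine ⟨p, q, hpq, ?_⟩
          rw [← hp]
          ext u
          simp [hadj, hvy, hvz]

theorem deg_eq_two {F : SimpleGraph V} {v p q : V} (hpq : p ≠ q) (h : F.neighborSet v = {p, q}) :
    deg F v = 2 := by
  rw [deg, h, Nat.card_coe_set_eq, Set.ncard_pair hpq]

theorem PathOn.exists_circuit {G : SimpleGraph V} {S : Multiset V} {x y : V}
    (hS : PathOn G S x y) (hyx : G.Adj y x) (h3 : 3 ≤ S.card) (hnd : S.Nodup) :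
    ∃ F ≤ G, (∀ u v, F.Adj u v → u ∈ S) ∧ (∀ v ∈ S, deg F v = 2) ∧ ∀ v ∈ S, F.Reachable x v := by
  obtain ⟨F, hF, hsupp, hx, hy, hreach, hnadj, hcase⟩ := hS.exists_subgraph hnd
  have hxy := hyx.ne
  obtain ⟨F', hFF', hadj⟩ := exists_add_edge F hxy
  rcases hcase with ⟨h, -⟩ | ⟨-, ⟨p, hp⟩, ⟨q, hq⟩, hrest⟩
  · exact absurd h.symm hxy
  have hxp : F.Adj x p := by rw [← SimpleGraph.mem_neighborSet, hp]; rfl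
  have hyq : F.Adj y q := by rw [← SimpleGraph.mem_neighborSet, hq]; rfl
  refine ⟨F', ?_, ?_, ?_, fun v hv => (hreach v hv).mono hFF'⟩
  · intro u v h
    rcases (hadj u v).1 h with h | ⟨rfl, rfl⟩ | ⟨rfl, rfl⟩
    exacts [hF h, hyx, hyx.symm]
  · intro u v h
    rcases (hadj u v).1 h with h | ⟨rfl, rfl⟩ | ⟨rfl, rfl⟩
    exacts [hsupp _ _ h, hy, hx]
  · intro v hv
    by_cases hvx : v = x
    · subst hvx
      refine deg_eq_two (p := p) (q := y) (fun h => hnadj h3 (h ▸ hxp)) ?_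
      ext u
      have := Set.ext_iff.1 hp u
      simp only [SimpleGraph.mem_neighborSet, Set.mem_singleton_iff] at this
      simp [hadj, this, hxy.symm]
    · by_cases hvy : v = y
      · subst hvy
        refine deg_eq_two (p := q) (q := x) (fun h => hnadj h3 (h ▸ hyq).symm) ?_
        ext u
        have := Set.ext_iff.1 hq u
        simp only [SimpleGraph.mem_neighborSet, Set.mem_singleton_iff] at this
        simp [hadj, this, hxy]
      · obtain ⟨p, q, hpq, h⟩ := hrest v hv hvx hvy
        refine deg_eq_two hpq ?_
        rw [← h]
        ext u
        simp [hadj, hvx, hvy]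

theorem deg_sup_left {F F' : SimpleGraph V} {v : V} (h : ∀ u, ¬ F'.Adj v u) :
    deg (F ⊔ F') v = deg F v := by
  unfold deg
  congr 2
  ext u
  simp [h]

/-- A cover without repeated vertices is an even factor; `R` represents its circuits and `I` its
isolated vertices. -/
theorem Cover.exists_evenFactor {G : SimpleGraph V} {S : Multiset V} {k : ℕ} (hS : Cover G S k)
    (hnd : S.Nodup) :
    ∃ F ≤ G, ∃ R I : Multiset V, (∀ u v, F.Adj u v → u ∈ S) ∧
      (∀ v ∈ S, (deg F v = 0 ∧ v ∈ I) ∨ (deg F v = 2 ∧ ∃ r ∈ R, F.Reachable r v)) ∧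
      2 * R.card + I.card ≤ k := by
  have hbot : ∀ v : V, deg (⊥ : SimpleGraph V) v = 0 := by
    intro v
    simp [deg]
  induction hS with
  | zero => exact ⟨⊥, bot_le, 0, 0, by simp, by simp, by simp⟩
  | isolated v => exact ⟨⊥, bot_le, 0, {v}, by simp, by simp [hbot], by simp⟩
  | @circuit S x y hP hyx h3 =>
    obtain ⟨F, hF, hsupp, hdeg, hreach⟩ := hP.exists_circuit hyx h3 hnd
    exact ⟨F, hF, {x}, 0, hsupp, fun v hv => .inr ⟨hdeg v hv, x, by simp, hreach v hv⟩, by simp⟩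
  | @add S T k j _ _ ih ih' =>
    obtain ⟨hnS, hnT, hdisj⟩ := Multiset.nodup_add.1 hnd
    obtain ⟨F, hF, R, I, hsupp, hdeg, hk⟩ := ih hnS
    obtain ⟨F', hF', R', I', hsupp', hdeg', hj⟩ := ih' hnT
    have hST : ∀ v ∈ S, v ∉ T := fun v hv hv' => (Multiset.disjoint_left.1 hdisj) hv hv'
    refine ⟨F ⊔ F', sup_le hF hF', R + R', I + I', ?_, ?_, by simp; omega⟩
    · rintro u v (h | h)
      · exact Multiset.mem_add.2 (.inl (hsupp _ _ h))
      · exact Multiset.mem_add.2 (.inr (hsupp' _ _ h))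
    · intro v hv
      rcases Multiset.mem_add.1 hv with hv | hv
      · rw [deg_sup_left fun u h => hST v hv (hsupp' _ _ h)]
        rcases hdeg v hv with ⟨h0, hI⟩ | ⟨h2, r, hr, h⟩
        · exact .inl ⟨h0, Multiset.mem_add.2 (.inl hI)⟩
        · exact .inr ⟨h2, r, Multiset.mem_add.2 (.inl hr), h.mono le_sup_left⟩
      · rw [sup_comm, deg_sup_left fun u h => hST v (hsupp _ _ h) hv]
        rcases hdeg' v hv with ⟨h0, hI⟩ | ⟨h2, r, hr, h⟩
        · exact .inl ⟨h0, Multiset.mem_add.2 (.inr hI)⟩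
        · exact .inr ⟨h2, r, Multiset.mem_add.2 (.inr hr), h.mono le_sup_left⟩

/-- A cover of all vertices yields an even factor of small cost. -/
theorem Cover.exists_isEvenFactor [Fintype V] {G : SimpleGraph V} {k : ℕ}
    (h : Cover G (Finset.univ : Finset V).val k) :
    ∃ F, IsEvenFactor G F ∧ 2 * numCirc F + numIso F ≤ k := by
  classical
  obtain ⟨F, hF, R, I, -, hdeg, hk⟩ := h.exists_evenFactor Finset.univ.nodup
  simp only [Finset.mem_val, Finset.mem_univ, true_imp_iff] at hdeg
  refine ⟨F, ⟨hF, fun v => (hdeg v).imp And.left And.left⟩, ?_⟩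
  have h1 : numCirc F ≤ R.card := by
    have hsub : {C | IsCircuitOf F C} ⊆ ((R.toFinset.image fun r => {u | F.Reachable r u} :
        Finset (Set V)) : Set (Set V)) := by
      rintro C ⟨v, hv, rfl⟩
      rcases hdeg v with ⟨h0, -⟩ | ⟨-, r, hr, h⟩
      · exact absurd h0 hv
      · refine Finset.mem_coe.2 (Finset.mem_image.2 ⟨r, by simpa using hr, ?_⟩)
        ext u
        exact ⟨fun h' => h.symm.trans h', fun h' => h.trans h'⟩
    calc numCirc F = {C | IsCircuitOf F C}.ncard := Nat.card_coe_set_eq _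
      _ ≤ _ := Set.ncard_le_ncard hsub (Finset.finite_toSet _)
      _ = _ := Set.ncard_coe_finset _
      _ ≤ R.toFinset.card := Finset.card_image_le
      _ ≤ R.card := Multiset.toFinset_card_le R
  have h2 : numIso F ≤ I.card := by
    have hsub : {v | deg F v = 0} ⊆ (I.toFinset : Set V) := by
      intro v hv
      rcases hdeg v with ⟨-, h⟩ | ⟨h, -⟩
      · simpa using h
      · simp only [Set.mem_ofPred_eq] at hv; omega
    calc numIso F = {v | deg F v = 0}.ncard := Nat.card_coe_set_eq _
      _ ≤ _ := Set.ncard_le_ncard hsub (Finset.finite_toSet _)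
      _ = _ := Set.ncard_coe_finset _
      _ ≤ I.card := Multiset.toFinset_card_le I
  omega

end Realization

section Crossing

open Classical in
/-- The number of neighbours of `v` in `X`. -/
noncomputable def degIn (H : SimpleGraph V) (X : Finset V) (v : V) : ℕ := (X.filter (H.Adj v)).card

/-- The number of pairs `(u, v)` of adjacent vertices with `u ∈ S` and `v ∈ T`. -/
noncomputable def crossing (H : SimpleGraph V) (S T : Finset V) : ℕ := ∑ u ∈ S, degIn H T u

/-- The weight of a vertex set: twice its size minus the number of induced edges, minus one. -/
noncomputable def weight (H : SimpleGraph V) (X : Finset V) : ℤ :=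
  2 * X.card - (crossing H X X / 2 : ℕ) - 1

variable {H : SimpleGraph V}

theorem crossing_singleton_left (v : V) (X : Finset V) : crossing H {v} X = degIn H X v := by
  simp [crossing]

theorem crossing_comm (S T : Finset V) : crossing H S T = crossing H T S := by
  classical
  simp only [crossing, degIn, Finset.card_filter]
  rw [Finset.sum_comm]
  simp only [H.adj_comm]

theorem crossing_singleton_right (v : V) (X : Finset V) : crossing H X {v} = degIn H X v := by
  rw [crossing_comm, crossing_singleton_left]

theorem degIn_singleton_self (v : V) : degIn H {v} v = 0 := by
  simp [degIn]

theorem degIn_pos_iff {X : Finset V} {v : V} : 1 ≤ degIn H X v ↔ ∃ u ∈ X, H.Adj v u := by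
  rw [degIn, Nat.one_le_iff_ne_zero, Finset.card_ne_zero]
  simp [Finset.Nonempty]

theorem degIn_le_crossing {S T : Finset V} {v : V} (hv : v ∈ S) : degIn H T v ≤ crossing H S T :=
  Finset.single_le_sum (f := degIn H T) (fun _ _ => Nat.zero_le _) hv

theorem crossing_pos_iff {S T : Finset V} :
    1 ≤ crossing H S T ↔ ∃ u ∈ S, ∃ v ∈ T, H.Adj u v := by
  constructor
  · intro h
    by_contra hcon
    push Not at hcon
    have : crossing H S T = 0 := by
      refine Finset.sum_eq_zero fun u hu => ?_
      by_contra h0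
      obtain ⟨v, hv, h⟩ := degIn_pos_iff.1 (Nat.one_le_iff_ne_zero.2 h0)
      exact hcon u hu v hv h
    omega
  · rintro ⟨u, hu, v, hv, h⟩
    exact (degIn_pos_iff.2 ⟨v, hv, h⟩).trans (degIn_le_crossing hu)

variable [DecidableEq V]

theorem degIn_union {S T : Finset V} (h : Disjoint S T) (v : V) :
    degIn H (S ∪ T) v = degIn H S v + degIn H T v := by
  classical
  rw [degIn, Finset.filter_union, Finset.card_union_of_disjoint (Finset.disjoint_filter_filter h)]
  rfl

theorem degIn_sdiff {S X : Finset V} (h : S ⊆ X) (v : V) :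
    degIn H S v + degIn H (X \ S) v = degIn H X v := by
  rw [← degIn_union Finset.disjoint_sdiff, Finset.union_sdiff_of_subset h]

theorem degIn_mono {S X : Finset V} (h : S ⊆ X) (v : V) : degIn H S v ≤ degIn H X v := by
  rw [← degIn_sdiff h]; omega

theorem crossing_union_left {S T : Finset V} (h : Disjoint S T) (X : Finset V) :
    crossing H (S ∪ T) X = crossing H S X + crossing H T X :=
  Finset.sum_union h

theorem crossing_union_right {S T : Finset V} (h : Disjoint S T) (X : Finset V) :
    crossing H X (S ∪ T) = crossing H X S + crossing H X T := by
  rw [crossing_comm, crossing_union_left h, crossing_comm, crossing_comm T]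

theorem even_crossing_self (X : Finset V) : Even (crossing H X X) := by
  induction X using Finset.induction_on with
  | empty => simp [crossing]
  | insert v X hv ih =>
    have hd : Disjoint {v} X := by simpa using hv
    rw [Finset.insert_eq, crossing_union_left hd, crossing_union_right hd, crossing_union_right hd,
      crossing_comm X {v}, crossing_singleton_left, degIn_singleton_self]
    rw [Nat.even_iff] at ih ⊢
    omega

theorem two_mul_weight (X : Finset V) :
    2 * weight H X = 4 * X.card - crossing H X X - 2 := by
  obtain ⟨k, hk⟩ := even_crossing_self (H := H) X
  rw [weight]
  omega

theorem weight_singleton (v : V) : weight H {v} = 1 := by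
  have := two_mul_weight (H := H) {v}
  rw [crossing_singleton_left, degIn_singleton_self] at this
  simp at this
  omega

theorem weight_union {S T : Finset V} (h : Disjoint S T) :
    weight H (S ∪ T) = weight H S + weight H T + 1 - crossing H S T := by
  have h1 := two_mul_weight (H := H) (S ∪ T)
  have h2 := two_mul_weight (H := H) S
  have h3 := two_mul_weight (H := H) T
  rw [Finset.card_union_of_disjoint h, crossing_union_left h, crossing_union_right h,
    crossing_union_right h, crossing_comm T S] at h1
  push_cast at h1
  omega

theorem weight_sdiff {S X : Finset V} (h : S ⊆ X) :
    weight H X = weight H S + weight H (X \ S) + 1 - crossing H S (X \ S) := by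
  rw [← weight_union Finset.disjoint_sdiff, Finset.union_sdiff_of_subset h]

end Crossing

section Blocks

variable [DecidableEq V]

/-- A vertex set inducing a 2-edge-connected subgraph with maximum degree at most three. -/
structure IsBlock (H : SimpleGraph V) (X : Finset V) : Prop where
  two_le_card : 2 ≤ X.card
  deg_le : ∀ v ∈ X, degIn H X v ≤ 3
  cut : ∀ S ⊆ X, S.Nonempty → S ≠ X → 2 ≤ crossing H S (X \ S)

/-- A block with two distinguished vertices of degree at most two. -/
structure IsPole (H : SimpleGraph V) (X : Finset V) (x y : V) : Prop where
  isBlock : IsBlock H X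
  left_mem : x ∈ X
  right_mem : y ∈ X
  ne : x ≠ y
  deg_left : degIn H X x ≤ 2
  deg_right : degIn H X y ≤ 2

/-- The building blocks of strings: single vertices and blocks with two distinguished vertices. -/
def IsElement (H : SimpleGraph V) (X : Finset V) (x y : V) : Prop :=
  (X = {x} ∧ x = y) ∨ IsPole H X x y

/-- `X` becomes a 2-edge-connected graph of maximum degree at most three once pending edges are
attached at `x` and `y` and their outer ends are identified. -/
structure IsSegment (H : SimpleGraph V) (X : Finset V) (x y : V) : Prop where
  left_mem : x ∈ X
  right_mem : y ∈ X
  deg_le : ∀ v ∈ X, degIn H X v + (if v = x then 1 else 0) + (if v = y then 1 else 0) ≤ 3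
  cut : ∀ S ⊆ X, S.Nonempty → S ≠ X → 1 ≤ crossing H S (X \ S) ∧
    ((x ∈ S ↔ y ∈ S) → 2 ≤ crossing H S (X \ S))

/-- `IsString H D x y ω`: `D` is a sequence of elements of total weight `ω`, consecutive ones being
joined by edges, leading from `x` to `y`. -/
inductive IsString (H : SimpleGraph V) : Multiset V → V → V → ℤ → Prop
  | single {X : Finset V} {x y : V} : IsElement H X x y → IsString H X.val x y (weight H X)
  | append {D D' : Multiset V} {x u v y : V} {ω ω' : ℤ} : IsString H D x u ω → H.Adj u v →
      IsString H D' v y ω' → IsString H (D + D') x y (ω + ω')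

/-- `IsConnector H D s t ω`: an edge from `s` to `t`, or a string with edges joining `s` and `t`
to its ends. -/
def IsConnector (H : SimpleGraph V) (D : Multiset V) (s t : V) (ω : ℤ) : Prop :=
  (D = 0 ∧ ω = 0 ∧ H.Adj s t) ∨ ∃ c d, IsString H D c d ω ∧ H.Adj s c ∧ H.Adj d t

variable {H : SimpleGraph V}

theorem IsPole.symm {X : Finset V} {x y : V} (h : IsPole H X x y) : IsPole H X y x :=
  ⟨h.isBlock, h.right_mem, h.left_mem, h.ne.symm, h.deg_right, h.deg_left⟩

theorem IsElement.symm {X : Finset V} {x y : V} (h : IsElement H X x y) : IsElement H X y x := by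
  rcases h with ⟨rfl, rfl⟩ | h
  exacts [.inl ⟨rfl, rfl⟩, .inr h.symm]

theorem IsElement.left_mem {X : Finset V} {x y : V} (h : IsElement H X x y) : x ∈ X := by
  rcases h with ⟨rfl, rfl⟩ | h
  exacts [Finset.mem_singleton_self _, h.left_mem]

theorem IsString.symm {D : Multiset V} {x y : V} {ω : ℤ} (h : IsString H D x y ω) :
    IsString H D y x ω := by
  induction h with
  | single h => exact .single h.symm
  | append _ h _ ih ih' => rw [add_comm, add_comm (_ : ℤ)]; exact ih'.append h.symm ih

theorem IsString.left_mem {D : Multiset V} {x y : V} {ω : ℤ} (h : IsString H D x y ω) : x ∈ D := by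
  induction h with
  | single h => exact h.left_mem
  | append _ _ _ ih _ => exact Multiset.mem_add.2 (.inl ih)

theorem IsConnector.symm {D : Multiset V} {s t : V} {ω : ℤ} (h : IsConnector H D s t ω) :
    IsConnector H D t s ω := by
  rcases h with ⟨hD, hk, h⟩ | ⟨c, d, h, hc, hd⟩
  · exact .inl ⟨hD, hk, h.symm⟩
  · exact .inr ⟨d, c, h.symm, hd.symm, hc.symm⟩

theorem IsConnector.append_string {D D' : Multiset V} {s c d : V} {ω ω' : ℤ}
    (h : IsConnector H D s c ω) (h' : IsString H D' c d ω') :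
    ∃ c', H.Adj s c' ∧ IsString H (D + D') c' d (ω + ω') := by
  rcases h with ⟨rfl, rfl, h⟩ | ⟨c', d', h, hc, hd⟩
  · exact ⟨c, h, by simpa using h'⟩
  · exact ⟨c', hc, h.append hd h'⟩

theorem IsConnector.exists_adj_left {D : Multiset V} {s t : V} {ω : ℤ}
    (h : IsConnector H D s t ω) : ∃ w, (w = t ∨ w ∈ D) ∧ H.Adj s w := by
  rcases h with ⟨-, -, h⟩ | ⟨c, d, h, hc, hd⟩
  · exact ⟨t, .inl rfl, h⟩
  · exact ⟨c, .inr h.left_mem, hc⟩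

/-- A string splits at the element containing a given vertex. -/
theorem IsString.split {D : Multiset V} {c d v : V} {ω : ℤ} (h : IsString H D c d ω) (hv : v ∈ D)
    {s t : V} (hs : H.Adj s c) (ht : H.Adj d t) :
    ∃ Q Z R z₁ z₂ ωQ ωR, D = Q + Z.val + R ∧ IsConnector H Q s z₁ ωQ ∧ IsElement H Z z₁ z₂ ∧
      v ∈ Z ∧ IsConnector H R z₂ t ωR ∧ ω = ωQ + weight H Z + ωR := by
  induction h generalizing s t with
  | @single X x y h =>
    exact ⟨0, X, 0, x, y, 0, 0, by simp, .inl ⟨rfl, rfl, hs⟩, h, hv, .inl ⟨rfl, rfl, ht⟩, by simp⟩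
  | @append D D' x u v' y ω ω' h huv h' ih ih' =>
    rcases Multiset.mem_add.1 hv with hv | hv
    · obtain ⟨Q, Z, R, z₁, z₂, ωQ, ωR, rfl, hQ, hZ, hvZ, hR, rfl⟩ := ih hv hs huv
      obtain ⟨c', hc', hR'⟩ := hR.append_string h'
      exact ⟨Q, Z, R + D', z₁, z₂, ωQ, ωR + ω', by abel, hQ, hZ, hvZ, .inr ⟨c', y, hR', hc', ht⟩,
        by ring⟩
    · obtain ⟨Q, Z, R, z₁, z₂, ωQ, ωR, rfl, hQ, hZ, hvZ, hR, rfl⟩ := ih' hv huv ht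
      obtain ⟨c', hc', hQ'⟩ := hQ.symm.append_string h.symm
      exact ⟨D + Q, Z, R, z₁, z₂, ω + ωQ, ωR, by abel,
        .inr ⟨x, c', by rw [add_comm D, add_comm ω]; exact hQ'.symm, hs, hc'.symm⟩,
        hZ, hvZ, hR, by ring⟩

theorem IsConnector.split {D : Multiset V} {s t v : V} {ω : ℤ} (h : IsConnector H D s t ω)
    (hv : v ∈ D) :
    ∃ Q Z R z₁ z₂ ωQ ωR, D = Q + Z.val + R ∧ IsConnector H Q s z₁ ωQ ∧ IsElement H Z z₁ z₂ ∧
      v ∈ Z ∧ IsConnector H R z₂ t ωR ∧ ω = ωQ + weight H Z + ωR := by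
  rcases h with ⟨rfl, -, -⟩ | ⟨c, d, h, hc, hd⟩
  · simp at hv
  · exact h.split hv hc hd

theorem IsSegment.symm {X : Finset V} {x y : V} (h : IsSegment H X x y) : IsSegment H X y x :=
  ⟨h.right_mem, h.left_mem, fun v hv => by have := h.deg_le v hv; omega,
    fun S hS hne hX => ⟨(h.cut S hS hne hX).1, fun hxy => (h.cut S hS hne hX).2 hxy.symm⟩⟩

/-- One side of a cut consisting of a single edge is again a segment. -/
theorem IsSegment.side {X S : Finset V} {x y u v : V} (h : IsSegment H X x y) (hS : S ⊆ X)
    (hx : x ∈ S) (hy : y ∉ S) (hcut : crossing H S (X \ S) = 1) (hu : u ∈ S) (hv : v ∈ X \ S)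
    (huv : H.Adj u v) : IsSegment H S x u := by
  have hu1 : 1 ≤ degIn H (X \ S) u := degIn_pos_iff.2 ⟨v, hv, huv⟩
  have core : ∀ T ⊆ S, T.Nonempty → u ∉ T →
      1 ≤ crossing H T (S \ T) ∧ (x ∉ T → 2 ≤ crossing H T (S \ T)) := by
    intro T hT hne huT
    have h1 : crossing H T (X \ T) = crossing H T (S \ T) + crossing H T (X \ S) := by
      rw [← crossing_union_right (Finset.disjoint_of_subset_left Finset.sdiff_subset
        Finset.disjoint_sdiff)]
      congr 1
      ext w
      simp only [Finset.mem_sdiff, Finset.mem_union]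
      have := @hT w
      have := @hS w
      tauto
    have h2 : crossing H T (X \ S) = 0 := by
      have h3 : crossing H S (X \ S) = crossing H T (X \ S) + crossing H (S \ T) (X \ S) := by
        rw [← crossing_union_left Finset.disjoint_sdiff, Finset.union_sdiff_of_subset hT]
      have h4 := degIn_le_crossing (H := H) (T := X \ S)
        (show u ∈ S \ T from Finset.mem_sdiff.2 ⟨hu, huT⟩)
      omega
    have hyT : y ∉ T := fun h => hy (hT h)
    obtain ⟨h3, h4⟩ := h.cut T (hT.trans hS) hne (fun h' => hyT (h' ▸ h.right_mem))
    rw [h1, h2, add_zero] at h3 h4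
    exact ⟨h3, fun hxT => h4 (by tauto)⟩
  refine ⟨hx, hu, fun w hw => ?_, fun T hT hne hTS => ?_⟩
  · have h1 := h.deg_le w (hS hw)
    rw [← degIn_sdiff hS] at h1
    split_ifs at h1 ⊢ <;> subst_vars <;> omega
  · by_cases huT : u ∈ T
    · have hsub : S \ T ⊆ S := Finset.sdiff_subset
      have hne' : (S \ T).Nonempty := Finset.sdiff_nonempty.2 fun h' => hTS (hT.antisymm h')
      have := core (S \ T) hsub hne' (by simp [huT])
      rw [Finset.sdiff_sdiff_eq_self hT, crossing_comm] at this
      exact ⟨this.1, fun h' => this.2 (by simp [h'.2 huT])⟩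
    · have := core T hT hne huT
      exact ⟨this.1, fun h' => this.2 (by tauto)⟩

theorem IsBlock.two_le_degIn {X : Finset V} (h : IsBlock H X) {v : V} (hv : v ∈ X) :
    2 ≤ degIn H X v := by
  have h1 := h.cut {v} (by simpa using hv) (by simp) (by
    rintro rfl
    simpa using h.two_le_card)
  rw [crossing_singleton_left] at h1
  exact h1.trans (degIn_mono Finset.sdiff_subset v)

theorem IsSegment.isString {X : Finset V} {x y : V} (h : IsSegment H X x y) :
    IsString H X.val x y (weight H X) := by
  induction hn : X.card using Nat.strong_induction_on generalizing X x y with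
  | _ n ih =>
    by_cases hX : IsBlock H X
    · have hx := hX.two_le_degIn h.left_mem
      have h1 := h.deg_le x h.left_mem
      have h2 := h.deg_le y h.right_mem
      have hne : x ≠ y := by
        rintro rfl
        simp at h1
        omega
      simp only [if_true] at h1 h2
      exact .single (.inr ⟨hX, h.left_mem, h.right_mem, hne, by omega, by omega⟩)
    by_cases hcard : X.card ≤ 1
    · have h1 := Finset.card_le_one.1 hcard x h.left_mem y h.right_mem
      refine .single (.inl ⟨?_, h1⟩)
      exact Finset.eq_singleton_iff_unique_mem.2
        ⟨h.left_mem, fun w hw => Finset.card_le_one.1 hcard w hw x h.left_mem⟩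
    have hcut : ∃ S ⊆ X, x ∈ S ∧ y ∉ S ∧ crossing H S (X \ S) = 1 := by
      by_contra hcon
      push Not at hcon
      refine hX ⟨by omega, fun v hv => by have := h.deg_le v hv; omega, fun S hS hne hSX => ?_⟩
      obtain ⟨h1, h2⟩ := h.cut S hS hne hSX
      by_cases hxy : x ∈ S ↔ y ∈ S
      · exact h2 hxy
      · by_cases hx : x ∈ S
        · have := hcon S hS hx (by tauto)
          omega
        · have := hcon (X \ S) Finset.sdiff_subset (by simp [hx, h.left_mem])
            (by simp only [Finset.mem_sdiff]; tauto)
          rw [Finset.sdiff_sdiff_eq_self hS, crossing_comm] at this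
          omega
    obtain ⟨S, hS, hx, hy, h1⟩ := hcut
    obtain ⟨u, hu, v, hv, huv⟩ := crossing_pos_iff.1 h1.ge
    have hy' : y ∈ X \ S := Finset.mem_sdiff.2 ⟨h.right_mem, hy⟩
    have hcard := Finset.card_sdiff_add_card_eq_card hS
    have hS1 : 1 ≤ S.card := Finset.card_pos.2 ⟨x, hx⟩
    have hS2 : 1 ≤ (X \ S).card := Finset.card_pos.2 ⟨y, hy'⟩
    have c1 := ih S.card (by omega) (h.side hS hx hy h1 hu hv huv) rfl
    have c2 := ih (X \ S).card (by omega) (h.symm.side Finset.sdiff_subset hy' (by simp [hx])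
      (by rw [Finset.sdiff_sdiff_eq_self hS, crossing_comm, h1]) hv
      (by rwa [Finset.sdiff_sdiff_eq_self hS]) huv.symm) rfl
    have := c1.append huv c2.symm
    rw [weight_sdiff hS, h1]
    convert this using 1
    · rw [Finset.sdiff_val, add_tsub_cancel_of_le (Finset.val_le_iff.2 hS)]
    · push_cast; ring

/-- Removing a vertex of degree two from a block leaves a segment. -/
theorem IsBlock.erase {X : Finset V} (h : IsBlock H X) {x : V} (hx : x ∈ X)
    (hdeg : degIn H X x ≤ 2) :
    ∃ a b, a ≠ b ∧ H.Adj x a ∧ H.Adj x b ∧ IsSegment H (X.erase x) a b ∧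
      weight H (X.erase x) = weight H X := by
  classical
  have h2 : degIn H X x = 2 := le_antisymm hdeg (h.two_le_degIn hx)
  obtain ⟨a, b, hab, hN⟩ := Finset.card_eq_two.1 h2
  have hmem : ∀ w, (w ∈ X ∧ H.Adj x w) ↔ w = a ∨ w = b := by
    intro w
    have := Finset.ext_iff.1 hN w
    simpa using this
  obtain ⟨haX, hxa⟩ := (hmem a).2 (.inl rfl)
  obtain ⟨hbX, hxb⟩ := (hmem b).2 (.inr rfl)
  have hxX : {x} ⊆ X := by simpa using hx
  have hsub : X.erase x ⊆ X := Finset.erase_subset x X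
  have hsd : X \ {x} = X.erase x := Finset.sdiff_singleton_eq_erase x X
  have hx1 : ∀ w, H.Adj x w → degIn H {x} w = 1 := by
    intro w hw
    simp [degIn, Finset.filter_singleton, hw.symm]
  have hdeg' : ∀ w, degIn H X w = degIn H {x} w + degIn H (X.erase x) w := by
    intro w
    rw [← degIn_sdiff hxX, hsd]
  have core : ∀ S ⊆ X.erase x, S.Nonempty → b ∉ S →
      1 ≤ crossing H S (X.erase x \ S) ∧ (a ∉ S → 2 ≤ crossing H S (X.erase x \ S)) := by
    intro S hS hne hbS
    have hxS : x ∉ S := fun h' => by simpa using hS h'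
    have h1 := h.cut S (hS.trans hsub) hne (fun h' => hxS (h' ▸ hx))
    have h2 : crossing H S (X \ S) = crossing H S {x} + crossing H S (X.erase x \ S) := by
      rw [← crossing_union_right (by simp)]
      congr 1
      ext w
      simp only [Finset.mem_sdiff, Finset.mem_union, Finset.mem_singleton, Finset.mem_erase]
      by_cases hw : w = x
      · subst hw; simp [hx, hxS]
      · simp [hw]
    rw [crossing_singleton_right] at h2
    have h3 : degIn H S x ≤ if a ∈ S then 1 else 0 := by
      have : S.filter (H.Adj x) ⊆ if a ∈ S then {a} else ∅ := by
        intro w hw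
        obtain ⟨hw, hxw⟩ := Finset.mem_filter.1 hw
        rcases (hmem w).1 ⟨hsub (hS hw), hxw⟩ with rfl | rfl
        · simp [hw]
        · exact absurd hw hbS
      have := Finset.card_le_card this
      rw [degIn]
      split_ifs at this ⊢ <;> simpa using this
    split_ifs at h3 with ha
    · exact ⟨by omega, fun h' => absurd ha h'⟩
    · exact ⟨by omega, fun _ => by omega⟩
  refine ⟨a, b, hab, hxa, hxb, ⟨?_, ?_, fun w hw => ?_, fun S hS hne hSX => ?_⟩, ?_⟩
  · exact Finset.mem_erase.2 ⟨hxa.ne', haX⟩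
  · exact Finset.mem_erase.2 ⟨hxb.ne', hbX⟩
  · have h1 := h.deg_le w (hsub hw)
    rw [hdeg'] at h1
    have h2 := hx1 a hxa
    have h3 := hx1 b hxb
    split_ifs <;> subst_vars <;> first | omega | exact absurd rfl hab
  · by_cases hb : b ∈ S
    · have hne' : (X.erase x \ S).Nonempty :=
        Finset.sdiff_nonempty.2 fun h' => hSX (hS.antisymm h')
      have := core _ Finset.sdiff_subset hne' (by simp [hb])
      rw [Finset.sdiff_sdiff_eq_self hS, crossing_comm] at this
      exact ⟨this.1, fun h' => this.2 (by simp [h'.2 hb])⟩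
    · have := core S hS hne hb
      exact ⟨this.1, fun h' => this.2 (by tauto)⟩
  · have h1 := weight_sdiff (H := H) hxX
    have h3 := hdeg' x
    rw [degIn_singleton_self] at h3
    rw [hsd, weight_singleton, crossing_singleton_left] at h1
    omega

/-- An element with a third distinguished vertex at which a further edge can be attached. -/
def IsTripod (H : SimpleGraph V) (Z : Finset V) (v z₁ z₂ : V) : Prop :=
  (Z = {v} ∧ z₁ = v ∧ z₂ = v) ∨ (IsPole H Z v z₁ ∧ IsPole H Z v z₂ ∧ IsPole H Z z₁ z₂)

/-- A connector inside a block splits at a vertex of degree at most two of that block. -/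
theorem IsConnector.split_tripod {D E : Multiset V} {X : Finset V} {s t v : V} {ω : ℤ}
    (h : IsConnector H D s t ω) (hv : v ∈ D) (hX : X.val = D + E) (hs : s ∈ E) (ht : t ∈ E)
    (hdeg : degIn H X v ≤ 2) :
    ∃ Q Z R z₁ z₂ ωQ ωR, D = Q + Z.val + R ∧ IsConnector H Q s z₁ ωQ ∧ IsTripod H Z v z₁ z₂ ∧
      IsConnector H R z₂ t ωR ∧ ω = ωQ + weight H Z + ωR := by
  obtain ⟨Q, Z, R, z₁, z₂, ωQ, ωR, rfl, hQ, hZ, hvZ, hR, rfl⟩ := h.split hv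
  refine ⟨Q, Z, R, z₁, z₂, ωQ, ωR, rfl, hQ, ?_, hR, rfl⟩
  rcases hZ with ⟨rfl, rfl⟩ | hZ
  · obtain rfl := Finset.mem_singleton.1 hvZ
    exact .inl ⟨rfl, rfl, rfl⟩
  · have hnd := X.nodup
    rw [hX, Multiset.nodup_add, Multiset.nodup_add, Multiset.nodup_add] at hnd
    obtain ⟨⟨⟨-, -, hQZ⟩, -, hZR⟩, -, hE⟩ := hnd
    have hmem : ∀ w, w ∈ X ↔ ((w ∈ Q ∨ w ∈ Z) ∨ w ∈ R) ∨ w ∈ E := by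
      intro w
      rw [← Finset.mem_val, hX]
      simp
    have hZX : Z ⊆ X := fun w hw => (hmem w).2 (.inl (.inl (.inr hw)))
    have hEZ : ∀ w ∈ E, w ∉ Z := fun w hw hwZ =>
      Multiset.disjoint_left.1 hE (by simp [hwZ]) hw
    have key : ∀ w, w ∈ X → w ∉ Z → H.Adj v w → False := by
      intro w hw hwZ hvw
      have h1 : 1 ≤ degIn H (X \ Z) v := degIn_pos_iff.2 ⟨w, by simp [hw, hwZ], hvw⟩
      have h2 := degIn_sdiff (H := H) hZX v
      have h3 := hZ.isBlock.two_le_degIn hvZ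
      omega
    have hd : degIn H Z v ≤ 2 := (degIn_mono hZX v).trans hdeg
    have hv₁ : v ≠ z₁ := by
      rintro rfl
      obtain ⟨w, hw, hadj⟩ := hQ.symm.exists_adj_left
      rcases hw with rfl | hw
      · exact key w ((hmem w).2 (.inr hs)) (hEZ w hs) hadj
      · exact key w ((hmem w).2 (.inl (.inl (.inl hw))))
          (fun h' => Multiset.disjoint_left.1 hQZ hw h') hadj
    have hv₂ : v ≠ z₂ := by
      rintro rfl
      obtain ⟨w, hw, hadj⟩ := hR.exists_adj_left
      rcases hw with rfl | hw
      · exact key w ((hmem w).2 (.inr ht)) (hEZ w ht) hadj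
      · exact key w ((hmem w).2 (.inl (.inr hw)))
          (fun h' => Multiset.disjoint_left.1 hZR (by simp [h']) hw) hadj
    exact .inr ⟨⟨hZ.isBlock, hvZ, hZ.left_mem, hv₁, hd, hZ.deg_left⟩,
      ⟨hZ.isBlock, hvZ, hZ.right_mem, hv₂, hd, hZ.deg_right⟩, hZ⟩

end Blocks

section Routing

/-- `X` is formed by `x`, `y` and two connectors between them. -/
def IsTheta [DecidableEq V] (H : SimpleGraph V) (X : Finset V) (x y : V) : Prop :=
  ∃ D₁ D₂ ω₁ ω₂, IsConnector H D₁ x y ω₁ ∧ IsConnector H D₂ x y ω₂ ∧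
    X.val = {x} + {y} + D₁ + D₂ ∧ weight H X = ω₁ + ω₂ + 1

/-- `X` is formed by four vertices `x`, `y`, `p`, `q` and connectors between all pairs of them
except `x` and `y`. -/
def IsKFour [DecidableEq V] (H : SimpleGraph V) (X : Finset V) (x y : V) : Prop :=
  ∃ p q E₁ E₂ E₃ E₄ E₅ ω₁ ω₂ ω₃ ω₄ ω₅, IsConnector H E₁ x p ω₁ ∧ IsConnector H E₂ x q ω₂ ∧
    IsConnector H E₃ p q ω₃ ∧ IsConnector H E₄ p y ω₄ ∧ IsConnector H E₅ q y ω₅ ∧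
    X.val = {x} + {y} + {p} + {q} + E₁ + E₂ + E₃ + E₄ + E₅ ∧
    weight H X = ω₁ + ω₂ + ω₃ + ω₄ + ω₅ + 2

/-- `X` admits a route from `x` to `y` and a cover whose costs are small compared to its weight. -/
def IsGood [DecidableEq V] (H : SimpleGraph V) (X : Finset V) (x y : V) : Prop :=
  ∃ A B : ℕ, Route H X.val x y A ∧ Cover H X.val B ∧ (A : ℤ) + B ≤ weight H X ∧
    2 * (A : ℤ) + 1 ≤ weight H X ∧
    (IsTheta H X x y ∨ (IsKFour H X x y ∧ 2 * (A : ℤ) + 2 ≤ weight H X) ∨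
      2 * (A : ℤ) + 3 ≤ weight H X)

variable {H : SimpleGraph V}

theorem Route.congr {S T : Multiset V} {x y : V} {k : ℕ} (h : Route H S x y k) (hST : S = T) :
    Route H T x y k := hST ▸ h

theorem Route.exists_le {S : Multiset V} {x y : V} {k j : ℕ} (hk : Route H S x y k)
    (hj : Route H S x y j) {c w : ℤ} (h : (k : ℤ) + j + c ≤ w) :
    ∃ A : ℕ, Route H S x y A ∧ 2 * (A : ℤ) + c ≤ w := by
  rcases le_total k j with h' | h'
  · exact ⟨k, hk, by omega⟩
  · exact ⟨j, hj, by omega⟩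

/-- Two links with the same ends form a circuit. -/
theorem Link.cover {D D' : Multiset V} {x y : V} {k j : ℕ} (h : Link H D x y k)
    (h' : Link H D' x y j) (hD : D ≠ 0) : Cover H ({x} + {y} + D + D') (k + j + 2) := by
  rcases h with ⟨h, -⟩ | ⟨c, d, ⟨P, R, hP, hR, rfl⟩, hc, hd⟩
  · exact absurd h hD
  have hP1 : 1 ≤ P.card := by
    rcases hP.card_cases with ⟨-, h⟩ | ⟨-, h⟩ | h <;> omega
  have hpath := ((PathOn.single x).append hc hP).snoc hd
  rcases h' with ⟨rfl, rfl, h'⟩ | ⟨c', d', ⟨P', R', hP', hR', rfl⟩, hc', hd'⟩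
  · have := (Cover.circuit hpath h'.symm (by simp; omega)).add hR
    convert this using 1
    · abel
    · ring
  · have := ((Cover.circuit (hpath.append hd'.symm hP'.symm) hc'.symm (by simp; omega)).add hR).add
      hR'
    convert this using 1
    · abel
    · ring

theorem three_le_degIn {Y : Finset V} {S₁ S₂ S₃ E : Multiset V} {p : V}
    (hY : Y.val = S₁ + S₂ + S₃ + E) (h₁ : ∃ w ∈ S₁, H.Adj p w) (h₂ : ∃ w ∈ S₂, H.Adj p w)
    (h₃ : ∃ w ∈ S₃, H.Adj p w) : 3 ≤ degIn H Y p := by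
  classical
  have key : ∀ S : Multiset V, (∃ w ∈ S, H.Adj p w) → 1 ≤ (S.filter (H.Adj p)).card := by
    rintro S ⟨w, hw, h⟩
    exact Multiset.card_pos_iff_exists_mem.2 ⟨w, Multiset.mem_filter.2 ⟨hw, h⟩⟩
  have h : degIn H Y p = (Y.val.filter (H.Adj p)).card := by
    rw [degIn, ← Finset.filter_val, Finset.card_val]
  rw [h, hY]
  simp only [Multiset.filter_add, Multiset.card_add]
  have := key _ h₁
  have := key _ h₂
  have := key _ h₃
  omega

variable [DecidableEq V]

theorem IsString.bounds {N : ℕ} (IH : ∀ Z z w, Z.card < N → IsPole H Z z w → IsGood H Z z w)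
    {D : Multiset V} {x y : V} {ω : ℤ} (h : IsString H D x y ω) (hD : D.card < N) :
    ∃ A B : ℕ, Route H D x y A ∧ Cover H D B ∧ (A : ℤ) + B ≤ ω ∧ 2 * (A : ℤ) + 1 ≤ ω := by
  induction h with
  | @single X x y h =>
    rcases h with ⟨rfl, rfl⟩ | h
    · exact ⟨0, 1, .single x, .isolated x, by simp [weight_singleton], by simp [weight_singleton]⟩
    · obtain ⟨A, B, hA, hB, h1, h2, -⟩ := IH X x y hD h
      exact ⟨A, B, hA, hB, h1, h2⟩
  | append h huv h' ih ih' =>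
    rw [Multiset.card_add] at hD
    obtain ⟨A, B, hA, hB, h1, h2⟩ := ih (by omega)
    obtain ⟨A', B', hA', hB', h1', h2'⟩ := ih' (by omega)
    exact ⟨A + A', B + B', hA.append huv hA', hB.add hB', by push_cast; omega, by push_cast; omega⟩

theorem IsConnector.bounds_of_ne {N : ℕ}
    (IH : ∀ Z z w, Z.card < N → IsPole H Z z w → IsGood H Z z w)
    {D : Multiset V} {s t : V} {ω : ℤ} (h : IsConnector H D s t ω) (hD : D.card < N) :
    ∃ A B : ℕ, Link H D s t A ∧ Cover H D B ∧ (A : ℤ) + B ≤ ω ∧ 2 * (A : ℤ) ≤ ω ∧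
      (D ≠ 0 → 2 * (A : ℤ) + 1 ≤ ω) := by
  rcases h with ⟨rfl, rfl, h⟩ | ⟨c, d, h, hc, hd⟩
  · exact ⟨0, 0, .inl ⟨rfl, rfl, h⟩, .zero, by simp, by simp, by simp⟩
  · obtain ⟨A, B, hA, hB, h1, h2⟩ := h.bounds IH hD
    exact ⟨A, B, .inr ⟨c, d, hA, hc, hd⟩, hB, h1, by omega, fun _ => h2⟩

theorem IsConnector.bounds {N : ℕ} (IH : ∀ Z z w, Z.card < N → IsPole H Z z w → IsGood H Z z w)
    {D : Multiset V} {s t : V} {ω : ℤ} (h : IsConnector H D s t ω) (hD : D.card < N) :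
    ∃ A B : ℕ, Link H D s t A ∧ Cover H D B ∧ (A : ℤ) + B ≤ ω ∧ 2 * (A : ℤ) ≤ ω := by
  obtain ⟨A, B, hA, hB, h1, h2, -⟩ := h.bounds_of_ne IH hD
  exact ⟨A, B, hA, hB, h1, h2⟩

theorem IsTripod.bounds {N : ℕ} (IH : ∀ Z z w, Z.card < N → IsPole H Z z w → IsGood H Z z w)
    {Z : Finset V} {v z₁ z₂ : V} (h : IsTripod H Z v z₁ z₂) (hZ : Z.card < N) :
    ∃ A A₁ A₂ : ℕ, Route H Z.val z₁ z₂ A ∧ Route H Z.val v z₁ A₁ ∧ Route H Z.val v z₂ A₂ ∧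
      2 * (A : ℤ) + 1 ≤ weight H Z ∧ 2 * (A₁ : ℤ) + 1 ≤ weight H Z ∧
      2 * (A₂ : ℤ) + 1 ≤ weight H Z := by
  rcases h with ⟨rfl, rfl, rfl⟩ | ⟨h₁, h₂, h₃⟩
  · exact ⟨0, 0, 0, .single _, .single _, .single _, by simp [weight_singleton]⟩
  · obtain ⟨A, -, hA, -, -, h, -⟩ := IH Z z₁ z₂ hZ h₃
    obtain ⟨A₁, -, hA₁, -, -, h', -⟩ := IH Z v z₁ hZ h₁
    obtain ⟨A₂, -, hA₂, -, -, h'', -⟩ := IH Z v z₂ hZ h₂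
    exact ⟨A, A₁, A₂, hA, hA₁, hA₂, h, h', h''⟩

/-- A theta structure inside a theta structure. -/
theorem exists_route_prism {X Z : Finset V} {D₁ D₂ Q R P P' Q' R' : Multiset V}
    {ω₁ ω₂ ωQ ωR ωP ωP' ωQ' ωR' : ℤ} {x y u₁ u₂ z₁ z₂ a b : V}
    (IH : ∀ Z z w, Z.card < X.card → IsPole H Z z w → IsGood H Z z w)
    (hD₁ : IsConnector H D₁ x u₁ ω₁) (hD₂ : IsConnector H D₂ x u₂ ω₂)
    (hQ : IsConnector H Q u₂ z₁ ωQ) (hR : IsConnector H R z₂ y ωR)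
    (hP : IsConnector H P u₂ y ωP) (hP' : IsConnector H P' u₁ z₁ ωP')
    (hQ' : IsConnector H Q' u₁ a ωQ') (hZ : IsTripod H Z z₂ a b) (hR' : IsConnector H R' b z₁ ωR')
    (hX : X.val = {x} + {u₂} + {y} + {u₁} + {z₁} + D₁ + D₂ + Q + R + P + P' + Q' + Z.val + R')
    (hw : weight H X = ω₁ + ω₂ + ωQ + ωR + ωP + ωP' + ωQ' + weight H Z + ωR' + 2) :
    ∃ A : ℕ, Route H X.val x y A ∧ 2 * (A : ℤ) + 3 ≤ weight H X := by
  have hc := congrArg Multiset.card hX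
  simp only [Multiset.card_add, Multiset.card_singleton, Finset.card_val] at hc
  obtain ⟨A₁, B₁, L₁, C₁, h₁, h₁'⟩ := hD₁.bounds IH (by omega)
  obtain ⟨A₂, B₂, L₂, C₂, h₂, h₂'⟩ := hD₂.bounds IH (by omega)
  obtain ⟨A₃, B₃, L₃, C₃, h₃, h₃'⟩ := hQ.bounds IH (by omega)
  obtain ⟨A₄, B₄, L₄, C₄, h₄, h₄'⟩ := hR.bounds IH (by omega)
  obtain ⟨A₅, B₅, L₅, C₅, h₅, h₅'⟩ := hP.bounds IH (by omega)
  obtain ⟨A₆, B₆, L₆, C₆, h₆, h₆'⟩ := hP'.bounds IH (by omega)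
  obtain ⟨A₇, B₇, L₇, C₇, h₇, h₇'⟩ := hQ'.bounds IH (by omega)
  obtain ⟨A₈, B₈, L₈, C₈, h₈, h₈'⟩ := hR'.bounds IH (by omega)
  obtain ⟨A, A', A'', r, r', r'', h, h', h''⟩ := hZ.bounds IH (by omega)
  refine Route.exists_le
    (((((((((Route.single x).link L₂ (.single u₂)).link L₃ (.single z₁)).link L₆.symm
      (.single u₁)).link L₇ r'.symm).link L₄ (.single y)).add_cover C₁).add_cover C₅).add_cover
      C₈ |>.congr (by rw [hX]; abel))
    (((((((((Route.single x).link L₁ (.single u₁)).link L₇ r).link L₈ (.single z₁)).link L₃.symm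
      (.single u₂)).link L₅ (.single y)).add_cover C₄).add_cover C₂).add_cover C₆ |>.congr
      (by rw [hX]; abel)) ?_
  push_cast
  linarith

/-- Routes through a block with a theta structure. -/
theorem exists_route_theta {X Y : Finset V} {D₁ D₂ P P' : Multiset V} {ω₁ ω₂ ωP ωP' : ℤ}
    {x y u₁ u₂ : V} (IH : ∀ Z z w, Z.card < X.card → IsPole H Z z w → IsGood H Z z w)
    (hD₁ : IsConnector H D₁ x u₁ ω₁) (hD₂ : IsConnector H D₂ x u₂ ω₂)
    (hX : X.val = {x} + Y.val + D₁ + D₂) (hw : weight H X = ω₁ + weight H Y + ω₂)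
    (hP : IsConnector H P u₂ y ωP) (hP' : IsConnector H P' u₂ y ωP')
    (hY : Y.val = {u₂} + {y} + P + P') (hwY : weight H Y = ωP + ωP' + 1)
    (hu₁ : u₁ ∈ P) (hdeg : degIn H Y u₁ ≤ 2) :
    ∃ A : ℕ, Route H X.val x y A ∧ 2 * (A : ℤ) + 2 ≤ weight H X ∧
      (IsKFour H X x y ∨ 2 * (A : ℤ) + 3 ≤ weight H X) := by
  obtain ⟨Q, Z, R, z₁, z₂, ωQ, ωR, rfl, hQ, hZ, hR, rfl⟩ :=
    hP.split_tripod (E := {u₂} + {y} + P') hu₁ (by rw [hY]; abel) (by simp) (by simp) hdeg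
  have hX' : X.val = {x} + {u₂} + {y} + D₁ + D₂ + Q + Z.val + R + P' := by rw [hX, hY]; abel
  have hw' : weight H X = ω₁ + ω₂ + ωQ + ωR + ωP' + weight H Z + 1 := by rw [hw, hwY]; ring
  have hc := congrArg Multiset.card hX'
  simp only [Multiset.card_add, Multiset.card_singleton, Finset.card_val] at hc
  obtain ⟨A₁, B₁, L₁, C₁, h₁, h₁'⟩ := hD₁.bounds IH (by omega)
  obtain ⟨A₂, B₂, L₂, C₂, h₂, h₂'⟩ := hD₂.bounds IH (by omega)
  obtain ⟨A₃, B₃, L₃, C₃, h₃, h₃'⟩ := hQ.bounds IH (by omega)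
  obtain ⟨A₄, B₄, L₄, C₄, h₄, h₄'⟩ := hR.bounds IH (by omega)
  obtain ⟨A₅, B₅, L₅, C₅, h₅, h₅'⟩ := hP'.bounds IH (by omega)
  have key : ∀ {A A' : ℕ} {c : ℤ}, Route H Z.val u₁ z₁ A → Route H Z.val z₁ z₂ A' →
      (A : ℤ) + A' + c ≤ weight H Z →
      ∃ k : ℕ, Route H X.val x y k ∧ 2 * (k : ℤ) + (c + 1) ≤ weight H X := by
    intro A A' c r r' h
    refine Route.exists_le
      (((((((Route.single x).link L₁ r).link L₃.symm (.single u₂)).link L₅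
        (.single y)).add_cover C₂).add_cover C₄) |>.congr (by rw [hX']; abel))
      (((((((Route.single x).link L₂ (.single u₂)).link L₃ r').link L₄
        (.single y)).add_cover C₁).add_cover C₅) |>.congr (by rw [hX']; abel)) ?_
    push_cast
    linarith
  rcases hZ with ⟨rfl, rfl, rfl⟩ | ⟨hZ₁, hZ₂, hZ₃⟩
  · obtain ⟨k, hk, hk'⟩ := key (c := 1) (.single _) (.single _) (by simp [weight_singleton])
    refine ⟨k, hk, hk', .inl ⟨u₂, z₂, D₂, D₁, Q, P', R, ω₂, ω₁, ωQ, ωP', ωR, hD₂, hD₁, hQ, hP', hR,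
      ?_, ?_⟩⟩
    · rw [hX', Finset.singleton_val]; abel
    · rw [hw', weight_singleton]; ring
  · obtain ⟨A, B, hA, -, -, hA1, hA2⟩ := IH Z u₁ z₁ (by omega) hZ₁
    obtain ⟨A', -, hA', -, -, hA1', -⟩ := IH Z z₁ z₂ (by omega) hZ₃
    rcases hA2 with ⟨T, T', ωT, ωT', hT, hT', hZT, hwT⟩ | hA2
    · have prism : ∀ {T T' : Multiset V} {ωT ωT' : ℤ}, IsConnector H T u₁ z₁ ωT →
          IsConnector H T' u₁ z₁ ωT' → Z.val = {u₁} + {z₁} + T + T' →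
          weight H Z = ωT + ωT' + 1 → z₂ ∈ T →
          ∃ k : ℕ, Route H X.val x y k ∧ 2 * (k : ℤ) + 3 ≤ weight H X := by
        intro T T' ωT ωT' hT hT' hZT hwT hz₂
        obtain ⟨Q', Z', R', a, b, ωQ', ωR', rfl, hQ', hZ', hR', rfl⟩ :=
          hT.split_tripod (E := {u₁} + {z₁} + T') hz₂ (by rw [hZT]; abel) (by simp) (by simp)
            hZ₂.deg_right
        exact exists_route_prism IH hD₁ hD₂ hQ hR hP' hT' hQ' hZ' hR'
          (by rw [hX', hZT]; abel) (by rw [hw', hwT]; ring)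
      have hmem : z₂ ∈ T ∨ z₂ ∈ T' := by
        have h := hZ₂.right_mem
        rw [← Finset.mem_val, hZT] at h
        simpa [hZ₂.ne.symm, hZ₃.ne.symm] using h
      obtain ⟨k, hk, hk'⟩ : ∃ k : ℕ, Route H X.val x y k ∧ 2 * (k : ℤ) + 3 ≤ weight H X := by
        rcases hmem with h | h
        · exact prism hT hT' hZT hwT h
        · exact prism hT' hT (by rw [hZT]; abel) (by rw [hwT]; ring) h
      exact ⟨k, hk, by omega, .inr hk'⟩
    · have hA3 : 2 * (A : ℤ) + 2 ≤ weight H Z := by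
        rcases hA2 with ⟨-, h⟩ | h <;> omega
      obtain ⟨k, hk, hk'⟩ := key (c := 2) hA hA' (by omega)
      exact ⟨k, hk, by omega, .inr (by omega)⟩

/-- Routes through a block with a `K₄` structure whose attachment lies on the connector between the
two inner vertices. -/
theorem exists_route_kFour_inner {X Z : Finset V} {D₁ D₂ E₁ E₂ Q R E₄ E₅ : Multiset V}
    {ω₁ ω₂ ε₁ ε₂ ωQ ωR ε₄ ε₅ : ℤ} {x y u₁ u₂ p q z₁ z₂ : V}
    (IH : ∀ Z z w, Z.card < X.card → IsPole H Z z w → IsGood H Z z w)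
    (hD₁ : IsConnector H D₁ x u₁ ω₁) (hD₂ : IsConnector H D₂ x u₂ ω₂)
    (hE₁ : IsConnector H E₁ u₂ p ε₁) (hE₂ : IsConnector H E₂ u₂ q ε₂)
    (hQ : IsConnector H Q p z₁ ωQ) (hZ : IsTripod H Z u₁ z₁ z₂) (hR : IsConnector H R z₂ q ωR)
    (hE₄ : IsConnector H E₄ p y ε₄) (hE₅ : IsConnector H E₅ q y ε₅)
    (hX : X.val = {x} + {u₂} + {y} + {p} + {q} + D₁ + D₂ + E₁ + E₂ + Q + Z.val + R + E₄ + E₅)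
    (hw : weight H X = ω₁ + ω₂ + ε₁ + ε₂ + ωQ + weight H Z + ωR + ε₄ + ε₅ + 2) :
    ∃ A : ℕ, Route H X.val x y A ∧ 2 * (A : ℤ) + 3 ≤ weight H X := by
  have hc := congrArg Multiset.card hX
  simp only [Multiset.card_add, Multiset.card_singleton, Finset.card_val] at hc
  obtain ⟨A₁, B₁, L₁, C₁, h₁, h₁'⟩ := hD₁.bounds IH (by omega)
  obtain ⟨A₂, B₂, L₂, C₂, h₂, h₂'⟩ := hD₂.bounds IH (by omega)
  obtain ⟨A₃, B₃, L₃, C₃, h₃, h₃'⟩ := hE₁.bounds IH (by omega)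
  obtain ⟨A₄, B₄, L₄, C₄, h₄, h₄'⟩ := hE₂.bounds IH (by omega)
  obtain ⟨A₅, B₅, L₅, C₅, h₅, h₅'⟩ := hQ.bounds IH (by omega)
  obtain ⟨A₆, B₆, L₆, C₆, h₆, h₆'⟩ := hR.bounds IH (by omega)
  obtain ⟨A₇, B₇, L₇, C₇, h₇, h₇'⟩ := hE₄.bounds IH (by omega)
  obtain ⟨A₈, B₈, L₈, C₈, h₈, h₈'⟩ := hE₅.bounds IH (by omega)
  obtain ⟨A, A', A'', r, r', r'', h, h', h''⟩ := hZ.bounds IH (by omega)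
  refine Route.exists_le
    (((((((((Route.single x).link L₁ r'').link L₆ (.single q)).link L₄.symm (.single u₂)).link L₃
      (.single p)).link L₇ (.single y)).add_cover C₂).add_cover C₅).add_cover C₈ |>.congr
      (by rw [hX]; abel))
    (((((((((Route.single x).link L₂ (.single u₂)).link L₃ (.single p)).link L₅ r).link L₆
      (.single q)).link L₈ (.single y)).add_cover C₁).add_cover C₇).add_cover C₄ |>.congr
      (by rw [hX]; abel)) ?_
  push_cast
  linarith

/-- Routes through a block with a `K₄` structure whose attachment lies on a connector at the first
terminal. -/
theorem exists_route_kFour_left {X Z : Finset V} {D₁ D₂ Q R E₂ E₃ E₄ E₅ : Multiset V}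
    {ω₁ ω₂ ωQ ωR ε₂ ε₃ ε₄ ε₅ : ℤ} {x y u₁ u₂ p q z₁ z₂ : V}
    (IH : ∀ Z z w, Z.card < X.card → IsPole H Z z w → IsGood H Z z w)
    (hD₁ : IsConnector H D₁ x u₁ ω₁) (hD₂ : IsConnector H D₂ x u₂ ω₂)
    (hQ : IsConnector H Q u₂ z₁ ωQ) (hZ : IsTripod H Z u₁ z₁ z₂) (hR : IsConnector H R z₂ p ωR)
    (hE₂ : IsConnector H E₂ u₂ q ε₂) (hE₃ : IsConnector H E₃ p q ε₃)
    (hE₄ : IsConnector H E₄ p y ε₄) (hE₅ : IsConnector H E₅ q y ε₅)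
    (hX : X.val = {x} + {u₂} + {y} + {p} + {q} + D₁ + D₂ + Q + Z.val + R + E₂ + E₃ + E₄ + E₅)
    (hw : weight H X = ω₁ + ω₂ + ωQ + weight H Z + ωR + ε₂ + ε₃ + ε₄ + ε₅ + 2) :
    ∃ A : ℕ, Route H X.val x y A ∧ 2 * (A : ℤ) + 3 ≤ weight H X := by
  have hc := congrArg Multiset.card hX
  simp only [Multiset.card_add, Multiset.card_singleton, Finset.card_val] at hc
  obtain ⟨A₁, B₁, L₁, C₁, h₁, h₁'⟩ := hD₁.bounds IH (by omega)
  obtain ⟨A₂, B₂, L₂, C₂, h₂, h₂'⟩ := hD₂.bounds IH (by omega)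
  obtain ⟨A₃, B₃, L₃, C₃, h₃, h₃'⟩ := hQ.bounds IH (by omega)
  obtain ⟨A₄, B₄, L₄, C₄, h₄, h₄'⟩ := hR.bounds IH (by omega)
  obtain ⟨A₅, B₅, L₅, C₅, h₅, h₅'⟩ := hE₂.bounds IH (by omega)
  obtain ⟨A₆, B₆, L₆, C₆, h₆, h₆'⟩ := hE₃.bounds IH (by omega)
  obtain ⟨A₇, B₇, L₇, C₇, h₇, h₇'⟩ := hE₄.bounds IH (by omega)
  obtain ⟨A₈, B₈, L₈, C₈, h₈, h₈'⟩ := hE₅.bounds IH (by omega)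
  obtain ⟨A, A', A'', r, r', r'', h, h', h''⟩ := hZ.bounds IH (by omega)
  refine Route.exists_le
    (((((((((Route.single x).link L₂ (.single u₂)).link L₃ r).link L₄ (.single p)).link L₆
      (.single q)).link L₈ (.single y)).add_cover C₅).add_cover C₁).add_cover C₇ |>.congr
      (by rw [hX]; abel))
    (((((((((Route.single x).link L₁ r').link L₃.symm (.single u₂)).link L₅ (.single q)).link
      L₆.symm (.single p)).link L₇ (.single y)).add_cover C₄).add_cover C₂).add_cover C₈ |>.congr
      (by rw [hX]; abel)) ?_
  push_cast
  linarith

/-- Routes through a block with a `K₄` structure whose attachment lies on a connector at the second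
terminal. -/
theorem exists_route_kFour_right {X Z : Finset V} {D₁ D₂ E₁ E₂ E₃ Q R E₅ : Multiset V}
    {ω₁ ω₂ ε₁ ε₂ ε₃ ωQ ωR ε₅ : ℤ} {x y u₁ u₂ p q z₁ z₂ : V}
    (IH : ∀ Z z w, Z.card < X.card → IsPole H Z z w → IsGood H Z z w)
    (hD₁ : IsConnector H D₁ x u₁ ω₁) (hD₂ : IsConnector H D₂ x u₂ ω₂)
    (hE₁ : IsConnector H E₁ u₂ p ε₁) (hE₂ : IsConnector H E₂ u₂ q ε₂)
    (hE₃ : IsConnector H E₃ p q ε₃)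
    (hQ : IsConnector H Q p z₁ ωQ) (hZ : IsTripod H Z u₁ z₁ z₂) (hR : IsConnector H R z₂ y ωR)
    (hE₅ : IsConnector H E₅ q y ε₅)
    (hX : X.val = {x} + {u₂} + {y} + {p} + {q} + D₁ + D₂ + E₁ + E₂ + E₃ + Q + Z.val + R + E₅)
    (hw : weight H X = ω₁ + ω₂ + ε₁ + ε₂ + ε₃ + ωQ + weight H Z + ωR + ε₅ + 2) :
    ∃ A : ℕ, Route H X.val x y A ∧ 2 * (A : ℤ) + 3 ≤ weight H X := by
  have hc := congrArg Multiset.card hX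
  simp only [Multiset.card_add, Multiset.card_singleton, Finset.card_val] at hc
  obtain ⟨A₁, B₁, L₁, C₁, h₁, h₁'⟩ := hD₁.bounds IH (by omega)
  obtain ⟨A₂, B₂, L₂, C₂, h₂, h₂'⟩ := hD₂.bounds IH (by omega)
  obtain ⟨A₃, B₃, L₃, C₃, h₃, h₃'⟩ := hE₁.bounds IH (by omega)
  obtain ⟨A₄, B₄, L₄, C₄, h₄, h₄'⟩ := hE₂.bounds IH (by omega)
  obtain ⟨A₅, B₅, L₅, C₅, h₅, h₅'⟩ := hE₃.bounds IH (by omega)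
  obtain ⟨A₆, B₆, L₆, C₆, h₆, h₆'⟩ := hQ.bounds IH (by omega)
  obtain ⟨A₇, B₇, L₇, C₇, h₇, h₇'⟩ := hR.bounds IH (by omega)
  obtain ⟨A₈, B₈, L₈, C₈, h₈, h₈'⟩ := hE₅.bounds IH (by omega)
  obtain ⟨A, A', A'', r, r', r'', h, h', h''⟩ := hZ.bounds IH (by omega)
  refine Route.exists_le
    (((((((((Route.single x).link L₁ r').link L₆.symm (.single p)).link L₃.symm (.single u₂)).link
      L₄ (.single q)).link L₈ (.single y)).add_cover C₂).add_cover C₇).add_cover C₅ |>.congr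
      (by rw [hX]; abel))
    (((((((((Route.single x).link L₂ (.single u₂)).link L₄ (.single q)).link L₅.symm
      (.single p)).link L₆ r).link L₇ (.single y)).add_cover C₈).add_cover C₁).add_cover C₃ |>.congr
      (by rw [hX]; abel)) ?_
  push_cast
  linarith

/-- Routes through a block with a `K₄` structure. -/
theorem exists_route_kFour {X Y : Finset V} {D₁ D₂ : Multiset V} {ω₁ ω₂ : ℤ} {x y u₁ u₂ : V}
    (IH : ∀ Z z w, Z.card < X.card → IsPole H Z z w → IsGood H Z z w)
    (hD₁ : IsConnector H D₁ x u₁ ω₁) (hD₂ : IsConnector H D₂ x u₂ ω₂)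
    (hX : X.val = {x} + Y.val + D₁ + D₂) (hw : weight H X = ω₁ + weight H Y + ω₂)
    (hY : IsKFour H Y u₂ y) (hu₁ : u₁ ∈ Y) (hne₂ : u₁ ≠ u₂) (hne : u₁ ≠ y)
    (hdeg : degIn H Y u₁ ≤ 2) :
    ∃ A : ℕ, Route H X.val x y A ∧ 2 * (A : ℤ) + 3 ≤ weight H X := by
  obtain ⟨p, q, E₁, E₂, E₃, E₄, E₅, ε₁, ε₂, ε₃, ε₄, ε₅, hE₁, hE₂, hE₃, hE₄, hE₅, hY, hwY⟩ := hY
  have hadj : ∀ {D : Multiset V} {s t : V} {ω : ℤ}, IsConnector H D s t ω →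
      ∃ w ∈ {t} + D, H.Adj s w := by
    intro D s t ω h
    obtain ⟨w, hw, h⟩ := h.exists_adj_left
    exact ⟨w, by simpa using hw, h⟩
  have hp : u₁ ≠ p := by
    rintro rfl
    have := three_le_degIn (E := {u₁} + E₂ + E₅) (by rw [hY]; abel) (hadj hE₁.symm) (hadj hE₃)
      (hadj hE₄)
    omega
  have hq : u₁ ≠ q := by
    rintro rfl
    have := three_le_degIn (E := {u₁} + E₁ + E₄) (by rw [hY]; abel) (hadj hE₂.symm)
      (hadj hE₃.symm) (hadj hE₅)
    omega
  have hmem : (((u₁ ∈ E₁ ∨ u₁ ∈ E₂) ∨ u₁ ∈ E₃) ∨ u₁ ∈ E₄) ∨ u₁ ∈ E₅ := by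
    rw [← Finset.mem_val, hY] at hu₁
    simpa [hne₂, hne, hp, hq, or_assoc] using hu₁
  rcases hmem with (((h | h) | h) | h) | h
  · obtain ⟨Q, Z, R, z₁, z₂, ωQ, ωR, rfl, hQ, hZ, hR, rfl⟩ :=
      hE₁.split_tripod (E := {u₂} + {y} + {p} + {q} + E₂ + E₃ + E₄ + E₅) h (by rw [hY]; abel)
        (by simp) (by simp) hdeg
    exact exists_route_kFour_left IH hD₁ hD₂ hQ hZ hR hE₂ hE₃ hE₄ hE₅
      (by rw [hX, hY]; abel) (by rw [hw, hwY]; ring)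
  · obtain ⟨Q, Z, R, z₁, z₂, ωQ, ωR, rfl, hQ, hZ, hR, rfl⟩ :=
      hE₂.split_tripod (E := {u₂} + {y} + {p} + {q} + E₁ + E₃ + E₄ + E₅) h (by rw [hY]; abel)
        (by simp) (by simp) hdeg
    exact exists_route_kFour_left IH hD₁ hD₂ hQ hZ hR hE₁ hE₃.symm hE₅ hE₄
      (by rw [hX, hY]; abel) (by rw [hw, hwY]; ring)
  · obtain ⟨Q, Z, R, z₁, z₂, ωQ, ωR, rfl, hQ, hZ, hR, rfl⟩ :=
      hE₃.split_tripod (E := {u₂} + {y} + {p} + {q} + E₁ + E₂ + E₄ + E₅) h (by rw [hY]; abel)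
        (by simp) (by simp) hdeg
    exact exists_route_kFour_inner IH hD₁ hD₂ hE₁ hE₂ hQ hZ hR hE₄ hE₅
      (by rw [hX, hY]; abel) (by rw [hw, hwY]; ring)
  · obtain ⟨Q, Z, R, z₁, z₂, ωQ, ωR, rfl, hQ, hZ, hR, rfl⟩ :=
      hE₄.split_tripod (E := {u₂} + {y} + {p} + {q} + E₁ + E₂ + E₃ + E₅) h (by rw [hY]; abel)
        (by simp) (by simp) hdeg
    exact exists_route_kFour_right IH hD₁ hD₂ hE₁ hE₂ hE₃ hQ hZ hR hE₅
      (by rw [hX, hY]; abel) (by rw [hw, hwY]; ring)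
  · obtain ⟨Q, Z, R, z₁, z₂, ωQ, ωR, rfl, hQ, hZ, hR, rfl⟩ :=
      hE₅.split_tripod (E := {u₂} + {y} + {p} + {q} + E₁ + E₂ + E₃ + E₄) h (by rw [hY]; abel)
        (by simp) (by simp) hdeg
    exact exists_route_kFour_right IH hD₁ hD₂ hE₂ hE₁ hE₃.symm hQ hZ hR hE₄
      (by rw [hX, hY]; abel) (by rw [hw, hwY]; ring)

/-- Routes through a block attached by three connectors, two of which lead to `x`. -/
theorem exists_route_pole {X Y : Finset V} {D₁ D₂ : Multiset V} {ω₁ ω₂ : ℤ} {x y u₁ u₂ : V}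
    {B₁ A₂ : ℕ} (IH : ∀ Z z w, Z.card < X.card → IsPole H Z z w → IsGood H Z z w)
    (hD₁ : IsConnector H D₁ x u₁ ω₁) (hD₂ : IsConnector H D₂ x u₂ ω₂)
    (hX : X.val = {x} + Y.val + D₁ + D₂) (hw : weight H X = ω₁ + weight H Y + ω₂)
    (hY : IsPole H Y u₂ y) (hY' : IsPole H Y u₁ y) (hne₂ : u₁ ≠ u₂)
    (hB₁ : Cover H D₁ B₁) (hA₂ : Link H D₂ x u₂ A₂) (hAB : 2 * ((B₁ : ℤ) + A₂) ≤ ω₁ + ω₂) :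
    ∃ A : ℕ, Route H X.val x y A ∧ 2 * (A : ℤ) + 2 ≤ weight H X ∧
      (IsKFour H X x y ∨ 2 * (A : ℤ) + 3 ≤ weight H X) := by
  have hc := congrArg Multiset.card hX
  simp only [Multiset.card_add, Multiset.card_singleton, Finset.card_val] at hc
  obtain ⟨A, -, hA, -, -, -, hgood⟩ := IH Y u₂ y (by omega) hY
  rcases hgood with ⟨P, P', ωP, ωP', hP, hP', hYP, hwY⟩ | ⟨hK, -⟩ | hA'
  · have hmem : u₁ ∈ P ∨ u₁ ∈ P' := by
      have h := hY'.left_mem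
      rw [← Finset.mem_val, hYP] at h
      simpa [hne₂, hY'.ne] using h
    rcases hmem with h | h
    · exact exists_route_theta IH hD₁ hD₂ hX hw hP hP' hYP hwY h hY'.deg_left
    · exact exists_route_theta IH hD₁ hD₂ hX hw hP' hP (by rw [hYP]; abel) (by rw [hwY]; ring) h
        hY'.deg_left
  · obtain ⟨k, hk, hk'⟩ :=
      exists_route_kFour IH hD₁ hD₂ hX hw hK hY'.left_mem hne₂ hY'.ne hY'.deg_left
    exact ⟨k, hk, by omega, .inr hk'⟩
  · refine ⟨0 + A₂ + A + B₁, (((Route.single x).link hA₂ hA).add_cover hB₁).congr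
      (by rw [hX]; abel), ?_, .inr ?_⟩ <;> push_cast <;> omega

/-- Every block with two distinguished vertices of degree two is good. -/
theorem IsPole.isGood {X : Finset V} {x y : V} (h : IsPole H X x y) : IsGood H X x y := by
  induction hn : X.card using Nat.strong_induction_on generalizing X x y with
  | _ n ih =>
    subst hn
    have IH : ∀ Z z w, Z.card < X.card → IsPole H Z z w → IsGood H Z z w :=
      fun Z z w hZ hp => ih Z.card hZ hp rfl
    obtain ⟨a, b, hab, hxa, hxb, hM, hwM⟩ := h.isBlock.erase h.left_mem h.deg_left
    have hstr := hM.isString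
    have hXM : X.val = (X.erase x).val + {x} := by
      rw [← Multiset.cons_erase h.left_mem, Finset.erase_val, add_comm, Multiset.singleton_add]
    have hc := congrArg Multiset.card hXM
    simp only [Multiset.card_add, Multiset.card_singleton, Finset.card_val] at hc
    have hyM : y ∈ (X.erase x).val :=
      Finset.mem_erase.2 ⟨h.ne.symm, h.right_mem⟩
    have hcon : IsConnector H (X.erase x).val x x (weight H (X.erase x)) :=
      .inr ⟨a, b, hstr, hxa, hxb.symm⟩
    obtain ⟨D₁, Y, D₂, u₁, u₂, ω₁, ω₂, hM', hD₁, hY, hD₂, hwY⟩ :=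
      hcon.split_tripod hyM hXM (by simp) (by simp) h.deg_right
    replace hD₂ := hD₂.symm
    have hc' := congrArg Multiset.card hM'
    simp only [Multiset.card_add, Finset.card_val] at hc'
    rw [hwM] at hwY
    have hX : X.val = {x} + Y.val + D₁ + D₂ := by rw [hXM, hM']; abel
    obtain ⟨A₁, B₁, L₁, C₁, h₁, h₁', h₁''⟩ := hD₁.bounds_of_ne IH (by omega)
    obtain ⟨A₂, B₂, L₂, C₂, h₂, h₂', h₂''⟩ := hD₂.bounds_of_ne IH (by omega)
    rcases hY with ⟨rfl, rfl, rfl⟩ | ⟨hY₁, hY₂, hY₃⟩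
    · rw [Finset.singleton_val] at hX
      rw [weight_singleton] at hwY
      have hT : IsTheta H X x u₂ := ⟨D₁, D₂, ω₁, ω₂, hD₁, hD₂, hX, by rw [hwY]; ring⟩
      have r₁ : Route H X.val x u₂ (0 + A₁ + 0 + B₂) :=
        (((Route.single x).link L₁ (.single u₂)).add_cover C₂).congr (by rw [hX]; abel)
      have r₂ : Route H X.val x u₂ (0 + A₂ + 0 + B₁) :=
        (((Route.single x).link L₂ (.single u₂)).add_cover C₁).congr (by rw [hX]; abel)
      obtain ⟨hcov, hlt⟩ : Cover H X.val (A₁ + A₂ + 2) ∧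
          (2 * (A₁ : ℤ) + 1 ≤ ω₁ ∨ 2 * (A₂ : ℤ) + 1 ≤ ω₂) := by
        by_cases h0 : D₁ = 0
        · by_cases h0' : D₂ = 0
          · refine absurd ?_ hab
            have : (X.erase x).card ≤ 1 := by rw [hc', h0, h0']; simp
            exact Finset.card_le_one.1 this a hM.left_mem b hM.right_mem
          · refine ⟨?_, .inr (h₂'' h0')⟩
            have := L₂.cover L₁ h0'
            convert this using 1
            · rw [hX]; abel
            · ring
        · exact ⟨by rw [hX]; exact L₁.cover L₂ h0, .inl (h₁'' h0)⟩
      rcases le_total (A₁ + B₂) (A₂ + B₁) with hle | hle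
      · exact ⟨_, _, r₁, hcov, by push_cast; omega, by push_cast; omega, .inl hT⟩
      · exact ⟨_, _, r₂, hcov, by push_cast; omega, by push_cast; omega, .inl hT⟩
    · obtain ⟨A, hA, hA2, hA3⟩ : ∃ A : ℕ, Route H X.val x y A ∧ 2 * (A : ℤ) + 2 ≤ weight H X ∧
          (IsKFour H X x y ∨ 2 * (A : ℤ) + 3 ≤ weight H X) := by
        rcases le_total (B₁ + A₂) (B₂ + A₁) with hle | hle
        · exact exists_route_pole IH hD₁ hD₂ hX hwY hY₂.symm hY₁.symm hY₃.ne C₁ L₂ (by omega)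
        · exact exists_route_pole IH hD₂ hD₁ (by rw [hX]; abel) (by rw [hwY]; ring) hY₁.symm
            hY₂.symm hY₃.ne.symm C₂ L₁ (by omega)
      obtain ⟨A', B', hA', hB', hAB, -⟩ := hstr.bounds IH (by rw [Finset.card_val]; omega)
      have c₁ : Cover H X.val (A' + 2) := by
        rw [hXM]; exact hA'.close hab hxb.symm hxa
      have c₂ : Cover H X.val (B' + 1) := by
        rw [hXM]; exact hB'.add (.isolated x)
      have hA3' : IsTheta H X x y ∨ (IsKFour H X x y ∧ 2 * (A : ℤ) + 2 ≤ weight H X) ∨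
          2 * (A : ℤ) + 3 ≤ weight H X := by tauto
      rw [hwM] at hAB
      rcases le_total (A' + 2) (B' + 1) with hle | hle
      · exact ⟨A, _, hA, c₁, by push_cast; omega, by omega, hA3'⟩
      · exact ⟨A, _, hA, c₂, by push_cast; omega, by omega, hA3'⟩

end Routing

section DeleteEdge

theorem degIn_le_of_le {H G : SimpleGraph V} (hHG : H ≤ G) (T : Finset V) (u : V) :
    degIn H T u ≤ degIn G T u := by
  classical
  exact Finset.card_le_card (Finset.monotone_filter_right _ fun w _ hw => hHG hw)

theorem crossing_le_of_le {H G : SimpleGraph V} (hHG : H ≤ G) (S T : Finset V) :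
    crossing H S T ≤ crossing G S T :=
  Finset.sum_le_sum fun u _ => degIn_le_of_le hHG T u

theorem degIn_lt_of_le {H G : SimpleGraph V} (hHG : H ≤ G) {T : Finset V} {x y : V}
    (hxy : G.Adj x y) (hnot : ¬ H.Adj x y) (hy : y ∈ T) : degIn H T x < degIn G T x := by
  classical
  refine Finset.card_lt_card (Finset.ssubset_iff_of_subset
    (Finset.monotone_filter_right _ fun w _ hw => hHG hw) |>.2 ⟨y, ?_, ?_⟩)
  · simp [hy, hxy]
  · simp [hnot]

theorem crossing_deleteEdges_lt {G : SimpleGraph V} {S T : Finset V} {x y : V} (hxy : G.Adj x y)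
    (hx : x ∈ S) (hy : y ∈ T) : crossing (G.deleteEdges {s(x, y)}) S T < crossing G S T :=
  Finset.sum_lt_sum (fun u _ => degIn_le_of_le (G.deleteEdges_le _) T u)
    ⟨x, hx, degIn_lt_of_le (G.deleteEdges_le _) hxy (by simp) hy⟩

theorem crossing_le_deleteEdges [DecidableEq V] (G : SimpleGraph V) (S T : Finset V) (x y : V) :
    crossing G S T ≤ crossing (G.deleteEdges {s(x, y)}) S T +
      (if x ∈ S then if y ∈ T then 1 else 0 else 0) +
      (if y ∈ S then if x ∈ T then 1 else 0 else 0) := by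
  classical
  have hadj : ∀ u w, (G.deleteEdges {s(x, y)}).Adj u w ↔ G.Adj u w ∧ s(u, w) ≠ s(x, y) :=
    fun u w => by rw [deleteEdges_adj, Set.mem_singleton_iff]
  generalize G.deleteEdges {s(x, y)} = H at *
  have key : ∀ u, degIn G T u ≤ degIn H T u +
      (if x = u then if y ∈ T then 1 else 0 else 0) +
      (if y = u then if x ∈ T then 1 else 0 else 0) := by
    intro u
    have hsub : T.filter (G.Adj u) ⊆ (T.filter (H.Adj u) ∪
        (if x = u then if y ∈ T then {y} else ∅ else ∅)) ∪
        (if y = u then if x ∈ T then {x} else ∅ else ∅) := by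
      intro w hw
      obtain ⟨hwT, huw⟩ := Finset.mem_filter.1 hw
      by_cases h : s(u, w) = s(x, y)
      · rcases Sym2.eq_iff.1 h with ⟨rfl, rfl⟩ | ⟨rfl, rfl⟩ <;> simp [hwT]
      · exact Finset.mem_union_left _ (Finset.mem_union_left _
          (Finset.mem_filter.2 ⟨hwT, (hadj _ _).2 ⟨huw, h⟩⟩))
    refine (Finset.card_le_card hsub).trans ((Finset.card_union_le _ _).trans
      (Nat.add_le_add ((Finset.card_union_le _ _).trans (Nat.add_le_add le_rfl ?_)) ?_))
    · split_ifs <;> simp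
    · split_ifs <;> simp
  calc crossing G S T ≤ _ := Finset.sum_le_sum fun u _ => key u
    _ = _ := by
      rw [Finset.sum_add_distrib, Finset.sum_add_distrib, Finset.sum_ite_eq, Finset.sum_ite_eq]
      rfl

theorem weight_le_of_le [DecidableEq V] {H G : SimpleGraph V} (hHG : H ≤ G) (X : Finset V) :
    weight G X ≤ weight H X := by
  have h1 := two_mul_weight (H := H) X
  have h2 := two_mul_weight (H := G) X
  have := crossing_le_of_le hHG X X
  omega

end DeleteEdge

section Counting

variable [DecidableEq V] {H : SimpleGraph V}

theorem IsBlock.two_lt_card {X : Finset V} (h : IsBlock H X) : 2 < X.card := by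
  obtain ⟨v, hv⟩ := Finset.card_pos.1 (zero_lt_two.trans_le h.two_le_card)
  classical
  have h1 : degIn H X v < X.card := Finset.card_lt_card
    ((Finset.ssubset_iff_of_subset (Finset.filter_subset _ _)).2 ⟨v, hv, by simp⟩)
  have := h.two_le_degIn hv
  omega

theorem IsString.card_lt {N : ℕ}
    (hw : ∀ X : Finset V, X.Nonempty → X.card < N → (X.card : ℤ) < 2 * weight H X)
    {D : Multiset V} {x y : V} {ω : ℤ} (h : IsString H D x y ω) (hD : D.card < N) :
    (D.card : ℤ) < 2 * ω := by
  induction h with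
  | single h => exact hw _ ⟨_, h.left_mem⟩ hD
  | append h huv h' ih ih' =>
    rw [Multiset.card_add] at hD
    have := ih (by omega)
    have := ih' (by omega)
    push_cast [Multiset.card_add]
    omega

theorem IsConnector.card_le {N : ℕ}
    (hw : ∀ X : Finset V, X.Nonempty → X.card < N → (X.card : ℤ) < 2 * weight H X)
    {D : Multiset V} {s t : V} {ω : ℤ} (h : IsConnector H D s t ω) (hD : D.card < N) :
    (D.card : ℤ) ≤ 2 * ω ∧ (2 * ω ≤ D.card → D.card = 0) := by
  rcases h with ⟨rfl, rfl, -⟩ | ⟨c, d, h, -, -⟩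
  · simp
  · have := h.card_lt hw hD
    exact ⟨this.le, fun h' => by omega⟩

theorem IsTheta.card_eq {X : Finset V} {x y : V} (h : IsTheta H X x y)
    (hw : ∀ Y : Finset V, Y.Nonempty → Y.card < X.card → (Y.card : ℤ) < 2 * weight H Y)
    (hX : 2 * weight H X ≤ X.card) : X.card = 2 := by
  obtain ⟨D₁, D₂, ω₁, ω₂, h₁, h₂, hval, hwX⟩ := h
  have hc := congrArg Multiset.card hval
  simp only [Multiset.card_add, Multiset.card_singleton, Finset.card_val] at hc
  obtain ⟨a₁, b₁⟩ := h₁.card_le hw (by omega)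
  obtain ⟨a₂, b₂⟩ := h₂.card_le hw (by omega)
  have := b₁ (by omega)
  have := b₂ (by omega)
  omega

theorem IsKFour.card_eq {X : Finset V} {x y : V} (h : IsKFour H X x y)
    (hw : ∀ Y : Finset V, Y.Nonempty → Y.card < X.card → (Y.card : ℤ) < 2 * weight H Y)
    (hX : 2 * weight H X ≤ X.card) : X.card = 4 := by
  obtain ⟨p, q, E₁, E₂, E₃, E₄, E₅, ω₁, ω₂, ω₃, ω₄, ω₅, h₁, h₂, h₃, h₄, h₅, hval, hwX⟩ := h
  have hc := congrArg Multiset.card hval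
  simp only [Multiset.card_add, Multiset.card_singleton, Finset.card_val] at hc
  obtain ⟨a₁, b₁⟩ := h₁.card_le hw (by omega)
  obtain ⟨a₂, b₂⟩ := h₂.card_le hw (by omega)
  obtain ⟨a₃, b₃⟩ := h₃.card_le hw (by omega)
  obtain ⟨a₄, b₄⟩ := h₄.card_le hw (by omega)
  obtain ⟨a₅, b₅⟩ := h₅.card_le hw (by omega)
  have := b₁ (by omega)
  have := b₂ (by omega)
  have := b₃ (by omega)
  have := b₄ (by omega)
  have := b₅ (by omega)
  omega

end Counting

section Cubic

variable [Fintype V] {G : SimpleGraph V}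

theorem IsCubic.degIn_univ (h : IsCubic G) (v : V) : degIn G Finset.univ v = 3 := by
  classical
  rw [← h v, deg, degIn, Nat.card_eq_fintype_card, ← Set.toFinset_card]
  congr 1
  ext w
  simp

variable [DecidableEq V]

theorem IsCubic.degIn_add (h : IsCubic G) (X : Finset V) (v : V) :
    degIn G X v + degIn G (Finset.univ \ X) v = 3 := by
  rw [degIn_sdiff (Finset.subset_univ X), h.degIn_univ]

theorem IsCubic.two_mul_weight (h : IsCubic G) (X : Finset V) :
    2 * weight G X = X.card + crossing G X (Finset.univ \ X) - 2 := by
  have h1 : crossing G X X + crossing G X (Finset.univ \ X) = 3 * X.card := by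
    rw [crossing, crossing, ← Finset.sum_add_distrib,
      Finset.sum_congr rfl fun v _ => h.degIn_add X v]
    simp [mul_comm]
  have := _root_.two_mul_weight (H := G) X
  omega

theorem exists_adj_of_reachable {S : Finset V} {u v : V} (h : G.Reachable u v) (hu : u ∈ S)
    (hv : v ∉ S) : 1 ≤ crossing G S (Finset.univ \ S) := by
  obtain ⟨p⟩ := h
  obtain ⟨d, -, h1, h2⟩ := p.exists_boundary_dart (S : Set V) (by simpa using hu)
    (by simpa using hv)
  exact crossing_pos_iff.2 ⟨d.fst, by simpa using h1, d.snd, by simpa using h2, d.adj⟩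

theorem Bridgeless.two_le_crossing (h : Bridgeless G) (hconn : G.Connected) {S : Finset V}
    (hS : S.Nonempty) (hSu : S ≠ Finset.univ) : 2 ≤ crossing G S (Finset.univ \ S) := by
  obtain ⟨u, hu⟩ := hS
  obtain ⟨v, hv⟩ : ∃ v, v ∉ S := by
    by_contra hcon
    push Not at hcon
    exact hSu (Finset.eq_univ_iff_forall.2 hcon)
  obtain ⟨a, ha, b, hb, hab⟩ :=
    crossing_pos_iff.1 (exists_adj_of_reachable (hconn.preconnected u v) hu hv)
  have h1 := h s(a, b)
  rw [SimpleGraph.isBridge_iff, not_not] at h1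
  have h2 := exists_adj_of_reachable h1 ha (Finset.mem_sdiff.1 hb).2
  have h3 := crossing_deleteEdges_lt hab ha hb
  omega

/-- Each side of a cut with two edges is a segment. -/
theorem IsCubic.isSegment (h : IsCubic G)
    (hcut : ∀ S : Finset V, S.Nonempty → S ≠ Finset.univ → 2 ≤ crossing G S (Finset.univ \ S))
    {Z : Finset V} (hZ : crossing G Z (Finset.univ \ Z) = 2) {c d : V} (hc : c ∈ Z) (hd : d ∈ Z)
    (hcd : c ≠ d) (hc1 : 1 ≤ degIn G (Finset.univ \ Z) c)
    (hd1 : 1 ≤ degIn G (Finset.univ \ Z) d) : IsSegment G Z c d := by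
  have core : ∀ T ⊆ Z, T.Nonempty → d ∉ T →
      1 ≤ crossing G T (Z \ T) ∧ (c ∉ T → 2 ≤ crossing G T (Z \ T)) := by
    intro T hT hne hdT
    have h1 : crossing G T (Finset.univ \ T) =
        crossing G T (Z \ T) + crossing G T (Finset.univ \ Z) := by
      rw [← crossing_union_right (Finset.disjoint_of_subset_left Finset.sdiff_subset
        Finset.disjoint_sdiff)]
      congr 1
      ext w
      simp only [Finset.mem_sdiff, Finset.mem_union, Finset.mem_univ]
      have := @hT w
      tauto
    have h2 := hcut T hne (fun h' => hdT (h' ▸ Finset.mem_univ d))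
    have h3 : crossing G T (Finset.univ \ Z) + crossing G (Z \ T) (Finset.univ \ Z) = 2 := by
      rw [← crossing_union_left Finset.disjoint_sdiff, Finset.union_sdiff_of_subset hT, hZ]
    have h4 := degIn_le_crossing (H := G) (T := Finset.univ \ Z)
      (Finset.mem_sdiff.2 ⟨hd, hdT⟩)
    refine ⟨by omega, fun hcT => ?_⟩
    have h5 : crossing G {c, d} (Finset.univ \ Z) ≤ crossing G (Z \ T) (Finset.univ \ Z) := by
      refine Finset.sum_le_sum_of_subset ?_
      intro w hw
      rcases Finset.mem_insert.1 hw with rfl | hw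
      · simp [hc, hcT]
      · rw [Finset.mem_singleton.1 hw]; simp [hd, hdT]
    rw [crossing, Finset.sum_pair hcd] at h5
    omega
  refine ⟨hc, hd, fun w hw => ?_, fun T hT hne hTZ => ?_⟩
  · have h1 := h.degIn_add Z w
    split_ifs <;> subst_vars <;> first | omega | exact absurd rfl hcd
  · by_cases hdT : d ∈ T
    · have hne' : (Z \ T).Nonempty := Finset.sdiff_nonempty.2 fun h' => hTZ (hT.antisymm h')
      have := core (Z \ T) Finset.sdiff_subset hne' (by simp [hdT])
      rw [Finset.sdiff_sdiff_eq_self hT, crossing_comm] at this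
      exact ⟨this.1, fun h' => this.2 (by simp [h'.2 hdT])⟩
    · have := core T hT hne hdT
      exact ⟨this.1, fun h' => this.2 (by tauto)⟩

/-- A vertex is incident with at most one edge of a cut with two edges. -/
theorem IsCubic.degIn_le_one (h : IsCubic G)
    (hcut : ∀ S : Finset V, S.Nonempty → S ≠ Finset.univ → 2 ≤ crossing G S (Finset.univ \ S))
    {Z : Finset V} (hZ : crossing G Z (Finset.univ \ Z) = 2) {v : V} (hv : v ∈ Z) :
    degIn G (Finset.univ \ Z) v ≤ 1 := by
  by_contra hcon
  have h1 := h.degIn_add Z v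
  have hvZ : {v} ⊆ Z := by simpa using hv
  have h3 : degIn G (Finset.univ \ Z) v + crossing G (Z \ {v}) (Finset.univ \ Z) = 2 := by
    rw [← crossing_singleton_left, ← crossing_union_left Finset.disjoint_sdiff,
      Finset.union_sdiff_of_subset hvZ, hZ]
  have h4 : degIn G (Z \ {v}) v = 1 := by
    have := degIn_sdiff (H := G) hvZ v
    rw [degIn_singleton_self] at this
    omega
  obtain ⟨w, hw, -⟩ := degIn_pos_iff.1 h4.ge
  have h5 := hcut (Z \ {v}) ⟨w, hw⟩ (fun h' => by
    have := Finset.mem_univ v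
    rw [← h'] at this
    simp at this)
  have h6 : crossing G (Z \ {v}) (Finset.univ \ (Z \ {v})) =
      crossing G (Z \ {v}) (Finset.univ \ Z) + crossing G (Z \ {v}) {v} := by
    rw [← crossing_union_right (by simp [hv])]
    congr 1
    ext w
    by_cases hw : w = v
    · subst hw; simp
    · simp [hw]
  rw [crossing_singleton_right, h4] at h6
  omega

/-- The two edges of a cut with two edges are disjoint. -/
theorem IsCubic.exists_edges (h : IsCubic G)
    (hcut : ∀ S : Finset V, S.Nonempty → S ≠ Finset.univ → 2 ≤ crossing G S (Finset.univ \ S))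
    {Z : Finset V} (hZ : crossing G Z (Finset.univ \ Z) = 2) :
    ∃ c ∈ Z, ∃ d ∈ Z, ∃ s ∈ Finset.univ \ Z, ∃ t ∈ Finset.univ \ Z, c ≠ d ∧ s ≠ t ∧ G.Adj c s ∧
      G.Adj d t := by
  obtain ⟨c, hc, s, hs, hcs⟩ := crossing_pos_iff.1 (hZ.symm ▸ one_le_two)
  have hcZ : {c} ⊆ Z := by simpa using hc
  have h1 : degIn G (Finset.univ \ Z) c + crossing G (Z \ {c}) (Finset.univ \ Z) = 2 := by
    rw [← crossing_singleton_left, ← crossing_union_left Finset.disjoint_sdiff,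
      Finset.union_sdiff_of_subset hcZ, hZ]
  have h2 := h.degIn_le_one hcut hZ hc
  obtain ⟨d, hd, t, ht, hdt⟩ := crossing_pos_iff.1
    (show 1 ≤ crossing G (Z \ {c}) (Finset.univ \ Z) by omega)
  obtain ⟨hdZ, hdc⟩ := Finset.mem_sdiff.1 hd
  have hcd : c ≠ d := fun h' => hdc (by simp [h'])
  refine ⟨c, hc, d, hdZ, s, hs, t, ht, hcd, ?_, hcs, hdt⟩
  rintro rfl
  have h3 := h.degIn_le_one hcut (Z := Finset.univ \ Z)
    (by rw [Finset.sdiff_sdiff_eq_self (Finset.subset_univ Z), crossing_comm, hZ]) hs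
  rw [Finset.sdiff_sdiff_eq_self (Finset.subset_univ Z)] at h3
  classical
  have h4 : ({c, d} : Finset V) ⊆ Z.filter (G.Adj s) := by
    intro w hw
    rcases Finset.mem_insert.1 hw with rfl | hw
    · simp [hc, hcs.symm]
    · rw [Finset.mem_singleton.1 hw]; simp [hdZ, hdt.symm]
  have h5 := Finset.card_le_card h4
  rw [Finset.card_pair hcd] at h5
  exact absurd (h5.trans h3) (by norm_num)

/-- The case of a graph all of whose nontrivial cuts have at least three edges. -/
theorem exists_cover_of_three_le_crossing (h : IsCubic G) (hn : 8 ≤ Fintype.card V)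
    (hcut : ∀ S : Finset V, S.Nonempty → S ≠ Finset.univ → 3 ≤ crossing G S (Finset.univ \ S)) :
    ∃ k : ℕ, Cover G Finset.univ.val k ∧ 4 * k ≤ Fintype.card V + 2 := by
  obtain ⟨x⟩ : Nonempty V := Fintype.card_pos_iff.1 (by omega)
  obtain ⟨y, -, hxy⟩ := degIn_pos_iff.1 (show 1 ≤ degIn G Finset.univ x by rw [h.degIn_univ]; omega)
  have hle : G.deleteEdges {s(x, y)} ≤ G := G.deleteEdges_le _
  have hnadj : ¬ (G.deleteEdges {s(x, y)}).Adj x y := by simp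
  have hx := degIn_lt_of_le hle hxy hnadj (Finset.mem_univ y)
  have hy := degIn_lt_of_le hle hxy.symm (fun h' => hnadj h'.symm) (Finset.mem_univ x)
  have hcr := crossing_le_deleteEdges G Finset.univ Finset.univ x y
  have hcr' := crossing_le_deleteEdges G (V := V) (x := x) (y := y)
  generalize G.deleteEdges {s(x, y)} = H at *
  rw [h.degIn_univ] at hx hy
  have hpole : IsPole H Finset.univ x y := by
    refine ⟨⟨by rw [Finset.card_univ]; omega, fun v _ => ?_, fun S _ hne hS => ?_⟩,
      Finset.mem_univ x, Finset.mem_univ y, hxy.ne, by omega, by omega⟩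
    · exact (degIn_le_of_le hle _ v).trans (h.degIn_univ v).le
    · have h1 := hcut S hne hS
      have h2 := hcr' S (Finset.univ \ S)
      simp only [Finset.mem_sdiff, Finset.mem_univ, true_and] at h2
      split_ifs at h2 <;> omega
  have hw : 2 * weight H Finset.univ ≤ (Finset.univ : Finset V).card := by
    have h1 := two_mul_weight (H := H) Finset.univ
    have h2 : crossing G Finset.univ Finset.univ = 3 * (Finset.univ : Finset V).card := by
      rw [crossing, Finset.sum_congr rfl fun v _ => h.degIn_univ v]
      simp [mul_comm]
    simp at hcr
    omega
  have hsmall : ∀ Y : Finset V, Y.Nonempty → Y.card < (Finset.univ : Finset V).card →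
      (Y.card : ℤ) < 2 * weight H Y := by
    intro Y hY hcard
    have h1 := hcut Y hY (by rintro rfl; omega)
    have h2 := h.two_mul_weight Y
    have h3 := weight_le_of_le hle Y
    omega
  obtain ⟨A, -, ⟨P, R, hP, hR, hPR⟩, -, -, -, hgood⟩ := hpole.isGood
  rw [Finset.card_univ] at hw
  have hA : 2 * (A : ℤ) + 3 ≤ weight H Finset.univ := by
    rcases hgood with hT | ⟨hK, -⟩ | hA
    · have := hT.card_eq hsmall (by rwa [Finset.card_univ])
      rw [Finset.card_univ] at this
      omega
    · have := hK.card_eq hsmall (by rwa [Finset.card_univ])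
      rw [Finset.card_univ] at this
      omega
    · exact hA
  have h3 : 3 ≤ P.card := by
    rcases hP.card_cases with ⟨h', -⟩ | ⟨h', -⟩ | h'
    exacts [absurd h' hxy.ne, absurd h' hnadj, h']
  refine ⟨2 + A, ?_, by omega⟩
  rw [hPR]
  exact (Cover.circuit (hP.mono hle) hxy.symm h3).add (hR.mono hle)

/-- The case of a graph with a cut of two edges. -/
theorem exists_cover_of_crossing_eq_two (h : IsCubic G)
    (hcut : ∀ S : Finset V, S.Nonempty → S ≠ Finset.univ → 2 ≤ crossing G S (Finset.univ \ S))
    (hex : ∃ S : Finset V, crossing G S (Finset.univ \ S) = 2) :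
    ∃ k : ℕ, Cover G Finset.univ.val k ∧ 4 * k ≤ Fintype.card V + 2 := by
  obtain ⟨D, hD, hmin⟩ := Set.exists_min_image {S : Finset V | crossing G S (Finset.univ \ S) = 2}
    Finset.card (Set.toFinite _) hex
  simp only [Set.mem_ofPred_eq] at hD hmin
  obtain ⟨c, hc, d, hd, s, hs, t, ht, hcd, hst, hcs, hdt⟩ := h.exists_edges hcut hD
  have hc1 : 1 ≤ degIn G (Finset.univ \ D) c := degIn_pos_iff.2 ⟨s, hs, hcs⟩
  have hd1 : 1 ≤ degIn G (Finset.univ \ D) d := degIn_pos_iff.2 ⟨t, ht, hdt⟩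
  have hseg := h.isSegment hcut hD hc hd hcd hc1 hd1
  have hDD : Finset.univ \ (Finset.univ \ D) = D :=
    Finset.sdiff_sdiff_eq_self (Finset.subset_univ D)
  have hD' : crossing G (Finset.univ \ D) (Finset.univ \ (Finset.univ \ D)) = 2 := by
    rw [hDD, crossing_comm, hD]
  have hseg' : IsSegment G (Finset.univ \ D) s t := by
    refine h.isSegment hcut hD' hs ht hst ?_ ?_ <;> rw [hDD]
    · exact degIn_pos_iff.2 ⟨c, hc, hcs.symm⟩
    · exact degIn_pos_iff.2 ⟨d, hd, hdt.symm⟩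
  have hsmall : ∀ Y : Finset V, Y.Nonempty → Y.card < D.card → (Y.card : ℤ) < 2 * weight G Y := by
    intro Y hY hcard
    have h1 := hcut Y hY (by
      rintro rfl
      exact absurd (Finset.card_le_univ D) (by rw [← Finset.card_univ]; omega))
    have h2 := h.two_mul_weight Y
    have h3 : crossing G Y (Finset.univ \ Y) ≠ 2 := fun h' => by
      have := hmin Y h'
      omega
    omega
  have hblock : IsBlock G D := by
    refine ⟨?_, fun v hv => ?_, fun T hT hne hTD => ?_⟩
    · rw [← Finset.card_pair hcd]
      refine Finset.card_le_card fun w hw => ?_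
      rcases Finset.mem_insert.1 hw with rfl | hw
      · exact hc
      · rwa [Finset.mem_singleton.1 hw]
    · have := h.degIn_add D v
      omega
    · by_contra hlt
      have h0 := (hseg.cut T hT hne hTD).2
      have h1 : crossing G T (Finset.univ \ T) =
          crossing G T (D \ T) + crossing G T (Finset.univ \ D) := by
        rw [← crossing_union_right (Finset.disjoint_of_subset_left Finset.sdiff_subset
          Finset.disjoint_sdiff)]
        congr 1
        ext w
        simp only [Finset.mem_sdiff, Finset.mem_union, Finset.mem_univ]
        have := @hT w
        tauto
      have h2 : crossing G T (Finset.univ \ D) + crossing G (D \ T) (Finset.univ \ D) = 2 := by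
        rw [← crossing_union_left Finset.disjoint_sdiff, Finset.union_sdiff_of_subset hT, hD]
      have h3 : 1 ≤ crossing G (D \ T) (Finset.univ \ D) := by
        by_cases hcT : c ∈ T
        · exact hd1.trans (degIn_le_crossing (Finset.mem_sdiff.2 ⟨hd, by tauto⟩))
        · exact hc1.trans (degIn_le_crossing (Finset.mem_sdiff.2 ⟨hc, hcT⟩))
      have hlt' := Finset.card_lt_card (hT.ssubset_of_ne hTD)
      have h4 := hcut T hne (by
        rintro rfl
        exact hTD (hT.antisymm (Finset.subset_univ D)))
      have := hmin T (by omega)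
      omega
  have hpole : IsPole G D c d := by
    have h1 := h.degIn_add D c
    have h2 := h.degIn_add D d
    exact ⟨hblock, hc, hd, hcd, by omega, by omega⟩
  have hwD := h.two_mul_weight D
  have hwD' := h.two_mul_weight (Finset.univ \ D)
  rw [hD] at hwD
  rw [hD'] at hwD'
  have hcard := Finset.card_sdiff_add_card_eq_card (Finset.subset_univ D)
  rw [Finset.card_univ] at hcard
  obtain ⟨A, -, ⟨P, R, hP, hR, hPR⟩, -, -, -, hgood⟩ := hpole.isGood
  have hA : 2 * (A : ℤ) + 2 ≤ weight G D := by
    rcases hgood with hT | ⟨-, hA⟩ | hA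
    · have h1 := hT.card_eq hsmall (by omega)
      have := hblock.two_lt_card
      omega
    · exact hA
    · omega
  obtain ⟨A', -, ⟨P', R', hP', hR', hPR'⟩, -, -, hA'⟩ :=
    hseg'.isString.bounds (N := (Finset.univ \ D).val.card + 1) (fun Z z w _ hp => hp.isGood)
      (Nat.lt_succ_self _)
  have h3 : 3 ≤ (P + P').card := by
    rw [Multiset.card_add]
    rcases hP.card_cases with ⟨h', -⟩ | ⟨-, h'⟩ | h'
    · exact absurd h' hcd
    · rcases hP'.card_cases with ⟨-, h''⟩ | ⟨-, h''⟩ | h'' <;> omega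
    · omega
  refine ⟨2 + (A + A'), ?_, by omega⟩
  have huniv : (Finset.univ : Finset V).val = (P + P') + (R + R') := by
    rw [← add_tsub_cancel_of_le (Finset.val_le_iff.2 (Finset.subset_univ D)), ← Finset.sdiff_val,
      hPR, hPR']
    abel
  rw [huniv]
  exact (Cover.circuit (hP.append hdt hP'.symm) hcs.symm h3).add (hR.add hR')

end Cubic

/-- Every simple connected bridgeless cubic graph on `n ≥ 8` vertices has an even factor
`F` of cost `c(F) = n + 2 * |C_F| + |V_F|` at most `1.3 * n`. -/
theorem cubic_graph_cheap_even_factor {V : Type*} [Fintype V] (G : SimpleGraph V)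
    (hconn : G.Connected) (hcubic : IsCubic G) (hbridgeless : Bridgeless G)
    (hn : 8 ≤ Fintype.card V) :
    ∃ F : SimpleGraph V, IsEvenFactor G F ∧ cost F ≤ 1.3 * (Fintype.card V : ℝ) := by
  classical
  have hcut : ∀ S : Finset V, S.Nonempty → S ≠ Finset.univ →
      2 ≤ crossing G S (Finset.univ \ S) := fun S hS hSu =>
    hbridgeless.two_le_crossing hconn hS hSu
  obtain ⟨k, hk, hle⟩ : ∃ k : ℕ, Cover G Finset.univ.val k ∧ 4 * k ≤ Fintype.card V + 2 := by
    by_cases hex : ∃ S : Finset V, crossing G S (Finset.univ \ S) = 2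
    · exact exists_cover_of_crossing_eq_two hcubic hcut hex
    · refine exists_cover_of_three_le_crossing hcubic hn fun S hS hSu => ?_
      have h1 := hcut S hS hSu
      have h2 : crossing G S (Finset.univ \ S) ≠ 2 := fun h => hex ⟨S, h⟩
      omega
  obtain ⟨F, hF, hFk⟩ := hk.exists_isEvenFactor
  refine ⟨F, hF, ?_⟩
  have h1 : 10 * (2 * numCirc F + numIso F) ≤ 3 * Fintype.card V := by omega
  have h2 : (10 : ℝ) * (2 * numCirc F + numIso F) ≤ 3 * Fintype.card V := by exact_mod_cast h1
  rw [cost]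
  linarith
end
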